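/- Fix r ≥ 0, continuous bounded σ with a = σσ* strictly elliptic, and bounded Borel λ. The map x ↦ Q^{σ,λ}_{r,x} from ℝⁿ to probability measures on path space Ω^r is continuous for the weak topology: if x_n → x then Q^{σ,λ}_{r,x_n} → Q^{σ,λ}_{r,x} weakly. -/

import Mathlib

open MeasureTheory Filter Topology Matrix

/-- The path space `Ω^r` of continuous functions `[r,∞) → ℝⁿ`, endowed with the
topology of uniform convergence on compact sets (the compact-open topology). -/
abbrev PathSp (n : ℕ) (r : ℝ) := C(↥(Set.Ici r), Fin n → ℝ)

/-- The canonical coordinate process on `Ω^r`. -/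
def Xcan (n : ℕ) (r : ℝ) (u : ℝ) (ω : PathSp n r) : Fin n → ℝ :=
  ω ⟨max u r, le_max_right u r⟩

/-- The canonical filtration `B^r_s` on `Ω^r`, generated by `X_u`, `r ≤ u ≤ s`. -/
def canonFiltr (n : ℕ) (r : ℝ) (s : ℝ) : MeasurableSpace (PathSp n r) :=
  MeasurableSpace.comap (fun ω => fun u : Set.Icc r s => ω ⟨u.1, u.2.1⟩) inferInstance

/-- The exponential process of the martingale problem with diffusion `a = σσ*`
and drift `σλ`, started from `x` at time `r`. -/
noncomputable def MexpP (n : ℕ) (r : ℝ)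
    (σ : ℝ → (Fin n → ℝ) → Matrix (Fin n) (Fin n) ℝ)
    (l : ℝ → (Fin n → ℝ) → (Fin n → ℝ))
    (x θ : Fin n → ℝ) (u : ℝ) (ω : PathSp n r) : ℝ :=
  Real.exp (θ ⬝ᵥ (Xcan n r u ω - x)
    - (∫ v in Set.Ioc r u,
        θ ⬝ᵥ ((σ v (Xcan n r v ω)).mulVec (l v (Xcan n r v ω))))
    - (1 / 2) * ∫ v in Set.Ioc r u,
        θ ⬝ᵥ ((σ v (Xcan n r v ω) * (σ v (Xcan n r v ω))ᵀ).mulVec θ))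

/-- `P` solves the Stroock–Varadhan martingale problem on `Ω^r` for the
diffusion `a = σσ*` and drift `σλ`, starting from `x` at time `r`. -/
def SolvesMP (n : ℕ) (r : ℝ) [MeasurableSpace (PathSp n r)]
    (σ : ℝ → (Fin n → ℝ) → Matrix (Fin n) (Fin n) ℝ)
    (l : ℝ → (Fin n → ℝ) → (Fin n → ℝ))
    (x : Fin n → ℝ) (P : Measure (PathSp n r)) : Prop :=
  P {ω | ω ⟨r, le_refl r⟩ = x} = 1 ∧
  ∀ (θ : Fin n → ℝ) (s t : ℝ), r ≤ s → s ≤ t →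
    Integrable (MexpP n r σ l x θ t) P ∧
    ∀ A : Set (PathSp n r), MeasurableSet[canonFiltr n r s] A →
      ∫ ω in A, MexpP n r σ l x θ t ω ∂P = ∫ ω in A, MexpP n r σ l x θ s ω ∂P

/-- Smooth compactly supported functions. -/
def IsTest {E : Type*} [NormedAddCommGroup E] [NormedSpace ℝ E] (f : E → ℝ) : Prop :=
  ContDiff ℝ (⊤ : ℕ∞) f ∧ HasCompactSupport f

/-- Directional derivative. -/
noncomputable def dirD {E : Type*} [NormedAddCommGroup E] [NormedSpace ℝ E] (v : E)
    (f : E → ℝ) (z : E) : ℝ := fderiv ℝ f z v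

section test
variable {E : Type*} [NormedAddCommGroup E] [NormedSpace ℝ E]

lemma IsTest.continuous {f : E → ℝ} (hf : IsTest f) : Continuous f := hf.1.continuous

lemma IsTest.differentiable {f : E → ℝ} (hf : IsTest f) : Differentiable ℝ f :=
  hf.1.differentiable (by simp)

lemma contDiff_dirD {f : E → ℝ} (hf : ContDiff ℝ (⊤ : ℕ∞) f) (v : E) :
    ContDiff ℝ (⊤ : ℕ∞) (dirD v f) := by
  have h1 : ContDiff ℝ (⊤ : ℕ∞) (fderiv ℝ f) := hf.fderiv_right (by simp)
  exact h1.clm_apply contDiff_const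

lemma IsTest.dirD {f : E → ℝ} (hf : IsTest f) (v : E) : IsTest (dirD v f) :=
  ⟨contDiff_dirD hf.1 v, hf.2.fderiv_apply ℝ v⟩

lemma IsTest.bounded {f : E → ℝ} (hf : IsTest f) : ∃ C, 0 ≤ C ∧ ∀ z, |f z| ≤ C := by
  obtain ⟨C, hC⟩ := hf.2.exists_bound_of_continuous hf.continuous
  exact ⟨C, (norm_nonneg _).trans (hC 0), hC⟩

lemma IsTest.mul {f g : E → ℝ} (hf : ContDiff ℝ (⊤ : ℕ∞) f) (hg : IsTest g) :
    IsTest (fun z => f z * g z) :=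
  ⟨hf.mul hg.1, hg.2.mul_left⟩

lemma dirD_comm {f : E → ℝ} (hf : ContDiff ℝ (⊤ : ℕ∞) f) (v w : E) :
    dirD v (dirD w f) = dirD w (dirD v f) := by
  funext z
  have hd : Differentiable ℝ (fderiv ℝ f) :=
    (hf.fderiv_right (m := 1) (by norm_cast)).differentiable (by simp)
  have e : ∀ a b : E, dirD a (dirD b f) z = fderiv ℝ (fderiv ℝ f) z a b := by
    intro a b
    have : dirD b f = fun y => fderiv ℝ f y b := rfl
    rw [this, dirD, fderiv_clm_apply (hd z) (differentiableAt_const b)]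
    simp
  rw [e, e]
  exact second_derivative_symmetric
    (fun y => (hf.differentiable (by simp) y).hasFDerivAt) (hd z).hasFDerivAt v w
end test

/-- Integrating a translate against a finite measure. -/
noncomputable def tconv {E F : Type*} [NormedAddCommGroup E] [MeasurableSpace E]
    [NormedAddCommGroup F] [NormedSpace ℝ F]
    (κ : Measure E) (f : E → F) (z : E) : F := ∫ w, f (z + w) ∂κ

section tconv
set_option linter.unusedSectionVars false
variable {E : Type} [NormedAddCommGroup E] [NormedSpace ℝ E] [FiniteDimensional ℝ E]
  [MeasurableSpace E] [BorelSpace E]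

lemma integrable_translate {F : Type} [NormedAddCommGroup F] [NormedSpace ℝ F]
    [FiniteDimensional ℝ F]
    (κ : Measure E) [IsFiniteMeasure κ] {f : E → F} (hf : Continuous f)
    (hs : HasCompactSupport f) (z : E) : Integrable (fun w => f (z + w)) κ := by
  obtain ⟨C, hC⟩ := hs.exists_bound_of_continuous hf
  exact Integrable.of_bound (hf.comp (by fun_prop)).aestronglyMeasurable C (ae_of_all _ fun w => hC _)

lemma hasFDerivAt_tconv {F : Type} [NormedAddCommGroup F] [NormedSpace ℝ F]
    [FiniteDimensional ℝ F]
    (κ : Measure E) [IsFiniteMeasure κ] {f : E → F} (hf : ContDiff ℝ 1 f)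
    (hs : HasCompactSupport f) (z : E) :
    HasFDerivAt (tconv κ f) (tconv κ (fderiv ℝ f) z) z := by
  have hfc : Continuous (fderiv ℝ f) := hf.continuous_fderiv (by simp)
  obtain ⟨C, hC⟩ := (hs.fderiv ℝ).exists_bound_of_continuous hfc
  unfold tconv
  refine hasFDerivAt_integral_of_dominated_of_fderiv_le (bound := fun _ => C) (𝕜 := ℝ) (s := Set.univ)
    (F := fun z w => f (z + w)) (F' := fun z w => fderiv ℝ f (z + w))
    Filter.univ_mem ?_ ?_ ?_ ?_ ?_ ?_
  · exact Filter.Eventually.of_forall fun x =>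
      (integrable_translate κ hf.continuous hs x).aestronglyMeasurable
  · exact integrable_translate κ hf.continuous hs z
  · exact (integrable_translate κ hfc (hs.fderiv ℝ) z).aestronglyMeasurable
  · exact ae_of_all _ fun w x _ => hC _
  · exact integrable_const _
  · refine ae_of_all _ fun w x _ => ?_
    have h := (hf.differentiable (by simp) (x + w)).hasFDerivAt
    exact (hasFDerivAt_comp_add_right w).2 h

lemma contDiff_tconv_nat (κ : Measure E) [IsFiniteMeasure κ] (k : ℕ) :
    ∀ {F : Type} [NormedAddCommGroup F] [NormedSpace ℝ F] [FiniteDimensional ℝ F] {f : E → F},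
    ContDiff ℝ (⊤ : ℕ∞) f → HasCompactSupport f → ContDiff ℝ k (tconv κ f) := by
  induction k with
  | zero =>
    intro F _ _ _ f hf hs
    rw [Nat.cast_zero, contDiff_zero]
    exact continuous_iff_continuousAt.2 fun z =>
      (hasFDerivAt_tconv κ (hf.of_le (by norm_cast)) hs z).continuousAt
  | succ k ih =>
    intro F _ _ _ f hf hs
    have hd := hasFDerivAt_tconv κ (f := f) (hf.of_le (by norm_cast)) hs
    rw [Nat.cast_succ, contDiff_succ_iff_fderiv]
    refine ⟨fun z => (hd z).differentiableAt, by simp, ?_⟩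
    have : fderiv ℝ (tconv κ f) = tconv κ (fderiv ℝ f) := funext fun z => (hd z).fderiv
    rw [this]
    exact ih (hf.fderiv_right (by simp)) (hs.fderiv ℝ)

lemma contDiff_tconv (κ : Measure E) [IsFiniteMeasure κ] {f : E → ℝ} (hf : IsTest f) :
    ContDiff ℝ (⊤ : ℕ∞) (tconv κ f) :=
  contDiff_infty.2 fun k => contDiff_tconv_nat κ k hf.1 hf.2

lemma dirD_tconv (κ : Measure E) [IsFiniteMeasure κ] {f : E → ℝ} (hf : IsTest f) (v : E) :
    dirD v (tconv κ f) = tconv κ (dirD v f) := by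
  funext z
  have h := hasFDerivAt_tconv κ (f := f) (hf.1.of_le (by norm_cast)) hf.2 z
  rw [dirD, h.fderiv]
  unfold tconv dirD
  rw [ContinuousLinearMap.integral_apply]
  exact integrable_translate κ (hf.1.continuous_fderiv (by simp)) (hf.2.fderiv ℝ) z

lemma bounded_tconv (κ : Measure E) [IsFiniteMeasure κ] {f : E → ℝ} (hf : IsTest f) :
    ∃ C, ∀ z, |tconv κ f z| ≤ C := by
  obtain ⟨C, hC0, hC⟩ := hf.bounded
  refine ⟨C * κ.real Set.univ, fun z => ?_⟩
  exact norm_integral_le_of_norm_le_const (f := fun w => f (z + w)) (ae_of_all _ fun w => hC (z + w))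

lemma IsTest.integrable {f : E → ℝ} (hf : IsTest f) (μ : Measure E) [IsFiniteMeasureOnCompacts μ] :
    Integrable f μ := hf.continuous.integrable_of_hasCompactSupport hf.2

lemma integrable_tconv (μ : Measure E) [μ.IsAddHaarMeasure] (κ : Measure E) [IsFiniteMeasure κ]
    {f : E → ℝ} (hf : IsTest f) : Integrable (tconv κ f) μ := by
  have : Integrable (fun p : E × E => f (p.1 + p.2)) (μ.prod κ) := by
    have hc : Continuous (fun p : E × E => f (p.1 + p.2)) := hf.continuous.comp (by fun_prop)
    rw [integrable_prod_iff' hc.aestronglyMeasurable]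
    refine ⟨ae_of_all _ fun w => (hf.integrable μ).comp_add_right w, ?_⟩
    have : (fun y => ∫ x, ‖f (x + y)‖ ∂μ) = fun y => ∫ x, ‖f x‖ ∂μ := by
      funext y
      exact integral_add_right_eq_self (fun x => ‖f x‖) y
    simp only [this]
    exact integrable_const _
  exact this.integral_prod_left

/-- Integration by parts for translates-averages of test functions. -/
lemma tconv_ibp (μ : Measure E) [μ.IsAddHaarMeasure] (κ : Measure E) [IsFiniteMeasure κ]
    {f g : E → ℝ} (hf : IsTest f) (hg : IsTest g) (v : E) :
    ∫ z, tconv κ f z * dirD v (tconv κ g) z ∂μ = - ∫ z, dirD v (tconv κ f) z * tconv κ g z ∂μ := by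
  have key : ∀ {p q : E → ℝ}, IsTest p → IsTest q →
      Integrable (fun z => tconv κ p z * tconv κ q z) μ := by
    intro p q hp hq
    obtain ⟨C, hC⟩ := bounded_tconv κ hp
    exact (integrable_tconv μ κ hq).bdd_mul
      (contDiff_tconv κ hp).continuous.aestronglyMeasurable (ae_of_all _ hC)
  have h1 := dirD_tconv κ hf v
  have h2 := dirD_tconv κ hg v
  refine integral_mul_fderiv_eq_neg_fderiv_mul_of_integrable (f := tconv κ f) (g := tconv κ g) ?_ ?_ (key hf hg)
    (fun x _ => (contDiff_tconv κ hf).differentiable (by simp) x)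
    (fun x _ => (contDiff_tconv κ hg).differentiable (by simp) x)
  · change Integrable (fun x => dirD v (tconv κ f) x * _) μ
    rw [h1]; exact key (hf.dirD v) hg
  · change Integrable (fun x => _ * dirD v (tconv κ g) x) μ
    rw [h2]; exact key hf (hg.dirD v)
end tconv

/-- Space-time. -/
abbrev SpT (n : ℕ) := ℝ × (Fin n → ℝ)

/-- The time direction. -/
def eT (n : ℕ) : SpT n := (1, 0)

/-- The space directions. -/
def eX {n : ℕ} (i : Fin n) : SpT n := (0, Pi.single i 1)

/-- The unnormalised standard Gaussian density. -/
noncomputable def gdens {n : ℕ} (ξ : Fin n → ℝ) : ℝ := Real.exp (-(∑ i, ξ i ^ 2) / 2)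

section gauss
variable {n : ℕ}

lemma gdens_pos (ξ : Fin n → ℝ) : 0 < gdens ξ := Real.exp_pos _

lemma contDiff_gdens : ContDiff ℝ (⊤ : ℕ∞) (gdens (n := n)) := by
  unfold gdens; fun_prop

lemma one_add_norm_pow_mul_gdens_le (N : ℕ) (ξ : Fin n → ℝ) :
    (1 + ‖ξ‖) ^ N * gdens ξ ≤ N.factorial * Real.exp (3 / 2) := by
  have h1 : ‖ξ‖ ^ 2 ≤ ∑ i, ξ i ^ 2 := by
    have : ‖ξ‖ ≤ Real.sqrt (∑ i, ξ i ^ 2) := by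
      refine (pi_norm_le_iff_of_nonneg (Real.sqrt_nonneg _)).2 fun i => ?_
      rw [Real.norm_eq_abs, ← Real.sqrt_sq_eq_abs]
      exact Real.sqrt_le_sqrt (Finset.single_le_sum (f := fun i => ξ i ^ 2)
        (fun j _ => sq_nonneg _) (Finset.mem_univ i))
    calc ‖ξ‖ ^ 2 ≤ (Real.sqrt (∑ i, ξ i ^ 2)) ^ 2 := by gcongr
      _ = _ := Real.sq_sqrt (Finset.sum_nonneg fun i _ => sq_nonneg _)
  have h2 := Real.pow_div_factorial_le_exp (1 + ‖ξ‖) (by positivity) N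
  rw [div_le_iff₀ (by positivity)] at h2
  have h3 : Real.exp (1 + ‖ξ‖) * gdens ξ ≤ Real.exp (3 / 2) := by
    rw [gdens, ← Real.exp_add]
    apply Real.exp_le_exp.2
    nlinarith [sq_nonneg (‖ξ‖ - 1)]
  calc (1 + ‖ξ‖) ^ N * gdens ξ ≤ (Real.exp (1 + ‖ξ‖) * N.factorial) * gdens ξ := by
        gcongr; exact (gdens_pos ξ).le
    _ = N.factorial * (Real.exp (1 + ‖ξ‖) * gdens ξ) := by ring
    _ ≤ _ := by gcongr

lemma integrable_gdens : Integrable (gdens (n := n)) := by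
  have h : Integrable (fun ξ : Fin n → ℝ => ∏ i, Real.exp (-(1 / 2) * ξ i ^ 2)) :=
    Integrable.fintype_prod fun i => integrable_exp_neg_mul_sq (by norm_num)
  convert h using 1
  funext ξ
  rw [gdens, ← Real.exp_sum, ← Finset.mul_sum]
  ring_nf

lemma integral_gdens_pos : 0 < ∫ ξ : Fin n → ℝ, gdens ξ :=
  integral_pos_of_integrable_nonneg_nonzero (x := 0) contDiff_gdens.continuous integrable_gdens
    (fun ξ => (gdens_pos ξ).le) (gdens_pos 0).ne'

lemma integrable_norm_mul_gdens : Integrable (fun ξ : Fin n → ℝ => ‖ξ‖ * gdens ξ) := by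
  have h : Integrable (fun ξ : Fin n → ℝ => (1 + ‖ξ‖) ^ (-((n : ℝ) + 1))) :=
    integrable_one_add_norm (by simp)
  refine (h.const_mul ((n + 2).factorial * Real.exp (3 / 2))).mono'
    ((continuous_norm.mul contDiff_gdens.continuous).aestronglyMeasurable) (ae_of_all _ fun ξ => ?_)
  have h1 := one_add_norm_pow_mul_gdens_le (n + 2) ξ
  have h0 : 0 < 1 + ‖ξ‖ := by positivity
  have e : (1 + ‖ξ‖) ^ (-((n : ℝ) + 1)) = ((1 + ‖ξ‖) ^ (n + 1))⁻¹ := by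
    rw [Real.rpow_neg h0.le]
    norm_cast
  rw [Real.norm_eq_abs, abs_of_nonneg (mul_nonneg (norm_nonneg _) (gdens_pos _).le), e,
    ← div_eq_mul_inv, le_div_iff₀ (by positivity)]
  refine le_trans ?_ h1
  have := (gdens_pos ξ).le
  calc ‖ξ‖ * gdens ξ * (1 + ‖ξ‖) ^ (n + 1) ≤ (1 + ‖ξ‖) * gdens ξ * (1 + ‖ξ‖) ^ (n + 1) := by
        gcongr; linarith
    _ = _ := by ring

lemma dirD_gdens (i : Fin n) (ξ : Fin n → ℝ) :
    dirD (Pi.single i 1) (gdens (n := n)) ξ = -ξ i * gdens ξ := by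
  have h : HasFDerivAt (gdens (n := n)) (gdens ξ • ((1 / 2 : ℝ) • -(∑ j, (2 * ξ j) •
      (ContinuousLinearMap.proj j : (Fin n → ℝ) →L[ℝ] ℝ)))) ξ := by
    have h1 : HasFDerivAt (fun ξ : Fin n → ℝ => ∑ j, ξ j ^ 2) (∑ j, (2 * ξ j) •
      (ContinuousLinearMap.proj j : (Fin n → ℝ) →L[ℝ] ℝ)) ξ := by
      refine HasFDerivAt.fun_sum fun j _ => ?_
      have := (hasFDerivAt_apply (𝕜 := ℝ) j ξ).pow 2
      simpa using this
    have h2 := (h1.neg.const_mul (1 / 2)).exp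
    have e : (fun ξ : Fin n → ℝ => Real.exp (1 / 2 * (-fun ξ : Fin n → ℝ => ∑ j, ξ j ^ 2) ξ)) = gdens := by
      funext ξ; simp only [gdens, Pi.neg_apply]; ring_nf
    rw [e] at h2
    have e2 : gdens ξ = Real.exp (1 / 2 * (-fun ξ : Fin n → ℝ => ∑ j, ξ j ^ 2) ξ) := by
      simp only [gdens, Pi.neg_apply]; congr 1; ring
    rw [e2]
    exact h2
  rw [dirD, h.fderiv]
  simp [Pi.single_apply]
  ring

lemma dirD_dirD_gdens (i j : Fin n) (ξ : Fin n → ℝ) :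
    dirD (Pi.single j 1) (dirD (Pi.single i 1) (gdens (n := n))) ξ
      = (ξ i * ξ j - if i = j then 1 else 0) * gdens ξ := by
  have e : dirD (Pi.single i 1) (gdens (n := n)) = fun ξ => -(ξ i) * gdens ξ :=
    funext fun ξ => dirD_gdens i ξ
  have hg := (contDiff_gdens (n := n)).differentiable (by simp) ξ
  have h1 := ((hasFDerivAt_apply (𝕜 := ℝ) i ξ).neg).mul hg.hasFDerivAt
  have h2 := dirD_gdens j ξ
  rw [dirD] at h2
  have e2 : (fun ξ : Fin n → ℝ => -(ξ i) * gdens ξ) = (-fun f : Fin n → ℝ => f i) * gdens := by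
    funext ξ; simp
  rw [e, dirD, e2, h1.fderiv]
  simp [h2, Pi.single_apply]
  split_ifs <;> ring

/-- Gaussian integration by parts. -/
lemma gauss_ibp {p : (Fin n → ℝ) → ℝ} (hp : ContDiff ℝ (⊤ : ℕ∞) p) {h : (Fin n → ℝ) → ℝ}
    (hh : IsTest h) (v : Fin n → ℝ) :
    ∫ ξ, p ξ * dirD v h ξ = - ∫ ξ, dirD v p ξ * h ξ := by
  refine integral_mul_fderiv_eq_neg_fderiv_mul_of_integrable (f := p) (g := h) ?_ ?_ ?_
    (fun x _ => hp.differentiable (by simp) x) (fun x _ => hh.differentiable x)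
  · exact (IsTest.mul (contDiff_dirD hp v) hh).integrable _
  · exact (IsTest.mul hp (hh.dirD v)).integrable _
  · exact (IsTest.mul hp hh).integrable _

lemma slice_isTest {f : SpT n → ℝ} (hf : IsTest f) (t : ℝ) (x : Fin n → ℝ) {s : ℝ} (hs : 0 < s) :
    IsTest (fun ξ : Fin n → ℝ => f (t, x + s • ξ)) := by
  refine ⟨hf.1.comp (by fun_prop), ?_⟩
  obtain ⟨R, hR⟩ := hf.2.isCompact.isBounded.exists_norm_le
  refine HasCompactSupport.of_support_subset_isCompact
    (isCompact_closedBall (0 : Fin n → ℝ) ((R + ‖x‖) / s)) fun ξ hξ => ?_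
  have h1 := hR _ (subset_tsupport f hξ)
  have h2 : ‖x + s • ξ‖ ≤ R := (norm_snd_le (t, x + s • ξ)).trans h1
  rw [mem_closedBall_zero_iff, le_div_iff₀ hs]
  have h3 : ‖s • ξ‖ ≤ ‖x + s • ξ‖ + ‖x‖ := by
    have := norm_sub_le (x + s • ξ) x
    simpa using this
  rw [norm_smul, Real.norm_eq_abs, abs_of_pos hs] at h3
  linarith

lemma dirD_slice {f : SpT n → ℝ} (hf : IsTest f) (t : ℝ) (x : Fin n → ℝ) (s : ℝ) (i : Fin n)
    (ξ : Fin n → ℝ) :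
    dirD (Pi.single i 1) (fun ξ : Fin n → ℝ => f (t, x + s • ξ)) ξ
      = s * dirD (eX i) f (t, x + s • ξ) := by
  have h1 : HasFDerivAt (fun ξ : Fin n → ℝ => ((t, x + s • ξ) : SpT n))
      ((0 : (Fin n → ℝ) →L[ℝ] ℝ).prod (s • ContinuousLinearMap.id ℝ (Fin n → ℝ))) ξ := by
    refine HasFDerivAt.prodMk (hasFDerivAt_const t ξ) ?_
    exact ((hasFDerivAt_id ξ).const_smul s).const_add x
  have h2 := (hf.differentiable (t, x + s • ξ)).hasFDerivAt.comp ξ h1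
  have e : (f ∘ fun ξ : Fin n → ℝ => ((t, x + s • ξ) : SpT n)) = fun ξ => f (t, x + s • ξ) := rfl
  rw [e] at h2
  rw [dirD, h2.fderiv, dirD, eX]
  have e3 : ((0 : ℝ), s • (Pi.single i 1 : Fin n → ℝ)) = s • ((0 : ℝ), (Pi.single i 1 : Fin n → ℝ)) := by
    simp
  simp only [ContinuousLinearMap.comp_apply, ContinuousLinearMap.prod_apply,
    _root_.zero_apply, _root_.smul_apply, ContinuousLinearMap.id_apply]
  rw [e3, map_smul, smul_eq_mul]
end gauss

section heat
variable {n : ℕ}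

/-- The law (up to a constant) of an exponential time and a standard Gaussian vector. -/
noncomputable def heatM (n : ℕ) : Measure (SpT n) :=
  ((volume.restrict (Set.Ioi (0 : ℝ))).withDensity (fun τ => ENNReal.ofReal (Real.exp (-τ)))).prod
    (volume.withDensity (fun ξ : Fin n → ℝ => ENNReal.ofReal (gdens ξ)))

/-- The damped space-time heat kernel as a measure. -/
noncomputable def heatK (n : ℕ) : Measure (SpT n) :=
  (heatM n).map (fun w => (w.1, Real.sqrt w.1 • w.2))

lemma integrableOn_exp_neg : IntegrableOn (fun τ : ℝ => Real.exp (-τ)) (Set.Ioi 0) := by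
  simpa using integrableOn_exp_mul_Ioi (a := -1) (by norm_num) 0

instance isFiniteMeasure_timeM : IsFiniteMeasure
    ((volume.restrict (Set.Ioi (0 : ℝ))).withDensity (fun τ => ENNReal.ofReal (Real.exp (-τ)))) :=
  isFiniteMeasure_withDensity_ofReal integrableOn_exp_neg.hasFiniteIntegral

instance isFiniteMeasure_gaussM : IsFiniteMeasure
    (volume.withDensity (fun ξ : Fin n → ℝ => ENNReal.ofReal (gdens ξ))) :=
  isFiniteMeasure_withDensity_ofReal integrable_gdens.hasFiniteIntegral

instance isFiniteMeasure_heatM : IsFiniteMeasure (heatM n) := by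
  unfold heatM; infer_instance

instance isFiniteMeasure_heatK : IsFiniteMeasure (heatK n) := by
  unfold heatK; infer_instance

lemma heat_formula {f : SpT n → ℝ} (hf : IsTest f) (z : SpT n) :
    tconv (heatK n) f z = ∫ τ in Set.Ioi (0 : ℝ), Real.exp (-τ) *
      ∫ ξ : Fin n → ℝ, gdens ξ * f (z.1 + τ, z.2 + Real.sqrt τ • ξ) := by
  have hc := hf.continuous
  obtain ⟨C, hC0, hC⟩ := hf.bounded
  have hΦ : Continuous (fun w : SpT n => ((w.1, Real.sqrt w.1 • w.2) : SpT n)) := by fun_prop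
  have hc2 : Continuous (fun w : SpT n => f (z + w)) := hc.comp (by fun_prop)
  rw [tconv, heatK, integral_map hΦ.aemeasurable hc2.aestronglyMeasurable, heatM, integral_prod,
    integral_withDensity_eq_integral_toReal_smul (by fun_prop) (by simp)]
  · congr 1
    funext τ
    rw [integral_withDensity_eq_integral_toReal_smul
      (contDiff_gdens.continuous.measurable.ennreal_ofReal) (by simp),
      ENNReal.toReal_ofReal (Real.exp_pos _).le, smul_eq_mul]
    congr 2
    funext ξ
    rw [ENNReal.toReal_ofReal (gdens_pos _).le, smul_eq_mul]
    rfl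
  · exact Integrable.of_bound (hc2.comp hΦ).aestronglyMeasurable C (ae_of_all _ fun w => hC _)

/-- Gaussian average of a test function at time `τ`. -/
noncomputable def gAvg (f : SpT n → ℝ) (z : SpT n) (τ : ℝ) : ℝ :=
  ∫ ξ : Fin n → ℝ, gdens ξ * f (z.1 + τ, z.2 + Real.sqrt τ • ξ)

lemma gAvg_integrable {f : SpT n → ℝ} (hf : IsTest f) (z : SpT n) (τ : ℝ) :
    Integrable (fun ξ : Fin n → ℝ => gdens ξ * f (z.1 + τ, z.2 + Real.sqrt τ • ξ)) := by
  obtain ⟨C, hC0, hC⟩ := hf.bounded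
  have hc2 : Continuous (fun ξ : Fin n → ℝ => f (z.1 + τ, z.2 + Real.sqrt τ • ξ)) :=
    hf.continuous.comp (by fun_prop)
  exact integrable_gdens.mul_bdd (c := C) hc2.aestronglyMeasurable (ae_of_all _ fun ξ => hC _)

lemma gAvg_bound {f : SpT n → ℝ} (hf : IsTest f) : ∃ C, ∀ z τ, |gAvg f z τ| ≤ C := by
  obtain ⟨C, hC0, hC⟩ := hf.bounded
  refine ⟨∫ ξ : Fin n → ℝ, gdens ξ * C, fun z τ => ?_⟩
  rw [← Real.norm_eq_abs, gAvg]
  refine norm_integral_le_of_norm_le (integrable_gdens.mul_const C) (ae_of_all _ fun ξ => ?_)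
  rw [norm_mul, Real.norm_eq_abs, abs_of_pos (gdens_pos ξ)]
  exact mul_le_mul_of_nonneg_left (hC _) (gdens_pos ξ).le

lemma gAvg_continuous {f : SpT n → ℝ} (hf : IsTest f) (z : SpT n) : Continuous (gAvg f z) := by
  obtain ⟨C, hC0, hC⟩ := hf.bounded
  unfold gAvg
  refine continuous_of_dominated (bound := fun ξ => gdens ξ * C) ?_ ?_
    (integrable_gdens.mul_const C) ?_
  · exact fun τ => (gAvg_integrable hf z τ).aestronglyMeasurable
  · refine fun τ => ae_of_all _ fun ξ => ?_
    rw [norm_mul, Real.norm_eq_abs, abs_of_pos (gdens_pos ξ)]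
    exact mul_le_mul_of_nonneg_left (hC _) (gdens_pos ξ).le
  · exact ae_of_all _ fun ξ => continuous_const.mul (hf.continuous.comp (by fun_prop))

lemma gAvg_dirD {f : SpT n → ℝ} (hf : IsTest f) (z : SpT n) {τ : ℝ} (hτ : 0 < τ) (i : Fin n) :
    ∫ ξ : Fin n → ℝ, ξ i * gdens ξ * f (z.1 + τ, z.2 + Real.sqrt τ • ξ) =
      Real.sqrt τ * gAvg (dirD (eX i) f) z τ := by
  have h := gauss_ibp contDiff_gdens (slice_isTest hf (z.1 + τ) z.2 (Real.sqrt_pos.2 hτ))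
    (Pi.single i 1)
  simp only [dirD_slice hf, dirD_gdens] at h
  rw [gAvg, ← integral_const_mul]
  calc _ = - ∫ ξ : Fin n → ℝ, (-ξ i * gdens ξ) * f (z.1 + τ, z.2 + Real.sqrt τ • ξ) := by
        rw [← integral_neg]; congr 1; funext ξ; ring
    _ = _ := by rw [← h]; congr 1; funext ξ; ring

lemma fderiv_split (f : SpT n → ℝ) (w : SpT n) (c : ℝ) (y : Fin n → ℝ) :
    fderiv ℝ f w (c, y) = c * dirD (eT n) f w + ∑ i, y i * dirD (eX i) f w := by
  have e : ((c, y) : SpT n) = c • eT n + ∑ i, y i • (eX i : SpT n) := by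
    refine Prod.ext ?_ ?_
    · simp [eT, eX, Prod.fst_sum]
    · simp only [eT, eX, Prod.snd_add, Prod.smul_snd, smul_zero, zero_add, Prod.snd_sum]
      exact pi_eq_sum_univ' y ▸ by simp
  rw [e, map_add, map_smul, map_sum]
  simp [dirD]

/-- The heat operator applied to a function. -/
noncomputable def heatOp (f : SpT n → ℝ) (z : SpT n) : ℝ :=
  dirD (eT n) f z + (1 / 2) * ∑ i, dirD (eX i) (dirD (eX i) f) z - f z

lemma gAvg_hasDerivAt {f : SpT n → ℝ} (hf : IsTest f) (z : SpT n) {τ : ℝ} (hτ : 0 < τ) :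
    HasDerivAt (gAvg f z) (gAvg (dirD (eT n) f) z τ
      + (1 / 2) * ∑ i, gAvg (dirD (eX i) (dirD (eX i) f)) z τ) τ := by
  obtain ⟨C0, hC00, hC0⟩ := (hf.dirD (eT n)).bounded
  choose C hCp hC using fun i => (hf.dirD (eX i)).bounded
  have hs : ∀ s ∈ Set.Ioi (τ / 2), 0 < s := fun s hs => (half_pos hτ).trans hs
  have key := hasDerivAt_integral_of_dominated_loc_of_deriv_le (𝕜 := ℝ) (μ := volume)
    (F := fun s (ξ : Fin n → ℝ) => gdens ξ * f (z.1 + s, z.2 + Real.sqrt s • ξ))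
    (F' := fun s (ξ : Fin n → ℝ) => gdens ξ * (dirD (eT n) f (z.1 + s, z.2 + Real.sqrt s • ξ) +
      ∑ i, (1 / (2 * Real.sqrt s) * ξ i) * dirD (eX i) f (z.1 + s, z.2 + Real.sqrt s • ξ)))
    (x₀ := τ) (s := Set.Ioi (τ / 2))
    (bound := fun ξ => gdens ξ * C0 + ∑ i, (1 / (2 * Real.sqrt (τ / 2)) * C i) * (‖ξ‖ * gdens ξ))
    (Ioi_mem_nhds (half_lt_self hτ))
    (Eventually.of_forall fun s => (gAvg_integrable hf z s).aestronglyMeasurable)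
    (gAvg_integrable hf z τ) ?_ ?_ ?_ ?_
  · have h2 := key.2
    refine h2.congr_deriv ?_
    have hi : ∀ i, Integrable (fun ξ : Fin n → ℝ => 1 / (2 * Real.sqrt τ) *
        (ξ i * gdens ξ * dirD (eX i) f (z.1 + τ, z.2 + Real.sqrt τ • ξ))) := by
      intro i
      refine Integrable.const_mul ?_ _
      have := (IsTest.mul (f := fun ξ : Fin n → ℝ => ξ i * gdens ξ)
        ((contDiff_apply ℝ ℝ i).mul contDiff_gdens)
        (slice_isTest (hf.dirD (eX i)) (z.1 + τ) z.2 (Real.sqrt_pos.2 hτ))).integrable volume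
      exact this
    have e : (fun ξ : Fin n → ℝ => gdens ξ * (dirD (eT n) f (z.1 + τ, z.2 + Real.sqrt τ • ξ) +
      ∑ i, (1 / (2 * Real.sqrt τ) * ξ i) * dirD (eX i) f (z.1 + τ, z.2 + Real.sqrt τ • ξ))) =
      fun ξ => gdens ξ * dirD (eT n) f (z.1 + τ, z.2 + Real.sqrt τ • ξ) +
        ∑ i, 1 / (2 * Real.sqrt τ) *
        (ξ i * gdens ξ * dirD (eX i) f (z.1 + τ, z.2 + Real.sqrt τ • ξ)) := by
      funext ξ
      rw [mul_add, Finset.mul_sum]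
      congr 1
      exact Finset.sum_congr rfl fun i _ => by ring
    rw [e, integral_add (gAvg_integrable (hf.dirD _) z τ) (integrable_finsetSum _ fun i _ => hi i),
      integral_finsetSum _ fun i _ => hi i, gAvg, Finset.mul_sum]
    congr 1
    refine Finset.sum_congr rfl fun i _ => ?_
    rw [integral_const_mul, gAvg_dirD (hf.dirD _) z hτ]
    have := Real.sqrt_pos.2 hτ
    field_simp
  · refine Continuous.aestronglyMeasurable ?_
    have h0 := contDiff_gdens (n := n) |>.continuous
    have h1 : ∀ v, Continuous (fun ξ : Fin n → ℝ => dirD v f (z.1 + τ, z.2 + Real.sqrt τ • ξ)) :=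
      fun v => (hf.dirD v).continuous.comp (by fun_prop)
    refine h0.mul ((h1 _).add (continuous_finsetSum _ fun i _ => ?_))
    exact (by fun_prop : Continuous fun ξ : Fin n → ℝ => 1 / (2 * Real.sqrt τ) * ξ i).mul (h1 _)
  · refine ae_of_all _ fun ξ s hs' => ?_
    have hg := gdens_pos ξ
    have hs2 : 1 / (2 * Real.sqrt s) ≤ 1 / (2 * Real.sqrt (τ / 2)) := by
      have h5 : 0 < Real.sqrt (τ / 2) := Real.sqrt_pos.2 (half_pos hτ)
      have h6 : Real.sqrt (τ / 2) ≤ Real.sqrt s := Real.sqrt_le_sqrt (le_of_lt hs')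
      gcongr
    rw [norm_mul, Real.norm_eq_abs, abs_of_pos hg]
    calc gdens ξ * ‖dirD (eT n) f (z.1 + s, z.2 + Real.sqrt s • ξ) +
          ∑ i, (1 / (2 * Real.sqrt s) * ξ i) * dirD (eX i) f (z.1 + s, z.2 + Real.sqrt s • ξ)‖
        ≤ gdens ξ * (C0 + ∑ i, (1 / (2 * Real.sqrt (τ / 2)) * ‖ξ‖) * C i) := by
          refine mul_le_mul_of_nonneg_left ((norm_add_le _ _).trans (add_le_add (hC0 _)
            ((norm_sum_le _ _).trans (Finset.sum_le_sum fun i _ => ?_)))) hg.le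
          have := hs s hs'
          rw [norm_mul, norm_mul, Real.norm_eq_abs (1 / _), abs_of_nonneg (by positivity)]
          exact mul_le_mul (mul_le_mul hs2 (norm_le_pi_norm ξ i) (norm_nonneg _) (by positivity))
            (hC i _) (norm_nonneg _) (by positivity)
      _ = _ := by
          rw [mul_add, Finset.mul_sum]
          congr 1
          exact Finset.sum_congr rfl fun i _ => by ring
  · exact (integrable_gdens.mul_const C0).add
      (integrable_finsetSum _ fun i _ => integrable_norm_mul_gdens.const_mul _)
  · refine ae_of_all _ fun ξ s hs' => ?_
    have hs0 := hs s hs'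
    have h1 : HasDerivAt (fun s : ℝ => ((z.1 + s, z.2 + Real.sqrt s • ξ) : SpT n))
        (1, (1 / (2 * Real.sqrt s)) • ξ) s := by
      refine HasDerivAt.prodMk ((hasDerivAt_id s).const_add z.1) ?_
      exact ((Real.hasDerivAt_sqrt hs0.ne').smul_const ξ).const_add z.2
    have h2 := (hf.differentiable (z.1 + s, z.2 + Real.sqrt s • ξ)).hasFDerivAt.comp_hasDerivAt s h1
    have h3 := h2.const_mul (gdens ξ)
    refine h3.congr_deriv ?_
    rw [fderiv_split]
    simp

/-- The damped heat potential solves the heat equation. -/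
lemma heat_pde {f : SpT n → ℝ} (hf : IsTest f) (z : SpT n) :
    heatOp (tconv (heatK n) f) z = -(∫ ξ : Fin n → ℝ, gdens ξ) * f z := by
  have hL : heatOp (tconv (heatK n) f) z = ∫ τ in Set.Ioi (0 : ℝ), Real.exp (-τ) *
      (gAvg (dirD (eT n) f) z τ + (1 / 2) * ∑ i, gAvg (dirD (eX i) (dirD (eX i) f)) z τ)
        - Real.exp (-τ) * gAvg f z τ := by
    have hintg : ∀ {g : SpT n → ℝ}, IsTest g → IntegrableOn
        (fun τ => Real.exp (-τ) * gAvg g z τ) (Set.Ioi 0) := by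
      intro g hg
      obtain ⟨C, hC⟩ := gAvg_bound hg
      exact integrableOn_exp_neg.mul_bdd (c := C)
        (gAvg_continuous hg z).aestronglyMeasurable (ae_of_all _ fun τ => hC z τ)
    have h2 := fun i => (hf.dirD (eX i)).dirD (eX i)
    unfold heatOp
    simp only [dirD_tconv _ hf, dirD_tconv _ (hf.dirD _)]
    rw [heat_formula (hf.dirD _), heat_formula hf,
      Finset.sum_congr rfl fun i _ => heat_formula (h2 i) z]
    change (∫ τ in Set.Ioi (0 : ℝ), Real.exp (-τ) * gAvg _ z τ) + 1 / 2 * ∑ i,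
      (∫ τ in Set.Ioi (0 : ℝ), Real.exp (-τ) * gAvg _ z τ) -
      (∫ τ in Set.Ioi (0 : ℝ), Real.exp (-τ) * gAvg _ z τ) = _
    have hs : IntegrableOn (fun τ => ∑ i, Real.exp (-τ) *
        gAvg (dirD (eX i) (dirD (eX i) f)) z τ) (Set.Ioi 0) :=
      integrable_finsetSum _ fun i _ => hintg (h2 i)
    rw [← integral_finsetSum _ fun i _ => hintg (h2 i), ← integral_const_mul,
      ← integral_add (hintg (hf.dirD _)) (hs.const_mul _), ← integral_sub _ (hintg hf)]
    · congr 1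
      funext τ
      rw [← Finset.mul_sum]; ring
    · exact (hintg (hf.dirD _)).add (hs.const_mul _)
  rw [hL]
  have hcont : Continuous fun τ => Real.exp (-τ) * gAvg f z τ :=
    (by fun_prop : Continuous fun τ : ℝ => Real.exp (-τ)).mul (gAvg_continuous hf z)
  obtain ⟨C, hC⟩ := gAvg_bound hf
  have := integral_Ioi_of_hasDerivAt_of_tendsto (a := 0) (m := 0)
    (f := fun τ => Real.exp (-τ) * gAvg f z τ)
    (f' := fun τ => Real.exp (-τ) *
      (gAvg (dirD (eT n) f) z τ + (1 / 2) * ∑ i, gAvg (dirD (eX i) (dirD (eX i) f)) z τ)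
        - Real.exp (-τ) * gAvg f z τ) hcont.continuousWithinAt ?_ ?_ ?_
  · rw [this]
    simp [gAvg, integral_mul_const]
  · intro τ hτ
    have h1 : HasDerivAt (fun τ : ℝ => Real.exp (-τ)) (-Real.exp (-τ)) τ := by
      simpa using (hasDerivAt_neg τ).exp
    refine (h1.mul (gAvg_hasDerivAt hf z hτ)).congr_deriv ?_
    ring
  · have hc' : Continuous fun τ => (gAvg (dirD (eT n) f) z τ
      + (1 / 2) * ∑ i, gAvg (dirD (eX i) (dirD (eX i) f)) z τ) - gAvg f z τ :=
      ((gAvg_continuous (hf.dirD _) z).add (continuous_const.mul (continuous_finsetSum _ fun i _ =>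
        gAvg_continuous ((hf.dirD _).dirD _) z))).sub (gAvg_continuous hf z)
    obtain ⟨C1, hC1⟩ := gAvg_bound (hf.dirD (eT n))
    choose C2 hC2 using fun i => gAvg_bound ((hf.dirD (eX i)).dirD (eX i))
    have := integrableOn_exp_neg.mul_bdd (c := C1 + 1 / 2 * ∑ i, C2 i + C)
      hc'.aestronglyMeasurable (ae_of_all _ fun τ => by
        refine (norm_sub_le _ _).trans (add_le_add ((norm_add_le _ _).trans (add_le_add (hC1 z τ) ?_)) (hC z τ))
        rw [norm_mul, Real.norm_eq_abs, abs_of_pos (by norm_num : (0 : ℝ) < 1 / 2)]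
        exact mul_le_mul_of_nonneg_left ((norm_sum_le _ _).trans
          (Finset.sum_le_sum fun i _ => hC2 i z τ)) (by norm_num))
    refine this.congr (ae_of_all _ fun τ => ?_)
    simp only; ring
  · have h1 : Tendsto (fun τ : ℝ => Real.exp (-τ)) atTop (𝓝 0) := Real.tendsto_exp_neg_atTop_nhds_zero
    refine h1.zero_mul_isBoundedUnder_le ⟨C, ?_⟩
    simp only [eventually_map]
    exact Eventually.of_forall fun τ => hC z τ
end heat

section heat
variable {n : ℕ}

instance isAddHaarMeasure_spT : (volume : Measure (SpT n)).IsAddHaarMeasure :=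
  Measure.prod.instIsAddHaarMeasure (volume : Measure ℝ) (volume : Measure (Fin n → ℝ))

lemma tconv_mul_integrable {p q : SpT n → ℝ} (hp : IsTest p) (hq : IsTest q) :
    Integrable (fun z => tconv (heatK n) p z * tconv (heatK n) q z) := by
  obtain ⟨C, hC⟩ := bounded_tconv (heatK n) hp
  exact (integrable_tconv volume (heatK n) hq).bdd_mul
    (contDiff_tconv (heatK n) hp).continuous.aestronglyMeasurable (ae_of_all _ hC)

/-- The `L²` pairing of heat potentials. -/
noncomputable def hI (p q : SpT n → ℝ) : ℝ :=
  ∫ z, tconv (heatK n) p z * tconv (heatK n) q z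

lemma hI_symm (p q : SpT n → ℝ) : hI p q = hI q p := by
  unfold hI; congr 1; funext z; ring

lemma hI_dirD {p q : SpT n → ℝ} (hp : IsTest p) (hq : IsTest q) (v : SpT n) :
    hI p (dirD v q) = - hI (dirD v p) q := by
  have := tconv_ibp volume (heatK n) hp hq v
  rw [dirD_tconv _ hp, dirD_tconv _ hq] at this
  exact this

lemma hI_dirD_self {p : SpT n → ℝ} (hp : IsTest p) (v : SpT n) : hI p (dirD v p) = 0 := by
  have h := hI_dirD hp hp v
  rw [hI_symm (dirD v p)] at h
  linarith

lemma hI_self_nonneg (p : SpT n → ℝ) : 0 ≤ hI p p :=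
  integral_nonneg fun _ => mul_self_nonneg _

/-- `L²` estimate for the second space derivatives of the heat potential. -/
lemma heat_L2 {f : SpT n → ℝ} (hf : IsTest f) (i j : Fin n) :
    ∫ z, (dirD (eX i) (dirD (eX j) (tconv (heatK n) f)) z) ^ 2
      ≤ 4 * (∫ ξ : Fin n → ℝ, gdens ξ) ^ 2 * ∫ z, f z ^ 2 := by
  set c := ∫ ξ : Fin n → ℝ, gdens ξ
  have h1 : ∀ v, IsTest (dirD v f) := fun v => hf.dirD v
  have h2 : ∀ v w, IsTest (dirD v (dirD w f)) := fun v w => (hf.dirD w).dirD v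
  let T : (SpT n → ℝ) → SpT n → ℝ := tconv (heatK n)
  have hi : ∀ {p q : SpT n → ℝ}, IsTest p → IsTest q → Integrable (fun z => T p z * T q z) :=
    fun hp hq => tconv_mul_integrable hp hq
  let S := fun i : Fin n => dirD (eX i) (dirD (eX i) f)
  have hS : ∀ i, IsTest (S i) := fun i => h2 _ _
  have hpde : ∀ z, T (dirD (eT n) f) z + (1 / 2) * ∑ i, T (S i) z - T f z = -c * f z := by
    intro z
    rw [← heat_pde hf z]
    simp only [heatOp, T, S, dirD_tconv _ hf, dirD_tconv _ (hf.dirD _)]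
  have hAU : hI (dirD (eT n) f) f = 0 := by rw [hI_symm]; exact hI_dirD_self hf _
  have hAB : ∀ i, hI (dirD (eT n) f) (S i) = 0 := by
    intro i
    rw [hI_dirD (h1 _) (h1 _), dirD_comm hf.1, hI_symm, hI_dirD_self (h1 _), neg_zero]
  have hBU : ∀ i, hI (S i) f ≤ 0 := by
    intro i
    rw [hI_symm, hI_dirD hf (h1 _)]
    linarith [hI_self_nonneg (dirD (eX i) f)]
  have hBB : ∀ i j, hI (S i) (S j) = hI (dirD (eX i) (dirD (eX j) f)) (dirD (eX i) (dirD (eX j) f)) := by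
    intro i j
    change hI (S i) (dirD (eX j) (dirD (eX j) f)) = _
    rw [hI_dirD (hS i) (h1 _)]
    change - hI (dirD (eX j) (dirD (eX i) (dirD (eX i) f))) _ = _
    rw [dirD_comm (h1 _).1, hI_symm, hI_dirD (h1 _) (h2 _ _), dirD_comm hf.1 (eX j) (eX i), neg_neg]
  have hSi : Integrable (fun z => (∑ i, T (S i) z) ^ 2) := by
    have e : (fun z => (∑ i, T (S i) z) ^ 2) = fun z => ∑ i, ∑ j, T (S i) z * T (S j) z := by
      funext z; rw [pow_two, Finset.sum_mul_sum]
    rw [e]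
    exact integrable_finsetSum _ fun i _ => integrable_finsetSum _ fun j _ => hi (hS i) (hS j)
  have hSe : ∫ z, (∑ i, T (S i) z) ^ 2 = ∑ i, ∑ j, hI (S i) (S j) := by
    have e : (fun z => (∑ i, T (S i) z) ^ 2) = fun z => ∑ i, ∑ j, T (S i) z * T (S j) z := by
      funext z; rw [pow_two, Finset.sum_mul_sum]
    rw [e, integral_finsetSum _ fun i _ => integrable_finsetSum _ fun j _ => hi (hS i) (hS j)]
    refine Finset.sum_congr rfl fun i _ => ?_
    rw [integral_finsetSum _ fun j _ => hi (hS i) (hS j)]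
    rfl
  have hmulS : ∀ {p : SpT n → ℝ}, IsTest p → Integrable (fun z => T p z * ∑ i, T (S i) z) ∧
      ∫ z, T p z * ∑ i, T (S i) z = ∑ i, hI p (S i) := by
    intro p hp
    simp only [Finset.mul_sum]
    exact ⟨integrable_finsetSum _ fun i _ => hi hp (hS i),
      integral_finsetSum _ fun i _ => hi hp (hS i)⟩
  have hAA := hi (h1 (eT n)) (h1 (eT n))
  have hexp : c ^ 2 * ∫ z, f z ^ 2 = hI (dirD (eT n) f) (dirD (eT n) f) + hI f f
      + (1 / 4) * (∑ i, ∑ j, hI (S i) (S j)) + ∑ i, hI (dirD (eT n) f) (S i)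
      - 2 * hI (dirD (eT n) f) f - ∑ i, hI f (S i) := by
    rw [← integral_const_mul, ← (hmulS hf).2, ← (hmulS (h1 (eT n))).2, ← hSe]
    unfold hI
    rw [← integral_const_mul, ← integral_const_mul, ← integral_add hAA (hi hf hf), ← integral_add _ (hSi.const_mul _),
      ← integral_add _ (hmulS (h1 _)).1, ← integral_sub _ ((hi (h1 _) hf).const_mul _),
      ← integral_sub _ (hmulS hf).1]
    · congr 1
      funext z
      have := hpde z
      have h3 : c ^ 2 * f z ^ 2 = (-c * f z) ^ 2 := by ring
      rw [h3, ← this]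
      simp only [T]
      ring
    · exact (((hAA.add (hi hf hf)).add (hSi.const_mul _)).add (hmulS (h1 _)).1).sub
        ((hi (h1 _) hf).const_mul _)
    · exact (((hAA.add (hi hf hf)).add (hSi.const_mul _)).add (hmulS (h1 _)).1)
    · exact ((hAA.add (hi hf hf)).add (hSi.const_mul _))
    · exact (hAA.add (hi hf hf))
  have hle : hI (dirD (eX i) (dirD (eX j) f)) (dirD (eX i) (dirD (eX j) f)) ≤
      ∑ i, ∑ j, hI (S i) (S j) := by
    rw [← hBB]
    have hnn : ∀ i j, 0 ≤ hI (S i) (S j) := fun i j => by rw [hBB]; exact hI_self_nonneg _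
    calc hI (S i) (S j) ≤ ∑ j, hI (S i) (S j) :=
          Finset.single_le_sum (f := fun j => hI (S i) (S j)) (fun j _ => hnn i j) (Finset.mem_univ j)
      _ ≤ _ := Finset.single_le_sum (f := fun i => ∑ j, hI (S i) (S j))
          (fun i _ => Finset.sum_nonneg fun j _ => hnn i j) (Finset.mem_univ i)
  have hfin : ∫ z, (dirD (eX i) (dirD (eX j) (tconv (heatK n) f)) z) ^ 2 =
      hI (dirD (eX i) (dirD (eX j) f)) (dirD (eX i) (dirD (eX j) f)) := by
    rw [dirD_tconv _ hf, dirD_tconv _ (h1 _)]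
    unfold hI
    congr 1; funext z; ring
  rw [hfin]
  have s1 : ∑ i, hI (dirD (eT n) f) (S i) = 0 := Finset.sum_eq_zero fun i _ => hAB i
  have s2 : ∑ i, hI f (S i) ≤ 0 := Finset.sum_nonpos fun i _ => by rw [hI_symm]; exact hBU i
  have s3 := hI_self_nonneg (dirD (eT n) f)
  have s4 := hI_self_nonneg f
  rw [s1, hAU] at hexp
  nlinarith
end heat

section kern
variable {n : ℕ}

/-- The parabolic distance to the origin. -/
noncomputable def pd (w : SpT n) : ℝ := max (Real.sqrt |w.1|) ‖w.2‖

lemma continuous_pd : Continuous (pd (n := n)) := by unfold pd; fun_prop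

lemma pd_nonneg (w : SpT n) : 0 ≤ pd w := le_max_of_le_right (norm_nonneg _)

/-- Parabolic Riesz potential. -/
noncomputable def riesz (m : ℕ) (f : SpT n → ℝ) (z : SpT n) : ENNReal :=
  ∫⁻ w, ENNReal.ofReal ((pd w ^ (n + m))⁻¹) * ‖f (z + w)‖ₑ

lemma lintegral_scale (H : (Fin n → ℝ) → ENNReal) {s : ℝ} (hs : 0 < s) (hH : Measurable H) :
    ∫⁻ ξ, H (s • ξ) = ENNReal.ofReal ((s ^ n)⁻¹) * ∫⁻ y, H y := by
  have h := Measure.map_addHaar_smul (volume : Measure (Fin n → ℝ)) hs.ne'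
  have : ∫⁻ y, H y ∂(Measure.map (s • ·) volume) = ∫⁻ ξ, H (s • ξ) :=
    lintegral_map hH (measurable_const_smul s)
  rw [← this, h, lintegral_smul_measure]
  simp [abs_of_pos hs]

lemma kern_bound (m : ℕ) {C : ℝ} (hC : 0 ≤ C) {f : SpT n → ℝ} (hf : Continuous f) (z : SpT n) :
    ∫⁻ τ in Set.Ioi (0 : ℝ), ∫⁻ ξ : Fin n → ℝ,
      ENNReal.ofReal (C * ((Real.sqrt τ ^ m)⁻¹ * ((1 + ‖ξ‖) ^ (n + m))⁻¹))
        * ‖f (z.1 + τ, z.2 + Real.sqrt τ • ξ)‖ₑ ≤ ENNReal.ofReal C * riesz m f z := by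
  have hm : Measurable fun w : SpT n => ENNReal.ofReal ((pd w ^ (n + m))⁻¹) * ‖f (z + w)‖ₑ := by
    have h1 : Measurable (pd (n := n)) := continuous_pd.measurable
    have h2 : Measurable fun w : SpT n => f (z + w) := (hf.comp (by fun_prop)).measurable
    exact ((h1.pow_const _).inv.ennreal_ofReal).mul h2.enorm
  calc _ ≤ ∫⁻ τ in Set.Ioi (0 : ℝ), ENNReal.ofReal C * ∫⁻ y : Fin n → ℝ,
        ENNReal.ofReal ((pd (τ, y) ^ (n + m))⁻¹) * ‖f (z + (τ, y))‖ₑ := by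
        refine setLIntegral_mono' measurableSet_Ioi fun τ hτ => ?_
        have hs : 0 < Real.sqrt τ := Real.sqrt_pos.2 hτ
        set s := Real.sqrt τ
        let H : (Fin n → ℝ) → ENNReal := fun y =>
          ENNReal.ofReal (C * ((s ^ m)⁻¹ * ((1 + ‖y‖ / s) ^ (n + m))⁻¹)) * ‖f (z.1 + τ, z.2 + y)‖ₑ
        have hH : Measurable H := by
          have h2 : Measurable fun y : Fin n → ℝ => f (z.1 + τ, z.2 + y) :=
            (hf.comp (by fun_prop)).measurable
          refine Measurable.mul (Measurable.ennreal_ofReal ?_) h2.enorm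
          fun_prop
        have e : ∀ ξ : Fin n → ℝ, ENNReal.ofReal (C * ((s ^ m)⁻¹ * ((1 + ‖ξ‖) ^ (n + m))⁻¹))
            * ‖f (z.1 + τ, z.2 + s • ξ)‖ₑ = H (s • ξ) := by
          intro ξ
          simp only [H, norm_smul, Real.norm_eq_abs, abs_of_pos hs]
          rw [mul_div_cancel_left₀ _ hs.ne']
        have hmτ : Measurable fun y : Fin n → ℝ =>
            ENNReal.ofReal ((pd (τ, y) ^ (n + m))⁻¹) * ‖f (z + (τ, y))‖ₑ :=
          hm.comp measurable_prodMk_left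
        simp only [e]
        rw [lintegral_scale H hs hH, ← lintegral_const_mul _ hH,
          ← lintegral_const_mul _ hmτ]
        refine lintegral_mono fun y => ?_
        simp only [H]
        rw [← mul_assoc (ENNReal.ofReal _) (ENNReal.ofReal _), ← mul_assoc (ENNReal.ofReal C),
          ← ENNReal.ofReal_mul (by positivity), ← ENNReal.ofReal_mul hC]
        refine mul_le_mul' (ENNReal.ofReal_le_ofReal ?_) le_rfl
        have h1 : (s ^ n)⁻¹ * (C * ((s ^ m)⁻¹ * ((1 + ‖y‖ / s) ^ (n + m))⁻¹)) =
            C * ((s + ‖y‖) ^ (n + m))⁻¹ := by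
          have : s + ‖y‖ = s * (1 + ‖y‖ / s) := by field_simp
          rw [this, mul_pow, pow_add s, mul_inv, mul_inv]; ring
        rw [h1]
        have h2 : pd (τ, y) ≤ s + ‖y‖ := by
          refine max_le ?_ ?_
          · rw [abs_of_pos hτ]; exact le_add_of_nonneg_right (norm_nonneg _)
          · exact le_add_of_nonneg_left hs.le
        have h3 : 0 < pd (τ, y) := lt_max_of_lt_left (by rw [abs_of_pos hτ]; exact hs)
        gcongr
    _ ≤ ∫⁻ τ, ENNReal.ofReal C * ∫⁻ y : Fin n → ℝ,
        ENNReal.ofReal ((pd (τ, y) ^ (n + m))⁻¹) * ‖f (z + (τ, y))‖ₑ := setLIntegral_le_lintegral _ _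
    _ = _ := by
        rw [lintegral_const_mul _ hm.lintegral_prod_right', riesz, Measure.volume_eq_prod,
          lintegral_prod _ hm.aemeasurable]

lemma tconv_le_riesz (m : ℕ) {C : ℝ} (hC : 0 ≤ C) {f p : SpT n → ℝ} (hf : Continuous f) (hp : IsTest p)
    (z : SpT n) (a : ℝ → ℝ) (k : (Fin n → ℝ) → ℝ)
    (ha : ∀ τ, 0 < τ → |a τ| ≤ (Real.sqrt τ ^ m)⁻¹)
    (hk : ∀ ξ, |k ξ| * (1 + ‖ξ‖) ^ (n + m) ≤ C)
    (h : ∀ τ, 0 < τ → Real.exp (-τ) * gAvg p z τ =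
      a τ * ∫ ξ : Fin n → ℝ, k ξ * f (z.1 + τ, z.2 + Real.sqrt τ • ξ)) :
    ‖tconv (heatK n) p z‖ₑ ≤ ENNReal.ofReal C * riesz m f z := by
  refine le_trans ?_ (kern_bound m hC hf z)
  rw [heat_formula hp]
  refine (enorm_integral_le_lintegral_enorm _).trans ?_
  refine setLIntegral_mono' measurableSet_Ioi fun τ hτ => ?_
  change ‖Real.exp (-τ) * gAvg p z τ‖ₑ ≤ _
  rw [h τ hτ, ← integral_const_mul]
  refine (enorm_integral_le_lintegral_enorm _).trans (lintegral_mono fun ξ => ?_)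
  rw [← mul_assoc, enorm_mul]
  refine mul_le_mul' ?_ le_rfl
  rw [← ofReal_norm]
  refine ENNReal.ofReal_le_ofReal ?_
  have h0 : 0 < 1 + ‖ξ‖ := by positivity
  have h1 : |k ξ| ≤ C * ((1 + ‖ξ‖) ^ (n + m))⁻¹ := by
    rw [← div_eq_mul_inv, le_div_iff₀ (by positivity)]; exact hk ξ
  rw [norm_mul, Real.norm_eq_abs, Real.norm_eq_abs]
  calc |a τ| * |k ξ| ≤ (Real.sqrt τ ^ m)⁻¹ * (C * ((1 + ‖ξ‖) ^ (n + m))⁻¹) := by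
        gcongr; exact ha τ hτ
    _ = _ := by ring

lemma exp_neg_le_inv_sqrt {τ : ℝ} (hτ : 0 < τ) : Real.exp (-τ) ≤ (Real.sqrt τ ^ 1)⁻¹ := by
  rw [pow_one, Real.exp_neg]
  have h1 : Real.sqrt τ ≤ 1 + τ := by
    have := Real.sq_sqrt hτ.le
    nlinarith [sq_nonneg (Real.sqrt τ - 1), Real.sqrt_nonneg τ]
  have h2 := Real.add_one_le_exp τ
  exact inv_anti₀ (Real.sqrt_pos.2 hτ) (by linarith)

lemma tconv_bound : ∃ C : ℝ, 0 ≤ C ∧ ∀ {f : SpT n → ℝ}, IsTest f → ∀ z,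
    ‖tconv (heatK n) f z‖ₑ ≤ ENNReal.ofReal C * riesz 1 f z := by
  refine ⟨(n + 1).factorial * Real.exp (3 / 2), by positivity, fun {f} hf z => ?_⟩
  refine tconv_le_riesz 1 (by positivity) hf.continuous hf z (fun τ => Real.exp (-τ)) gdens
    (fun τ hτ => ?_) (fun ξ => ?_) fun τ hτ => rfl
  · rw [abs_of_pos (Real.exp_pos _)]; exact exp_neg_le_inv_sqrt hτ
  · rw [abs_of_pos (gdens_pos _), mul_comm]; exact one_add_norm_pow_mul_gdens_le _ _

lemma dirD_tconv_bound : ∃ C : ℝ, 0 ≤ C ∧ ∀ {f : SpT n → ℝ}, IsTest f → ∀ i z,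
    ‖dirD (eX i) (tconv (heatK n) f) z‖ₑ ≤ ENNReal.ofReal C * riesz 1 f z := by
  refine ⟨(n + 2).factorial * Real.exp (3 / 2), by positivity, fun {f} hf i z => ?_⟩
  rw [dirD_tconv _ hf]
  refine tconv_le_riesz 1 (by positivity) hf.continuous (hf.dirD _) z
    (fun τ => Real.exp (-τ) * (Real.sqrt τ)⁻¹) (fun ξ => ξ i * gdens ξ)
    (fun τ hτ => ?_) (fun ξ => ?_) fun τ hτ => ?_
  · rw [abs_of_nonneg (by positivity), pow_one]
    exact mul_le_of_le_one_left (by positivity) (Real.exp_le_one_iff.2 (by linarith))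
  · have h1 : |ξ i| ≤ 1 + ‖ξ‖ := (norm_le_pi_norm ξ i).trans (by linarith)
    have := (gdens_pos ξ).le
    rw [abs_mul, abs_of_pos (gdens_pos _)]
    refine le_trans ?_ (one_add_norm_pow_mul_gdens_le (n + 2) ξ)
    calc _ ≤ (1 + ‖ξ‖) * gdens ξ * (1 + ‖ξ‖) ^ (n + 1) := by gcongr
      _ = _ := by ring
  · have := Real.sqrt_pos.2 hτ
    rw [gAvg_dirD hf z hτ]
    field_simp

lemma dirD_dirD_tconv_bound : ∃ C : ℝ, 0 ≤ C ∧ ∀ {f : SpT n → ℝ}, IsTest f → ∀ i j z,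
    ‖dirD (eX i) (dirD (eX j) (tconv (heatK n) f)) z‖ₑ ≤ ENNReal.ofReal C * riesz 2 f z := by
  refine ⟨(n + 4).factorial * Real.exp (3 / 2), by positivity, fun {f} hf i j z => ?_⟩
  rw [dirD_tconv _ hf, dirD_tconv _ (hf.dirD _)]
  refine tconv_le_riesz 2 (by positivity) hf.continuous ((hf.dirD _).dirD _) z
    (fun τ => Real.exp (-τ) * (Real.sqrt τ ^ 2)⁻¹)
    (fun ξ => (ξ i * ξ j - if i = j then 1 else 0) * gdens ξ)
    (fun τ hτ => ?_) (fun ξ => ?_) fun τ hτ => ?_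
  · rw [abs_of_nonneg (by positivity)]
    exact mul_le_of_le_one_left (by positivity) (Real.exp_le_one_iff.2 (by linarith))
  · have h1 : |ξ i| ≤ ‖ξ‖ := norm_le_pi_norm ξ i
    have h2 : |ξ j| ≤ ‖ξ‖ := norm_le_pi_norm ξ j
    have h4 : |(if i = j then 1 else 0 : ℝ)| ≤ 1 := by split_ifs <;> simp
    have h3 : |ξ i * ξ j - if i = j then 1 else 0| ≤ (1 + ‖ξ‖) ^ 2 := by
      refine (abs_sub _ _).trans ?_
      rw [abs_mul]
      have := mul_le_mul h1 h2 (abs_nonneg _) (norm_nonneg _)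
      nlinarith [norm_nonneg ξ]
    have := (gdens_pos ξ).le
    rw [abs_mul, abs_of_pos (gdens_pos _)]
    refine le_trans ?_ (one_add_norm_pow_mul_gdens_le (n + 4) ξ)
    calc _ ≤ (1 + ‖ξ‖) ^ 2 * gdens ξ * (1 + ‖ξ‖) ^ (n + 2) := by gcongr
      _ = _ := by ring
  · have hs := Real.sqrt_pos.2 hτ
    have hsl := slice_isTest hf (z.1 + τ) z.2 hs
    have hsl2 := slice_isTest (hf.dirD (eX j)) (z.1 + τ) z.2 hs
    have g1 := gauss_ibp contDiff_gdens hsl2 (Pi.single i 1)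
    have g2 := gauss_ibp (contDiff_dirD contDiff_gdens (Pi.single i 1)) hsl (Pi.single j 1)
    simp only [dirD_slice (hf.dirD _)] at g1
    simp only [dirD_slice hf, dirD_dirD_gdens] at g2
    have e1 : ∫ ξ : Fin n → ℝ, gdens ξ * (Real.sqrt τ *
        dirD (eX i) (dirD (eX j) f) (z.1 + τ, z.2 + Real.sqrt τ • ξ)) =
        Real.sqrt τ * gAvg (dirD (eX i) (dirD (eX j) f)) z τ := by
      rw [gAvg, ← integral_const_mul]; congr 1; funext ξ; ring
    have e2 : ∫ ξ : Fin n → ℝ, dirD (Pi.single i 1) gdens ξ * (Real.sqrt τ *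
        dirD (eX j) f (z.1 + τ, z.2 + Real.sqrt τ • ξ)) = Real.sqrt τ *
        ∫ ξ : Fin n → ℝ, dirD (Pi.single i 1) gdens ξ *
        dirD (eX j) f (z.1 + τ, z.2 + Real.sqrt τ • ξ) := by
      rw [← integral_const_mul]; congr 1; funext ξ; ring
    rw [e1] at g1
    rw [e2] at g2
    have e3 : Real.sqrt τ ^ 2 * gAvg (dirD (eX i) (dirD (eX j) f)) z τ =
        ∫ ξ : Fin n → ℝ, (ξ i * ξ j - if i = j then 1 else 0) * gdens ξ *
          f (z.1 + τ, z.2 + Real.sqrt τ • ξ) := by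
      rw [pow_two, mul_assoc, g1, mul_neg, g2, neg_neg]
    rw [← e3]
    field_simp
end kern

section morrey
variable {n : ℕ}

/-- Parabolic cylinders. -/
def Pcyl (z : SpT n) (ρ : ℝ) : Set (SpT n) := {w | pd (w - z) ≤ ρ}

lemma isClosed_Pcyl (z : SpT n) (ρ : ℝ) : IsClosed (Pcyl z ρ) :=
  isClosed_le (continuous_pd.comp (by fun_prop)) continuous_const

lemma measurableSet_Pcyl (z : SpT n) (ρ : ℝ) : MeasurableSet (Pcyl z ρ) :=
  (isClosed_Pcyl z ρ).measurableSet

lemma Pcyl_eq (z : SpT n) {ρ : ℝ} (hρ : 0 ≤ ρ) :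
    Pcyl z ρ = Metric.closedBall z.1 (ρ ^ 2) ×ˢ Metric.closedBall z.2 ρ := by
  ext w
  simp [Pcyl, pd, Real.sqrt_le_left hρ, dist_eq_norm, Real.norm_eq_abs]

lemma volume_Pcyl (z : SpT n) {ρ : ℝ} (hρ : 0 ≤ ρ) :
    volume (Pcyl z ρ) = ENNReal.ofReal (2 ^ (n + 1) * ρ ^ (n + 2)) := by
  rw [Pcyl_eq z hρ, Measure.volume_eq_prod, Measure.prod_prod, Real.volume_closedBall,
    Real.volume_pi_closedBall _ hρ, ← ENNReal.ofReal_mul (by positivity), Fintype.card_fin]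
  congr 1; ring

lemma pd_add_le (v w : SpT n) : pd (v + w) ≤ pd v + pd w := by
  refine max_le ?_ ?_
  · refine le_trans ?_ (add_le_add (le_max_left _ _) (le_max_left _ _))
    have h1 := Real.sq_sqrt (abs_nonneg v.1)
    have h2 := Real.sq_sqrt (abs_nonneg w.1)
    have h3 := Real.sqrt_nonneg |v.1|
    have h4 := Real.sqrt_nonneg |w.1|
    rw [Real.sqrt_le_left (by positivity)]
    have := abs_add_le v.1 w.1
    change |v.1 + w.1| ≤ _
    nlinarith
  · exact (norm_add_le _ _).trans (add_le_add (le_max_right _ _) (le_max_right _ _))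

lemma Pcyl_subset {z z' : SpT n} {ρ ρ' : ℝ} (h : z' ∈ Pcyl z ρ) : Pcyl z' ρ' ⊆ Pcyl z (ρ + ρ') := by
  intro w hw
  have : w - z = (z' - z) + (w - z') := by abel
  rw [Pcyl, Set.mem_ofPred_eq, this]
  exact (pd_add_le _ _).trans (add_le_add h hw)

/-- Parabolic Morrey bound. -/
def MorreyB (f : SpT n → ℝ) (m : ℝ) : Prop :=
  ∀ z ρ, 0 < ρ → ∫⁻ w in Pcyl z ρ, ‖f w‖ₑ ^ 2 ≤ ENNReal.ofReal (m ^ 2 * ρ ^ (n + 1))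

lemma MorreyB.mono {f g : SpT n → ℝ} {m : ℝ} (hf : MorreyB f m) (h : ∀ w, |g w| ≤ |f w|) :
    MorreyB g m := fun z ρ hρ => by
  refine (lintegral_mono fun w => ?_).trans (hf z ρ hρ)
  have : ‖g w‖ₑ ≤ ‖f w‖ₑ := by
    rw [← ofReal_norm, ← ofReal_norm]; exact ENNReal.ofReal_le_ofReal (h w)
  gcongr

lemma MorreyB.lintegral_le {f : SpT n → ℝ} {m : ℝ} (hm : 0 < m) (hf : MorreyB f m)
    (z : SpT n) {ρ : ℝ} (hρ : 0 < ρ) :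
    ∫⁻ w in Pcyl z ρ, ‖f w‖ₑ ≤ ENNReal.ofReal (2 ^ (n + 1) * m * (Real.sqrt ρ * ρ ^ (n + 1))) := by
  have hs := Real.sqrt_pos.2 hρ
  set κ : ℝ := Real.sqrt ρ / m
  have hκ : 0 < κ := by positivity
  have hp : ∀ w, ‖f w‖ₑ ≤ ENNReal.ofReal (κ / 2) * ‖f w‖ₑ ^ 2 + ENNReal.ofReal (κ⁻¹ / 2) := by
    intro w
    rw [← ofReal_norm, ← ENNReal.ofReal_pow (norm_nonneg _), ← ENNReal.ofReal_mul (by positivity),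
      ← ENNReal.ofReal_add (by positivity) (by positivity)]
    refine ENNReal.ofReal_le_ofReal ?_
    have h1 : 0 ≤ (κ * ‖f w‖ - 1) ^ 2 / κ := by positivity
    have h2 : (κ * ‖f w‖ - 1) ^ 2 / κ = κ * ‖f w‖ ^ 2 - 2 * ‖f w‖ + κ⁻¹ := by
      field_simp; ring
    linarith
  calc _ ≤ ∫⁻ w in Pcyl z ρ, (ENNReal.ofReal (κ / 2) * ‖f w‖ₑ ^ 2 + ENNReal.ofReal (κ⁻¹ / 2)) :=
        lintegral_mono hp
    _ = ENNReal.ofReal (κ / 2) * (∫⁻ w in Pcyl z ρ, ‖f w‖ₑ ^ 2)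
        + ENNReal.ofReal (κ⁻¹ / 2) * volume (Pcyl z ρ) := by
        rw [lintegral_add_right _ measurable_const, lintegral_const_mul' _ _ ENNReal.ofReal_ne_top]
        simp
    _ ≤ ENNReal.ofReal (κ / 2) * ENNReal.ofReal (m ^ 2 * ρ ^ (n + 1))
        + ENNReal.ofReal (κ⁻¹ / 2) * ENNReal.ofReal (2 ^ (n + 1) * ρ ^ (n + 2)) := by
        rw [volume_Pcyl z hρ.le]; gcongr; exact hf z ρ hρ
    _ ≤ _ := by
        rw [← ENNReal.ofReal_mul (by positivity), ← ENNReal.ofReal_mul (by positivity),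
          ← ENNReal.ofReal_add (by positivity) (by positivity)]
        refine ENNReal.ofReal_le_ofReal ?_
        have hsq := Real.sq_sqrt hρ.le
        have e1 : κ / 2 * (m ^ 2 * ρ ^ (n + 1)) = m * (Real.sqrt ρ * ρ ^ (n + 1)) / 2 := by
          simp only [κ]; field_simp
        have e2 : κ⁻¹ / 2 * (2 ^ (n + 1) * ρ ^ (n + 2)) =
            2 ^ (n + 1) * (m * (Real.sqrt ρ * ρ ^ (n + 1))) / 2 := by
          have : ρ ^ (n + 2) = Real.sqrt ρ ^ 2 * ρ ^ (n + 1) := by rw [hsq]; ring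
          rw [this]; simp only [κ]; field_simp
        rw [e1, e2]
        have h1 : (1 : ℝ) ≤ 2 ^ (n + 1) := one_le_pow₀ (by norm_num)
        have h2 : 0 ≤ m * (Real.sqrt ρ * ρ ^ (n + 1)) := by positivity
        nlinarith

lemma lintegral_Ioi_inv_pow {N : ℕ} (hN : 1 ≤ N) {c : ℝ} (hc : 0 < c) :
    ∫⁻ ρ in Set.Ioi c, ENNReal.ofReal (N * (ρ ^ (N + 1))⁻¹) = ENNReal.ofReal ((c ^ N)⁻¹) := by
  have h1 : (-(N : ℝ) - 1) < -1 := by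
    have : (1 : ℝ) ≤ N := by exact_mod_cast hN
    linarith
  have e : ∀ ρ ∈ Set.Ioi c, N * (ρ ^ (N + 1))⁻¹ = N * ρ ^ (-(N : ℝ) - 1) := by
    intro ρ hρ
    have : 0 < ρ := hc.trans hρ
    rw [show -(N : ℝ) - 1 = -((N + 1 : ℕ) : ℝ) by push_cast; ring, Real.rpow_neg this.le,
      Real.rpow_natCast]
  rw [setLIntegral_congr_fun measurableSet_Ioi fun ρ hρ => congrArg _ (e ρ hρ),
    ← ofReal_integral_eq_lintegral_ofReal ((integrableOn_Ioi_rpow_of_lt h1 hc).const_mul _),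
    integral_const_mul, integral_Ioi_rpow_of_lt h1 hc]
  · congr 1
    rw [show -(N : ℝ) - 1 + 1 = -(N : ℝ) by ring, Real.rpow_neg hc.le, Real.rpow_natCast]
    have : (N : ℝ) ≠ 0 := by positivity
    field_simp
  · refine (ae_restrict_iff' measurableSet_Ioi).2 (ae_of_all _ fun ρ hρ => ?_)
    have : 0 < ρ := hc.trans hρ
    positivity

lemma riesz_le_layer {m : ℕ} (hm : 1 ≤ m) {f : SpT n → ℝ} (hf : Continuous f) (z : SpT n) :
    riesz m f z ≤ ∫⁻ ρ in Set.Ioi (0 : ℝ),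
      ENNReal.ofReal ((n + m : ℕ) * (ρ ^ (n + m + 1))⁻¹) * ∫⁻ w in Pcyl z ρ, ‖f w‖ₑ := by
  have hN : 1 ≤ n + m := by omega
  set N := n + m
  have hms : MeasurableSet {p : SpT n × ℝ | pd p.1 ≤ p.2} :=
    (isClosed_le (continuous_pd.comp continuous_fst) continuous_snd).measurableSet
  have h1 : ∀ w : SpT n, ENNReal.ofReal ((pd w ^ N)⁻¹) ≤ ∫⁻ ρ in Set.Ioi (0 : ℝ),
      ENNReal.ofReal (N * (ρ ^ (N + 1))⁻¹) * {p : SpT n × ℝ | pd p.1 ≤ p.2}.indicator 1 (w, ρ) := by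
    intro w
    rcases (pd_nonneg w).eq_or_lt with h0 | h0
    · rw [← h0, zero_pow (by omega)]; simp
    · rw [← lintegral_Ioi_inv_pow hN h0]
      refine (setLIntegral_mono' measurableSet_Ioi fun ρ hρ => ?_).trans
        (lintegral_mono_set (Set.Ioi_subset_Ioi h0.le))
      rw [Set.indicator_of_mem (show ((w, ρ) : SpT n × ℝ) ∈ {p : SpT n × ℝ | pd p.1 ≤ p.2} from le_of_lt (a := pd w) hρ)]
      simp
  have hfm : Measurable fun w : SpT n => ‖f (z + w)‖ₑ := by
    have h2 : Measurable fun w : SpT n => f (z + w) := (hf.comp (by fun_prop)).measurable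
    exact h2.enorm
  have hmeas : Measurable fun p : SpT n × ℝ => ENNReal.ofReal (N * (p.2 ^ (N + 1))⁻¹) *
      {p : SpT n × ℝ | pd p.1 ≤ p.2}.indicator 1 p * ‖f (z + p.1)‖ₑ := by
    refine (Measurable.mul ?_ (measurable_one.indicator hms)).mul (hfm.comp measurable_fst)
    exact (((measurable_snd.pow_const _).inv).const_mul _).ennreal_ofReal
  have hmeas1 : ∀ w : SpT n, Measurable fun ρ : ℝ => ENNReal.ofReal (N * (ρ ^ (N + 1))⁻¹) *
      {p : SpT n × ℝ | pd p.1 ≤ p.2}.indicator 1 (w, ρ) := by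
    intro w
    refine Measurable.mul ?_ ((measurable_one.indicator hms).comp measurable_prodMk_left)
    exact (((measurable_id.pow_const _).inv).const_mul _).ennreal_ofReal
  calc riesz m f z ≤ ∫⁻ w, ∫⁻ ρ in Set.Ioi (0 : ℝ), ENNReal.ofReal (N * (ρ ^ (N + 1))⁻¹) *
        {p : SpT n × ℝ | pd p.1 ≤ p.2}.indicator 1 (w, ρ) * ‖f (z + w)‖ₑ := by
        refine lintegral_mono fun w => ?_
        rw [lintegral_mul_const _ (hmeas1 w)]
        exact mul_le_mul' (h1 w) le_rfl
    _ = ∫⁻ ρ in Set.Ioi (0 : ℝ), ∫⁻ w, ENNReal.ofReal (N * (ρ ^ (N + 1))⁻¹) *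
        {p : SpT n × ℝ | pd p.1 ≤ p.2}.indicator 1 (w, ρ) * ‖f (z + w)‖ₑ :=
        lintegral_lintegral_swap hmeas.aemeasurable
    _ = _ := by
        refine lintegral_congr fun ρ => ?_
        simp only [mul_assoc]
        rw [lintegral_const_mul' _ _ ENNReal.ofReal_ne_top]
        congr 1
        rw [← lintegral_indicator (measurableSet_Pcyl z ρ),
          ← lintegral_add_left_eq_self ((Pcyl z ρ).indicator fun w => ‖f w‖ₑ) z]
        refine lintegral_congr fun w => ?_
        by_cases h : pd w ≤ ρ
        · rw [Set.indicator_of_mem (show ((w, ρ) : SpT n × ℝ) ∈ {p : SpT n × ℝ | pd p.1 ≤ p.2} from h),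
            Set.indicator_of_mem (show z + w ∈ Pcyl z ρ by simpa [Pcyl] using h)]
          simp
        · rw [Set.indicator_of_notMem (show ((w, ρ) : SpT n × ℝ) ∉ {p : SpT n × ℝ | pd p.1 ≤ p.2} from h),
            Set.indicator_of_notMem (show z + w ∉ Pcyl z ρ by simpa [Pcyl] using h)]
          simp

lemma lintegral_sqrt_inv_Ioc : ∫⁻ ρ in Set.Ioc (0 : ℝ) 1, ENNReal.ofReal ((Real.sqrt ρ)⁻¹) =
    ENNReal.ofReal 2 := by
  have e : ∀ ρ ∈ Set.Ioc (0 : ℝ) 1, (Real.sqrt ρ)⁻¹ = ρ ^ (-(1 / 2) : ℝ) := by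
    intro ρ hρ
    rw [Real.rpow_neg hρ.1.le, Real.sqrt_eq_rpow]
  have hi := (intervalIntegral.intervalIntegrable_rpow' (a := 0) (b := 1) (r := -(1 / 2)) (by norm_num)).1
  rw [setLIntegral_congr_fun measurableSet_Ioc fun ρ hρ => congrArg _ (e ρ hρ),
    ← ofReal_integral_eq_lintegral_ofReal hi, ← intervalIntegral.integral_of_le zero_le_one,
    integral_rpow (Or.inl (by norm_num))]
  · norm_num
  · refine (ae_restrict_iff' measurableSet_Ioc).2 (ae_of_all _ fun ρ hρ => ?_)
    exact Real.rpow_nonneg hρ.1.le _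

lemma lintegral_sqrt_inv_Ioi {c : ℝ} (hc : 0 < c) :
    ∫⁻ ρ in Set.Ioi c, ENNReal.ofReal ((ρ * Real.sqrt ρ)⁻¹) =
    ENNReal.ofReal (2 * (Real.sqrt c)⁻¹) := by
  have e : ∀ ρ ∈ Set.Ioi c, (ρ * Real.sqrt ρ)⁻¹ = ρ ^ (-(3 / 2) : ℝ) := by
    intro ρ hρ
    have : 0 < ρ := hc.trans hρ
    rw [Real.rpow_neg this.le, Real.sqrt_eq_rpow]
    nth_rewrite 1 [← Real.rpow_one ρ]
    rw [← Real.rpow_add this]; norm_num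
  rw [setLIntegral_congr_fun measurableSet_Ioi fun ρ hρ => congrArg _ (e ρ hρ),
    ← ofReal_integral_eq_lintegral_ofReal (integrableOn_Ioi_rpow_of_lt (by norm_num) hc),
    integral_Ioi_rpow_of_lt (by norm_num) hc]
  · congr 1
    rw [Real.sqrt_eq_rpow, ← Real.rpow_neg hc.le]
    norm_num
    ring
  · refine (ae_restrict_iff' measurableSet_Ioi).2 (ae_of_all _ fun ρ hρ => ?_)
    have : 0 < ρ := hc.trans hρ
    positivity

lemma riesz_one_le : ∃ C : ℝ, 0 ≤ C ∧ ∀ (f : SpT n → ℝ) (m A : ℝ), Continuous f → 0 < m → 0 ≤ A →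
    MorreyB f m → (∫⁻ w, ‖f w‖ₑ ≤ ENNReal.ofReal A) → ∀ z, riesz 1 f z ≤ ENNReal.ofReal (C * m + A) := by
  refine ⟨(n + 1) * 2 ^ (n + 1) * 2, by positivity, fun f m A hf hm hA hM hL z => ?_⟩
  refine (riesz_le_layer le_rfl hf z).trans ?_
  rw [← Set.Ioc_union_Ioi_eq_Ioi (zero_le_one (α := ℝ)),
    lintegral_union measurableSet_Ioi (Set.Ioc_disjoint_Ioi le_rfl),
    ENNReal.ofReal_add (by positivity) hA]
  refine add_le_add ?_ ?_
  · calc _ ≤ ∫⁻ ρ in Set.Ioc (0 : ℝ) 1, ENNReal.ofReal ((n + 1) * 2 ^ (n + 1) * m) *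
          ENNReal.ofReal ((Real.sqrt ρ)⁻¹) := by
          refine setLIntegral_mono' measurableSet_Ioc fun ρ hρ => ?_
          have h0 := hρ.1
          have hs := Real.sqrt_pos.2 h0
          refine (mul_le_mul' le_rfl (hM.lintegral_le hm z h0)).trans ?_
          rw [← ENNReal.ofReal_mul (by positivity), ← ENNReal.ofReal_mul (by positivity)]
          refine ENNReal.ofReal_le_ofReal (le_of_eq ?_)
          have e : ρ ^ (n + 1 + 1) = Real.sqrt ρ ^ 2 * ρ ^ (n + 1) := by
            rw [Real.sq_sqrt h0.le]; ring
          rw [e]; push_cast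
          field_simp
      _ = _ := by
          rw [lintegral_const_mul' _ _ ENNReal.ofReal_ne_top, lintegral_sqrt_inv_Ioc,
            ← ENNReal.ofReal_mul (by positivity)]
          congr 1; ring
  · calc _ ≤ ∫⁻ ρ in Set.Ioi (1 : ℝ), ENNReal.ofReal ((n + 1 : ℕ) * (ρ ^ (n + 1 + 1))⁻¹) *
          ENNReal.ofReal A :=
          lintegral_mono fun ρ => mul_le_mul' le_rfl ((setLIntegral_le_lintegral _ _).trans hL)
      _ = _ := by
          rw [lintegral_mul_const' _ _ ENNReal.ofReal_ne_top, lintegral_Ioi_inv_pow (by omega) one_pos]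
          simp

lemma riesz_two_le : ∃ C : ℝ, 0 ≤ C ∧ ∀ (f : SpT n → ℝ) (m ρ₀ : ℝ) (z : SpT n), Continuous f → 0 < m →
    0 < ρ₀ → MorreyB f m → (∀ w ∈ Pcyl z ρ₀, f w = 0) →
    riesz 2 f z ≤ ENNReal.ofReal (C * m * (Real.sqrt ρ₀)⁻¹) := by
  refine ⟨(n + 2) * 2 ^ (n + 1) * 2, by positivity, fun f m ρ₀ z hf hm hρ₀ hM hL => ?_⟩
  refine (riesz_le_layer one_le_two hf z).trans ?_
  rw [← Set.Ioc_union_Ioi_eq_Ioi hρ₀.le,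
    lintegral_union measurableSet_Ioi (Set.Ioc_disjoint_Ioi le_rfl)]
  have h0 : ∫⁻ ρ in Set.Ioc (0 : ℝ) ρ₀, ENNReal.ofReal ((n + 2 : ℕ) * (ρ ^ (n + 2 + 1))⁻¹) *
      ∫⁻ w in Pcyl z ρ, ‖f w‖ₑ = 0 := by
    rw [setLIntegral_congr_fun (g := fun _ => 0) measurableSet_Ioc fun ρ hρ => ?_]
    · simp
    · have : ∫⁻ w in Pcyl z ρ, ‖f w‖ₑ = 0 := by
        rw [setLIntegral_congr_fun (g := fun _ => 0) (measurableSet_Pcyl z ρ) fun w hw => ?_]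
        · simp
        · simp [hL w (le_trans hw hρ.2)]
      simp only [this, mul_zero]
  rw [h0, zero_add]
  calc _ ≤ ∫⁻ ρ in Set.Ioi ρ₀, ENNReal.ofReal ((n + 2) * 2 ^ (n + 1) * m) *
          ENNReal.ofReal ((ρ * Real.sqrt ρ)⁻¹) := by
          refine setLIntegral_mono' measurableSet_Ioi fun ρ hρ => ?_
          have h0 : 0 < ρ := hρ₀.trans hρ
          have hs := Real.sqrt_pos.2 h0
          refine (mul_le_mul' le_rfl (hM.lintegral_le hm z h0)).trans ?_
          rw [← ENNReal.ofReal_mul (by positivity), ← ENNReal.ofReal_mul (by positivity)]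
          refine ENNReal.ofReal_le_ofReal (le_of_eq ?_)
          have e : ρ ^ (n + 2 + 1) = Real.sqrt ρ ^ 2 * ρ * ρ ^ (n + 1) := by
            rw [Real.sq_sqrt h0.le]; ring
          rw [e]; push_cast
          field_simp
      _ = _ := by
          rw [lintegral_const_mul' _ _ ENNReal.ofReal_ne_top, lintegral_sqrt_inv_Ioi hρ₀,
            ← ENNReal.ofReal_mul (by positivity)]
          congr 1; ring
end morrey

lemma exists_cutoff {E : Type*} [NormedAddCommGroup E] [NormedSpace ℝ E] [FiniteDimensional ℝ E]
    {K U : Set E} (hK : IsClosed K) (hU : IsOpen U) (hKU : K ⊆ U) (hb : Bornology.IsBounded U) :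
    ∃ χ : E → ℝ, IsTest χ ∧ (∀ z, 0 ≤ χ z) ∧ (∀ z, χ z ≤ 1) ∧ (∀ z ∈ K, χ z = 1) ∧
      ∀ z, z ∉ U → χ z = 0 := by
  obtain ⟨χ, h1, h2, h3, h4⟩ := exists_contMDiff_zero_iff_one_iff_of_isClosed (modelWithCornersSelf ℝ E)
    (n := (⊤ : ℕ∞)) hU.isClosed_compl hK (Set.disjoint_left.2 fun x hx hx' => hx (hKU hx'))
  have h0 : ∀ z, χ z ∈ Set.Icc (0 : ℝ) 1 := fun z => h2 ⟨z, rfl⟩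
  refine ⟨χ, ⟨h1.contDiff, ?_⟩, fun z => (h0 z).1, fun z => (h0 z).2, fun z hz => (h4 z).1 hz,
    fun z hz => (h3 z).1 hz⟩
  refine HasCompactSupport.intro hb.isCompact_closure fun z hz => (h3 z).1 fun hz' => hz (subset_closure hz')

section morrey
variable {n : ℕ}

lemma tconv_add {κ : Measure (SpT n)} [IsFiniteMeasure κ] {f g : SpT n → ℝ} (hf : IsTest f)
    (hg : IsTest g) (z : SpT n) : tconv κ (fun w => f w + g w) z = tconv κ f z + tconv κ g z :=
  integral_add (integrable_translate κ hf.continuous hf.2 z) (integrable_translate κ hg.continuous hg.2 z)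

lemma dirD_add {E : Type*} [NormedAddCommGroup E] [NormedSpace ℝ E] {f g : E → ℝ} (v z : E)
    (hf : DifferentiableAt ℝ f z) (hg : DifferentiableAt ℝ g z) :
    dirD v (fun z => f z + g z) z = dirD v f z + dirD v g z := by
  simp only [_root_.dirD]
  rw [fderiv_fun_add hf hg]; rfl

lemma isOpen_pd_lt (z : SpT n) (ρ : ℝ) : IsOpen {w : SpT n | pd (w - z) < ρ} :=
  isOpen_lt (continuous_pd.comp (by fun_prop)) continuous_const

lemma isBounded_Pcyl (z : SpT n) {ρ : ℝ} (hρ : 0 ≤ ρ) : Bornology.IsBounded (Pcyl z ρ) := by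
  rw [Pcyl_eq z hρ]
  exact Metric.isBounded_closedBall.prod Metric.isBounded_closedBall

lemma morrey_D2 : ∃ C : ℝ, 0 < C ∧ ∀ {f : SpT n → ℝ} {m : ℝ}, IsTest f → 0 < m → MorreyB f m →
    ∀ i j, MorreyB (dirD (eX i) (dirD (eX j) (tconv (heatK n) f))) (C * m) := by
  obtain ⟨C₁, hC₁, hD⟩ := dirD_dirD_tconv_bound (n := n)
  obtain ⟨C₂, hC₂, hR⟩ := riesz_two_le (n := n)
  set I := ∫ ξ : Fin n → ℝ, gdens ξ
  set A : ℝ := 2 * (4 * I ^ 2 * 3 ^ (n + 1)) + 2 * (2 ^ (n + 1) * (C₁ * C₂) ^ 2)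
  have hA : 0 ≤ A := by positivity
  refine ⟨A + 1, by positivity, fun {f m} hf hm hM i j z ρ hρ => ?_⟩
  obtain ⟨χ, hχ, hχ0, hχ1, hχK, hχU⟩ := exists_cutoff (isClosed_Pcyl z (2 * ρ)) (isOpen_pd_lt z (3 * ρ))
    (fun w (hw : pd (w - z) ≤ _) => lt_of_le_of_lt hw (by linarith))
    ((isBounded_Pcyl z (by positivity : 0 ≤ 3 * ρ)).subset fun w (hw : pd (w - z) < _) => le_of_lt hw)
  set f1 : SpT n → ℝ := fun w => χ w * f w
  set f2 : SpT n → ℝ := fun w => (1 - χ w) * f w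
  have hf1 : IsTest f1 := IsTest.mul hχ.1 hf
  have hf2 : IsTest f2 := IsTest.mul (contDiff_const.sub hχ.1) hf
  have hsplit : f = fun w => f1 w + f2 w := by funext w; simp only [f1, f2]; ring
  set D : (SpT n → ℝ) → SpT n → ℝ := fun f => dirD (eX i) (dirD (eX j) (tconv (heatK n) f))
  have hDc : ∀ {f}, IsTest f → Continuous (D f) := fun hf =>
    (contDiff_dirD (contDiff_dirD (contDiff_tconv _ hf) _) _).continuous
  have hadd : ∀ w, D f w = D f1 w + D f2 w := by
    intro w
    have e1 : tconv (heatK n) f = fun w => tconv (heatK n) f1 w + tconv (heatK n) f2 w := by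
      funext w; conv_lhs => rw [hsplit]
      exact tconv_add hf1 hf2 w
    have e2 : dirD (eX j) (tconv (heatK n) f) = fun w => dirD (eX j) (tconv (heatK n) f1) w +
        dirD (eX j) (tconv (heatK n) f2) w := by
      funext w; rw [e1]
      exact dirD_add _ _ ((contDiff_tconv _ hf1).differentiable (by simp) w)
        ((contDiff_tconv _ hf2).differentiable (by simp) w)
    simp only [D]; rw [e2]
    exact dirD_add _ _ ((contDiff_dirD (contDiff_tconv _ hf1) _).differentiable (by simp) w)
      ((contDiff_dirD (contDiff_tconv _ hf2) _).differentiable (by simp) w)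
  have near : ∫⁻ w, ‖D f1 w‖ₑ ^ 2 ≤ ENNReal.ofReal (4 * I ^ 2 * (m ^ 2 * (3 * ρ) ^ (n + 1))) := by
    have hsq : ∀ g : SpT n → ℝ, ∀ w, ‖g w‖ₑ ^ 2 = ENNReal.ofReal (g w ^ 2) := by
      intro g w
      rw [← ofReal_norm, ← ENNReal.ofReal_pow (norm_nonneg _), Real.norm_eq_abs, sq_abs]
    have h2 : ∫⁻ w, ENNReal.ofReal (f1 w ^ 2) ≤ ENNReal.ofReal (m ^ 2 * (3 * ρ) ^ (n + 1)) := by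
      refine le_trans ?_ (hM z (3 * ρ) (by positivity))
      rw [← lintegral_indicator (measurableSet_Pcyl _ _)]
      refine lintegral_mono fun w => ?_
      by_cases hw : w ∈ Pcyl z (3 * ρ)
      · rw [Set.indicator_of_mem hw, hsq]
        refine ENNReal.ofReal_le_ofReal ?_
        simp only [f1]; rw [mul_pow]
        exact mul_le_of_le_one_left (sq_nonneg _) (pow_le_one₀ (hχ0 w) (hχ1 w))
      · have : f1 w = 0 := by
          simp only [f1]; rw [hχU w fun h => hw (le_of_lt (a := pd (w - z)) h), zero_mul]
        simp [this]
    have hi : Integrable (fun w => f1 w ^ 2) := by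
      have := (IsTest.mul hf1.1 hf1).integrable volume
      simpa [pow_two] using this
    rw [← ofReal_integral_eq_lintegral_ofReal hi (ae_of_all _ fun w => sq_nonneg _)] at h2
    have h3 := (ENNReal.ofReal_le_ofReal_iff (by positivity)).1 h2
    have hi2 : Integrable (fun w => D f1 w ^ 2) := by
      have e : D f1 = tconv (heatK n) (dirD (eX i) (dirD (eX j) f1)) := by
        simp only [D]; rw [dirD_tconv _ hf1, dirD_tconv _ (hf1.dirD _)]
      obtain ⟨B, hB⟩ := bounded_tconv (heatK n) ((hf1.dirD (eX j)).dirD (eX i))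
      have h5 := integrable_tconv volume (heatK n) ((hf1.dirD (eX j)).dirD (eX i))
      rw [← e] at h5 hB
      refine (h5.bdd_mul (c := B) (hDc hf1).aestronglyMeasurable (ae_of_all _ hB)).congr (ae_of_all _ fun w => ?_)
      simp [pow_two]
    simp only [hsq]
    rw [← ofReal_integral_eq_lintegral_ofReal hi2 (ae_of_all _ fun w => sq_nonneg _)]
    refine ENNReal.ofReal_le_ofReal ((heat_L2 hf1 i j).trans ?_)
    gcongr
  have far : ∀ w ∈ Pcyl z ρ, ‖D f2 w‖ₑ ≤ ENNReal.ofReal (C₁ * (C₂ * m * (Real.sqrt ρ)⁻¹)) := by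
    intro w hw
    refine (hD hf2 i j w).trans ?_
    rw [ENNReal.ofReal_mul hC₁]
    refine mul_le_mul' le_rfl (hR f2 m ρ w hf2.continuous hm hρ (hM.mono fun w => ?_) fun w' hw' => ?_)
    · simp only [f2]; rw [abs_mul]
      refine mul_le_of_le_one_left (abs_nonneg _) ?_
      rw [abs_of_nonneg (by linarith [hχ1 w])]; linarith [hχ0 w]
    · simp only [f2]
      rw [hχK w' (by rw [two_mul]; exact Pcyl_subset hw hw')]; ring
  have h2sq : ∀ a b : ENNReal, (a + b) ^ 2 ≤ 2 * a ^ 2 + 2 * b ^ 2 := by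
    intro a b
    have := ENNReal.rpow_add_le_mul_rpow_add_rpow a b (p := 2) (by norm_num)
    norm_num [mul_add] at this
    exact this
  calc ∫⁻ w in Pcyl z ρ, ‖D f w‖ₑ ^ 2
      ≤ ∫⁻ w in Pcyl z ρ, (2 * ‖D f1 w‖ₑ ^ 2 + 2 * ENNReal.ofReal ((C₁ * (C₂ * m * (Real.sqrt ρ)⁻¹)) ^ 2)) := by
        refine setLIntegral_mono' (measurableSet_Pcyl z ρ) fun w hw => ?_
        rw [hadd]
        refine (pow_le_pow_left₀ zero_le (enorm_add_le _ _) 2).trans ((h2sq _ _).trans ?_)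
        rw [ENNReal.ofReal_pow (by positivity)]
        gcongr
        exact far w hw
    _ = 2 * (∫⁻ w in Pcyl z ρ, ‖D f1 w‖ₑ ^ 2) + 2 * ENNReal.ofReal ((C₁ * (C₂ * m * (Real.sqrt ρ)⁻¹)) ^ 2)
        * volume (Pcyl z ρ) := by
        rw [lintegral_add_right _ measurable_const, lintegral_const_mul' _ _ (by simp)]
        simp
    _ ≤ 2 * ENNReal.ofReal (4 * I ^ 2 * (m ^ 2 * (3 * ρ) ^ (n + 1))) +
        2 * ENNReal.ofReal ((C₁ * (C₂ * m * (Real.sqrt ρ)⁻¹)) ^ 2)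
        * ENNReal.ofReal (2 ^ (n + 1) * ρ ^ (n + 2)) := by
        rw [volume_Pcyl z hρ.le]; gcongr
        exact (setLIntegral_le_lintegral _ _).trans near
    _ ≤ _ := by
        rw [show (2 : ENNReal) = ENNReal.ofReal 2 by simp, ← ENNReal.ofReal_mul (by positivity),
          ← ENNReal.ofReal_mul (by positivity), ← ENNReal.ofReal_mul (by positivity),
          ← ENNReal.ofReal_add (by positivity) (by positivity)]
        refine ENNReal.ofReal_le_ofReal ?_
        have hs := Real.sqrt_pos.2 hρ
        have e : 2 * (4 * I ^ 2 * (m ^ 2 * (3 * ρ) ^ (n + 1))) + 2 * (C₁ * (C₂ * m * (Real.sqrt ρ)⁻¹)) ^ 2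
            * (2 ^ (n + 1) * ρ ^ (n + 2)) = A * (m ^ 2 * ρ ^ (n + 1)) := by
          have e1 : ρ ^ (n + 2) = Real.sqrt ρ ^ 2 * ρ ^ (n + 1) := by rw [Real.sq_sqrt hρ.le]; ring
          rw [e1]; simp only [A]; rw [mul_pow 3 ρ]
          field_simp
        rw [e, mul_pow, mul_assoc]
        refine mul_le_mul_of_nonneg_right ?_ (by positivity)
        nlinarith
end morrey

section absorption
variable {n : ℕ}

lemma ball_subset_Pcyl (z : SpT n) {R : ℝ} (hR : 0 < R) : Metric.ball z R ⊆ Pcyl z (R + 1) := by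
  intro w hw
  rw [mem_ball_iff_norm] at hw
  have h1 : |(w - z).1| ≤ R := (norm_fst_le (w - z)).trans hw.le
  have h2 : ‖(w - z).2‖ ≤ R := (norm_snd_le (w - z)).trans hw.le
  refine max_le ?_ (h2.trans (by linarith))
  rw [Real.sqrt_le_left (by linarith)]
  nlinarith

lemma morrey_L1 (z₀ : SpT n) {R : ℝ} (hR : 0 < R) : ∃ C : ℝ, 0 ≤ C ∧ ∀ {f : SpT n → ℝ} {m : ℝ}, 0 < m →
    MorreyB f m → (∀ z, z ∉ Metric.ball z₀ R → f z = 0) → ∫⁻ z, ‖f z‖ₑ ≤ ENNReal.ofReal (C * m) := by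
  refine ⟨2 ^ (n + 1) * (Real.sqrt (R + 1) * (R + 1) ^ (n + 1)), by positivity, fun {f m} hm hM h0 => ?_⟩
  have h := hM.lintegral_le hm z₀ (by positivity : 0 < R + 1)
  rw [← lintegral_indicator (measurableSet_Pcyl _ _)] at h
  refine (lintegral_mono fun w => ?_).trans (h.trans (le_of_eq (by congr 1; ring)))
  by_cases hw : w ∈ Pcyl z₀ (R + 1)
  · rw [Set.indicator_of_mem hw]
  · rw [h0 w fun h => hw (ball_subset_Pcyl z₀ hR h)]; simp

lemma heat_sup (z₀ : SpT n) {R : ℝ} (hR : 0 < R) : ∃ C : ℝ, 0 ≤ C ∧ ∀ {f : SpT n → ℝ} {m : ℝ}, IsTest f →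
    0 < m → MorreyB f m → (∀ z, z ∉ Metric.ball z₀ R → f z = 0) →
    ∀ z, |tconv (heatK n) f z| ≤ C * m ∧ ∀ i, |dirD (eX i) (tconv (heatK n) f) z| ≤ C * m := by
  obtain ⟨C₁, hC₁, h1⟩ := tconv_bound (n := n)
  obtain ⟨C₂, hC₂, h2⟩ := dirD_tconv_bound (n := n)
  obtain ⟨C₃, hC₃, h3⟩ := riesz_one_le (n := n)
  obtain ⟨C₄, hC₄, h4⟩ := morrey_L1 z₀ hR
  refine ⟨(C₁ + C₂) * (C₃ + C₄), by positivity, fun {f m} hf hm hM h0 z => ?_⟩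
  have h5 := h3 f m (C₄ * m) hf.continuous hm (by positivity) hM (h4 hm hM h0) z
  have key : ∀ {x C : ℝ}, 0 ≤ C → C ≤ C₁ + C₂ → ‖x‖ₑ ≤ ENNReal.ofReal C * riesz 1 f z →
      |x| ≤ (C₁ + C₂) * (C₃ + C₄) * m := by
    intro x C hC hC' hx
    have h6 := hx.trans (mul_le_mul' le_rfl h5)
    rw [← ENNReal.ofReal_mul hC, ← ofReal_norm, ENNReal.ofReal_le_ofReal_iff (by positivity)] at h6
    rw [← Real.norm_eq_abs]
    refine h6.trans ?_
    rw [mul_assoc, add_mul C₃]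
    gcongr
  exact ⟨key hC₁ (by linarith) (h1 hf z), fun i => key hC₂ (by linarith) (h2 hf i z)⟩

/-- A smooth compactly supported majorant of `|g|`, with almost the same Morrey norm. -/
lemma exists_smooth_abs (z₀ : SpT n) {R : ℝ} (hR : 0 < R) {χ g : SpT n → ℝ} (hχ : IsTest χ)
    (hχ0 : ∀ z, 0 ≤ χ z) (hχ1 : ∀ z, χ z ≤ 1) (hχU : ∀ z, z ∉ Metric.ball z₀ R → χ z = 0)
    (hg : ContDiff ℝ (⊤ : ℕ∞) g) {m m' : ℝ} (hm : 0 < m) (hm' : 0 < m') (hM : MorreyB g m') :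
    ∃ h : SpT n → ℝ, IsTest h ∧ (∀ z, 0 ≤ h z) ∧ (∀ z, z ∉ Metric.ball z₀ R → h z = 0) ∧
      (∀ z, χ z = 1 → |g z| ≤ h z) ∧ MorreyB h (m' + m) := by
  set K := R + 1
  have hK : 0 < K := by positivity
  set κ : ℝ := m ^ 2 / (2 ^ (n + 1) * K)
  have hκ : 0 < κ := by positivity
  have hpos : ∀ z, 0 < g z ^ 2 + κ := fun z => by positivity
  have hs : ContDiff ℝ (⊤ : ℕ∞) fun z => Real.sqrt (g z ^ 2 + κ) :=
    ((hg.pow 2).add contDiff_const).sqrt fun z => (hpos z).ne'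
  refine ⟨fun z => Real.sqrt (g z ^ 2 + κ) * χ z, IsTest.mul hs hχ,
    fun z => mul_nonneg (Real.sqrt_nonneg _) (hχ0 z), fun z hz => by simp [hχU z hz],
    fun z hz => ?_, fun z ρ hρ => ?_⟩
  · change |g z| ≤ Real.sqrt (g z ^ 2 + κ) * χ z
    rw [hz, mul_one, ← Real.sqrt_sq_eq_abs]
    exact Real.sqrt_le_sqrt (by linarith)
  · have hb : ∀ w, ‖Real.sqrt (g w ^ 2 + κ) * χ w‖ₑ ^ 2 ≤ ‖g w‖ₑ ^ 2 +
        (Pcyl z₀ K).indicator (fun _ => ENNReal.ofReal κ) w := by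
      intro w
      have h1 : ‖Real.sqrt (g w ^ 2 + κ) * χ w‖ ^ 2 = (g w ^ 2 + κ) * χ w ^ 2 := by
        rw [Real.norm_eq_abs, sq_abs, mul_pow, Real.sq_sqrt (hpos w).le]
      rw [← ofReal_norm, ← ofReal_norm (g w), ← ENNReal.ofReal_pow (norm_nonneg _),
        ← ENNReal.ofReal_pow (norm_nonneg _), h1, Real.norm_eq_abs, sq_abs]
      by_cases hw : w ∈ Pcyl z₀ K
      · rw [Set.indicator_of_mem hw, ← ENNReal.ofReal_add (by positivity) hκ.le]
        exact ENNReal.ofReal_le_ofReal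
          (mul_le_of_le_one_right (hpos w).le (pow_le_one₀ (hχ0 w) (hχ1 w)))
      · rw [hχU w fun h => hw (ball_subset_Pcyl z₀ hR h)]; simp
    have hvol : ENNReal.ofReal κ * volume (Pcyl z₀ K ∩ Pcyl z ρ) ≤ ENNReal.ofReal (m ^ 2 * ρ ^ (n + 1)) := by
      rcases le_total ρ K with h | h
      · refine (mul_le_mul' le_rfl (measure_mono Set.inter_subset_right)).trans ?_
        rw [volume_Pcyl z hρ.le, ← ENNReal.ofReal_mul hκ.le]
        refine ENNReal.ofReal_le_ofReal ?_
        calc _ = m ^ 2 * ρ ^ (n + 1) * (ρ / K) := by simp only [κ]; field_simp; ring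
          _ ≤ m ^ 2 * ρ ^ (n + 1) * 1 := by gcongr; exact (div_le_one hK).2 h
          _ = _ := mul_one _
      · refine (mul_le_mul' le_rfl (measure_mono Set.inter_subset_left)).trans ?_
        rw [volume_Pcyl z₀ hK.le, ← ENNReal.ofReal_mul hκ.le]
        refine ENNReal.ofReal_le_ofReal ?_
        calc _ = m ^ 2 * K ^ (n + 1) := by simp only [κ]; field_simp; ring
          _ ≤ m ^ 2 * ρ ^ (n + 1) := by gcongr
    calc _ ≤ ∫⁻ w in Pcyl z ρ, (‖g w‖ₑ ^ 2 + (Pcyl z₀ K).indicator (fun _ => ENNReal.ofReal κ) w) :=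
          lintegral_mono hb
      _ = (∫⁻ w in Pcyl z ρ, ‖g w‖ₑ ^ 2) + ENNReal.ofReal κ * volume (Pcyl z₀ K ∩ Pcyl z ρ) := by
          rw [lintegral_add_right _ (measurable_const.indicator (measurableSet_Pcyl _ _)),
            lintegral_indicator_const (measurableSet_Pcyl _ _),
            Measure.restrict_apply (measurableSet_Pcyl _ _)]
      _ ≤ ENNReal.ofReal (m' ^ 2 * ρ ^ (n + 1)) + ENNReal.ofReal (m ^ 2 * ρ ^ (n + 1)) :=
          add_le_add (hM z ρ hρ) hvol
      _ ≤ _ := by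
          rw [← ENNReal.ofReal_add (by positivity) (by positivity)]
          refine ENNReal.ofReal_le_ofReal ?_
          rw [← add_mul]
          gcongr
          nlinarith

/-- The parabolic operator with coefficients `a`, `b`. -/
noncomputable def parOp (a : SpT n → Matrix (Fin n) (Fin n) ℝ) (b : SpT n → Fin n → ℝ)
    (φ : SpT n → ℝ) (z : SpT n) : ℝ :=
  dirD (eT n) φ z + (1 / 2) * ∑ i, ∑ j, a z i j * dirD (eX i) (dirD (eX j) φ) z
    + ∑ i, b z i * dirD (eX i) φ z

lemma dirD_mul {E : Type*} [NormedAddCommGroup E] [NormedSpace ℝ E] {f g : E → ℝ} (v z : E)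
    (hf : DifferentiableAt ℝ f z) (hg : DifferentiableAt ℝ g z) :
    dirD v (fun z => f z * g z) z = f z * dirD v g z + g z * dirD v f z := by
  simp only [_root_.dirD]
  rw [fderiv_fun_mul hf hg]; rfl

lemma dirD_shift {E : Type*} [NormedAddCommGroup E] [NormedSpace ℝ E] (f : E → ℝ) (v w : E) :
    dirD v (fun z => f (z + w)) = fun z => dirD v f (z + w) := by
  funext z
  simp only [_root_.dirD]
  rw [fderiv_comp_add_right]

lemma dirD_dirD_mul {E : Type*} [NormedAddCommGroup E] [NormedSpace ℝ E] {f g : E → ℝ} (v w z : E)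
    (hf : ContDiff ℝ (⊤ : ℕ∞) f) (hg : ContDiff ℝ (⊤ : ℕ∞) g) :
    dirD v (dirD w (fun z => f z * g z)) z = f z * dirD v (dirD w g) z + dirD v f z * dirD w g z
      + dirD v g z * dirD w f z + g z * dirD v (dirD w f) z := by
  have hd : ∀ {h : E → ℝ}, ContDiff ℝ (⊤ : ℕ∞) h → ∀ z, DifferentiableAt ℝ h z :=
    fun hh z => hh.differentiable (by simp) z
  have e : dirD w (fun z => f z * g z) = fun z => f z * dirD w g z + g z * dirD w f z := by
    funext z; exact dirD_mul w z (hd hf z) (hd hg z)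
  rw [e, dirD_add _ _ (hd (hf.mul (contDiff_dirD hg w)) z) (hd (hg.mul (contDiff_dirD hf w)) z),
    dirD_mul _ _ (hd hf z) (hd (contDiff_dirD hg w) z), dirD_mul _ _ (hd hg z) (hd (contDiff_dirD hf w) z)]
  ring
end absorption

section absorption
variable {n : ℕ}

lemma parOp_measurable {a : SpT n → Matrix (Fin n) (Fin n) ℝ} {b : SpT n → Fin n → ℝ}
    (ha : ∀ i j, Measurable fun z => a z i j) (hb : ∀ i, Measurable fun z => b z i)
    {φ : SpT n → ℝ} (hφ : ContDiff ℝ (⊤ : ℕ∞) φ) : Measurable (parOp a b φ) := by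
  have h1 : ∀ v, Measurable (dirD v φ) := fun v => (contDiff_dirD hφ v).continuous.measurable
  have h2 : ∀ v w, Measurable (dirD v (dirD w φ)) :=
    fun v w => (contDiff_dirD (contDiff_dirD hφ w) v).continuous.measurable
  unfold parOp
  refine ((h1 _).add (Measurable.const_mul ?_ _)).add ?_
  · exact Finset.measurable_sum _ fun i _ => Finset.measurable_sum _ fun j _ => (ha i j).mul (h2 _ _)
  · exact Finset.measurable_sum _ fun i _ => (hb i).mul (h1 _)

/-- Pointwise estimate behind the absorption argument. -/
lemma parOp_cutoff_estimate {δ A B Bη U : ℝ} (hB : 0 ≤ B) (hA : 0 ≤ A) (hBη : 0 ≤ Bη)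
    (hU : 0 ≤ U) {a : Matrix (Fin n) (Fin n) ℝ} {b : Fin n → ℝ}
    (had : ∀ i j, |a i j - if i = j then 1 else 0| ≤ δ) (haA : ∀ i j, |a i j| ≤ A) (hbB : ∀ i, |b i| ≤ B)
    {η η1 : ℝ} {ηi : Fin n → ℝ} {ηij : Fin n → Fin n → ℝ} (hη0 : 0 ≤ η) (hη : η ≤ 1) (hη1 : |η1| ≤ Bη)
    (hηi : ∀ i, |ηi i| ≤ Bη) (hηij : ∀ i j, |ηij i j| ≤ Bη)
    {u ut : ℝ} {ui : Fin n → ℝ} {uij hij : Fin n → Fin n → ℝ} (hu : |u| ≤ U) (hui : ∀ i, |ui i| ≤ U)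
    (huij : ∀ i j, η * |uij i j| ≤ η * hij i j) {F : ℝ}
    (hpde : ut + (1 / 2) * ∑ i, uij i i - u = -F) :
    η * F ≤ -((η * ut + u * η1) + (1 / 2) * ∑ i, ∑ j, a i j * (η * uij i j + ηi i * ui j + ui i * ηi j
      + u * ηij i j) + ∑ i, b i * (η * ui i + u * ηi i)) + (1 / 2) * δ * ∑ i, ∑ j, η * hij i j
      + (1 + Bη + n ^ 2 * (A * (3 * Bη)) + n * (B * (1 + Bη))) * U := by
  have e1 : ∑ i, uij i i = ∑ i, ∑ j, (if i = j then 1 else 0) * uij i j := by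
    refine Finset.sum_congr rfl fun i _ => ?_
    simp
  have e2 : ∑ i, ∑ j, a i j * (η * uij i j + ηi i * ui j + ui i * ηi j + u * ηij i j) =
      ∑ i, ∑ j, (if i = j then 1 else 0) * (η * uij i j) +
      ∑ i, ∑ j, (a i j - if i = j then 1 else 0) * (η * uij i j)
      + ∑ i, ∑ j, a i j * (ηi i * ui j + ui i * ηi j + u * ηij i j) := by
    simp only [← Finset.sum_add_distrib]
    refine Finset.sum_congr rfl fun i _ => Finset.sum_congr rfl fun j _ => ?_
    ring
  have e3 : ∑ i, ∑ j, (if i = j then 1 else 0) * (η * uij i j) = η * ∑ i, uij i i := by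
    rw [e1, Finset.mul_sum]
    refine Finset.sum_congr rfl fun i _ => ?_
    rw [Finset.mul_sum]
    refine Finset.sum_congr rfl fun j _ => ?_
    ring
  have b1 : ∑ i, ∑ j, (a i j - if i = j then 1 else 0) * (η * uij i j) ≤ δ * ∑ i, ∑ j, η * hij i j := by
    simp only [Finset.mul_sum]
    refine Finset.sum_le_sum fun i _ => Finset.sum_le_sum fun j _ => ?_
    refine (le_abs_self _).trans ?_
    rw [abs_mul, abs_mul, abs_of_nonneg hη0]
    exact mul_le_mul (had i j) (huij i j) (by positivity)
      ((abs_nonneg _).trans (had i j))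
  have b2 : ∑ i, ∑ j, a i j * (ηi i * ui j + ui i * ηi j + u * ηij i j) ≤ n ^ 2 * (A * (3 * Bη)) * U := by
    have : ∀ i j, a i j * (ηi i * ui j + ui i * ηi j + u * ηij i j) ≤ A * (3 * Bη) * U := by
      intro i j
      refine (le_abs_self _).trans ?_
      rw [abs_mul, mul_assoc]
      refine mul_le_mul (haA i j) ?_ (abs_nonneg _) hA
      refine (abs_add_three _ _ _).trans ?_
      rw [abs_mul, abs_mul, abs_mul]
      have q1 := mul_le_mul (hηi i) (hui j) (abs_nonneg _) hBη
      have q2 := mul_le_mul (hui i) (hηi j) (abs_nonneg _) hU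
      have q3 := mul_le_mul hu (hηij i j) (abs_nonneg _) hU
      linarith
    refine (Finset.sum_le_sum fun i _ => Finset.sum_le_sum fun j _ => this i j).trans ?_
    simp only [Finset.sum_const, Finset.card_univ, Fintype.card_fin, nsmul_eq_mul]
    exact le_of_eq (by ring)
  have b3 : ∑ i, b i * (η * ui i + u * ηi i) ≤ n * (B * (1 + Bη)) * U := by
    have : ∀ i, b i * (η * ui i + u * ηi i) ≤ B * (1 + Bη) * U := by
      intro i
      refine (le_abs_self _).trans ?_
      rw [abs_mul, mul_assoc]
      refine mul_le_mul (hbB i) ?_ (abs_nonneg _) hB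
      refine (abs_add_le _ _).trans ?_
      rw [abs_mul, abs_mul, abs_of_nonneg hη0]
      have q1 := mul_le_mul hη (hui i) (abs_nonneg _) zero_le_one
      have q2 := mul_le_mul hu (hηi i) (abs_nonneg _) hU
      linarith
    refine (Finset.sum_le_sum fun i _ => this i).trans ?_
    simp only [Finset.sum_const, Finset.card_univ, Fintype.card_fin, nsmul_eq_mul]
    exact le_of_eq (by ring)
  have b4 : u * η1 ≤ Bη * U := by
    refine (le_abs_self _).trans ?_
    rw [abs_mul, mul_comm]
    exact mul_le_mul hη1 hu (abs_nonneg _) hBη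
  have b5 : η * u ≥ - U := by
    have := mul_le_mul hη hu (abs_nonneg _) zero_le_one
    rw [one_mul, ← abs_of_nonneg hη0, ← abs_mul] at this
    exact (abs_le.1 this).1
  have b5' : η * u ≤ U := by
    have := mul_le_mul hη hu (abs_nonneg _) zero_le_one
    rw [one_mul, ← abs_of_nonneg hη0, ← abs_mul] at this
    exact (abs_le.1 this).2
  have b6 : 0 ≤ n ^ 2 * (A * (3 * Bη)) * U := by positivity
  have hF : η * F = -(η * ut) - (1 / 2) * (η * ∑ i, uij i i) + η * u := by
    have : F = -ut - (1 / 2) * ∑ i, uij i i + u := by linarith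
    rw [this]; ring
  rw [e2, e3, hF]
  nlinarith

lemma parOp_bounded {a : SpT n → Matrix (Fin n) (Fin n) ℝ} {b : SpT n → Fin n → ℝ} {A B : ℝ}
    (haA : ∀ z i j, |a z i j| ≤ A) (hbB : ∀ z i, |b z i| ≤ B) {φ : SpT n → ℝ} (hφ : IsTest φ) :
    ∃ C, ∀ z, |parOp a b φ z| ≤ C := by
  obtain ⟨C₀, hC₀, h0⟩ := (hφ.dirD (eT n)).bounded
  choose C₁ hC₁ h1 using fun i : Fin n => (hφ.dirD (eX i)).bounded
  choose C₂ hC₂ h2 using fun i j : Fin n => ((hφ.dirD (eX j)).dirD (eX i)).bounded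
  refine ⟨C₀ + (1 / 2) * ∑ i, ∑ j, A * C₂ i j + ∑ i, B * C₁ i, fun z => ?_⟩
  refine (abs_add_three _ _ _).trans (add_le_add_three (h0 z) ?_ ?_)
  · rw [abs_mul, abs_of_pos (by norm_num : (0 : ℝ) < 1 / 2)]
    refine mul_le_mul_of_nonneg_left ?_ (by norm_num)
    refine (Finset.abs_sum_le_sum_abs _ _).trans (Finset.sum_le_sum fun i _ => ?_)
    refine (Finset.abs_sum_le_sum_abs _ _).trans (Finset.sum_le_sum fun j _ => ?_)
    rw [abs_mul]
    exact mul_le_mul (haA z i j) (h2 i j z) (abs_nonneg _) ((abs_nonneg _).trans (haA z i j))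
  · refine (Finset.abs_sum_le_sum_abs _ _).trans (Finset.sum_le_sum fun i _ => ?_)
    rw [abs_mul]
    exact mul_le_mul (hbB z i) (h1 i z) (abs_nonneg _) ((abs_nonneg _).trans (hbB z i))

lemma parOp_integrable {a : SpT n → Matrix (Fin n) (Fin n) ℝ} {b : SpT n → Fin n → ℝ} {A B : ℝ}
    (ha : ∀ i j, Measurable fun z => a z i j) (hb : ∀ i, Measurable fun z => b z i)
    (haA : ∀ z i j, |a z i j| ≤ A) (hbB : ∀ z i, |b z i| ≤ B) {φ : SpT n → ℝ} (hφ : IsTest φ)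
    (μ : Measure (SpT n)) [IsFiniteMeasure μ] : Integrable (parOp a b φ) μ := by
  obtain ⟨C, hC⟩ := parOp_bounded haA hbB hφ
  exact Integrable.of_bound (parOp_measurable ha hb hφ.1).aestronglyMeasurable C (ae_of_all _ hC)

lemma IsTest.shift {E : Type*} [NormedAddCommGroup E] [NormedSpace ℝ E] {f : E → ℝ} (hf : IsTest f)
    (w : E) : IsTest fun z => f (z + w) :=
  ⟨hf.1.comp (by fun_prop), hf.2.comp_homeomorph (Homeomorph.addRight w)⟩

/-- One step of the absorption argument. -/
lemma absorb_step : ∃ Cd : ℝ, 1 ≤ Cd ∧ ∀ (z₀ : SpT n) (R B M : ℝ), 0 < R → 0 ≤ B → 0 ≤ M →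
    ∀ η : SpT n → ℝ, IsTest η → (∀ z, 0 ≤ η z) → (∀ z, η z ≤ 1) →
    (∀ z, z ∉ Metric.ball z₀ (2 * R) → η z = 0) → ∃ K : ℝ, 0 ≤ K ∧
    ∀ (δ : ℝ) (a : SpT n → Matrix (Fin n) (Fin n) ℝ) (b : SpT n → Fin n → ℝ) (μ : Measure (SpT n))
      [IsFiniteMeasure μ], 0 ≤ δ → δ ≤ 1 → μ.real Set.univ ≤ M →
      (∀ i j, Measurable fun z => a z i j) → (∀ i, Measurable fun z => b z i) →
      (∀ z i j, |a z i j - if i = j then 1 else 0| ≤ δ) → (∀ z i, |b z i| ≤ B) →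
      (∀ φ, IsTest φ → (∀ z, z ∉ Metric.ball z₀ (2 * R) → φ z = 0) → ∫ z, parOp a b φ z ∂μ = 0) →
    ∀ (f : SpT n → ℝ) (m : ℝ), 0 < m → IsTest f → MorreyB f m →
      (∀ z, z ∉ Metric.ball z₀ (4 * R) → f z = 0) →
    ∃ h : Fin n → Fin n → SpT n → ℝ, (∀ i j, IsTest (h i j) ∧ (∀ z, 0 ≤ h i j z) ∧
      (∀ z, z ∉ Metric.ball z₀ (4 * R) → h i j z = 0) ∧ MorreyB (h i j) (Cd * m)) ∧
      ∀ w : SpT n, ‖w‖ ≤ R → (∫ ξ : Fin n → ℝ, gdens ξ) * ∫ z, η z * f (z + w) ∂μ ≤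
        (1 / 2) * δ * ∑ i, ∑ j, (∫ z, η z * h i j (z + w) ∂μ) + K * m := by
  obtain ⟨C, hC, hD⟩ := morrey_D2 (n := n)
  refine ⟨C + 1, by linarith, fun z₀ R B M hR hB hM η hη hη0 hη1 hηU => ?_⟩
  obtain ⟨Cs, hCs, hsup⟩ := heat_sup z₀ (by positivity : 0 < 4 * R)
  obtain ⟨χ, hχ, hχ0, hχ1, hχK, hχU⟩ := exists_cutoff (Metric.isClosed_closedBall (x := z₀) (ε := 3 * R))
    (Metric.isOpen_ball (x := z₀) (ε := 4 * R)) (Metric.closedBall_subset_ball (by linarith))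
    Metric.isBounded_ball
  obtain ⟨E₀, hE₀, h0⟩ := (hη.dirD (eT n)).bounded
  choose E₁ hE₁ h1 using fun i : Fin n => (hη.dirD (eX i)).bounded
  choose E₂ hE₂ h2 using fun i j : Fin n => ((hη.dirD (eX j)).dirD (eX i)).bounded
  set Bη : ℝ := E₀ + ∑ i, E₁ i + ∑ i, ∑ j, E₂ i j
  have hs1 : 0 ≤ ∑ i, E₁ i := Finset.sum_nonneg fun i _ => hE₁ i
  have hs2 : 0 ≤ ∑ i, ∑ j, E₂ i j := Finset.sum_nonneg fun i _ => Finset.sum_nonneg fun j _ => hE₂ i j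
  have hBη : 0 ≤ Bη := by positivity
  have h0' : ∀ z, |dirD (eT n) η z| ≤ Bη := fun z => (h0 z).trans (by simp only [Bη]; linarith)
  have h1' : ∀ i z, |dirD (eX i) η z| ≤ Bη := fun i z => (h1 i z).trans (by
    have := Finset.single_le_sum (fun i _ => hE₁ i) (Finset.mem_univ i)
    simp only [Bη]; linarith)
  have h2' : ∀ i j z, |dirD (eX i) (dirD (eX j) η) z| ≤ Bη := fun i j z => (h2 i j z).trans (by
    have q1 := Finset.single_le_sum (f := fun i => ∑ j, E₂ i j)
      (fun i _ => Finset.sum_nonneg fun j _ => hE₂ i j) (Finset.mem_univ i)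
    have q2 := Finset.single_le_sum (fun j _ => hE₂ i j) (Finset.mem_univ j)
    simp only [Bη]; linarith)
  set K₀ : ℝ := 1 + Bη + n ^ 2 * (2 * (3 * Bη)) + n * (B * (1 + Bη))
  have hK₀ : 0 ≤ K₀ := by positivity
  refine ⟨K₀ * Cs * M, by positivity,
    fun δ a b μ _ hδ hδ1 hμ ha hb had hbB hgen f m hm hf hfM hf0 => ?_⟩
  set u := tconv (heatK n) f
  have hu : ContDiff ℝ (⊤ : ℕ∞) u := contDiff_tconv _ hf
  choose h hh1 hh2 hh3 hh4 hh5 using fun i j => exists_smooth_abs z₀ (by positivity : 0 < 4 * R) hχ hχ0 hχ1 hχU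
    (contDiff_dirD (contDiff_dirD hu (eX j)) (eX i)) hm (by positivity : 0 < C * m) (hD hf hm hfM i j)
  refine ⟨h, fun i j => ⟨hh1 i j, hh2 i j, hh3 i j, by rw [add_mul, one_mul]; exact hh5 i j⟩, fun w hw => ?_⟩
  set φ : SpT n → ℝ := fun z => η z * u (z + w)
  have huw : ContDiff ℝ (⊤ : ℕ∞) fun z => u (z + w) := hu.comp (by fun_prop)
  have hφ : IsTest φ := by
    have := IsTest.mul huw hη
    simpa only [φ, mul_comm] using this
  have hφ0 := hgen φ hφ fun z hz => by simp only [φ]; rw [hηU z hz, zero_mul]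
  have haA : ∀ z i j, |a z i j| ≤ 2 := by
    intro z i j
    have q1 := had z i j
    have q2 := abs_sub_abs_le_abs_sub (a z i j) (if i = j then 1 else 0)
    have q3 : |(if i = j then 1 else 0 : ℝ)| ≤ 1 := by split_ifs <;> simp
    linarith
  have hdu : ∀ {g : SpT n → ℝ}, ContDiff ℝ (⊤ : ℕ∞) g → ∀ z, DifferentiableAt ℝ g z :=
    fun hh z => hh.differentiable (by simp) z
  have hpt : ∀ z, (∫ ξ : Fin n → ℝ, gdens ξ) * (η z * f (z + w)) ≤ - parOp a b φ z +
      (1 / 2) * δ * ∑ i, ∑ j, η z * h i j (z + w) + K₀ * (Cs * m) := by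
    intro z
    have q := parOp_cutoff_estimate (δ := δ) (A := 2) (B := B) (Bη := Bη) (U := Cs * m) (a := a z) (b := b z)
      (η := η z) (η1 := dirD (eT n) η z) (ηi := fun i => dirD (eX i) η z)
      (ηij := fun i j => dirD (eX i) (dirD (eX j) η) z) (u := u (z + w)) (ut := dirD (eT n) u (z + w))
      (ui := fun i => dirD (eX i) u (z + w)) (uij := fun i j => dirD (eX i) (dirD (eX j) u) (z + w))
      (hij := fun i j => h i j (z + w)) (F := (∫ ξ : Fin n → ℝ, gdens ξ) * f (z + w))
      hB (by norm_num) hBη (by positivity) (had z) (haA z) (hbB z) (hη0 z) (hη1 z) (h0' z)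
      (fun i => h1' i z) (fun i j => h2' i j z) ((hsup hf hm hfM hf0 _).1) (fun i => (hsup hf hm hfM hf0 _).2 i)
      (fun i j => ?_) (by have := heat_pde hf (z + w); rw [heatOp] at this; rw [this]; ring)
    · have e : parOp a b φ z = (η z * dirD (eT n) u (z + w) + u (z + w) * dirD (eT n) η z) +
          (1 / 2) * ∑ i, ∑ j, a z i j * (η z * dirD (eX i) (dirD (eX j) u) (z + w)
            + dirD (eX i) η z * dirD (eX j) u (z + w) + dirD (eX i) u (z + w) * dirD (eX j) η z
            + u (z + w) * dirD (eX i) (dirD (eX j) η) z) +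
          ∑ i, b z i * (η z * dirD (eX i) u (z + w) + u (z + w) * dirD (eX i) η z) := by
        simp only [parOp, φ]
        simp only [dirD_dirD_mul _ _ z hη.1 huw, dirD_mul _ z (hdu hη.1 z) (hdu huw z), dirD_shift]
      rw [e]
      refine le_trans (le_of_eq (by ring)) (q.trans (le_of_eq (by ring)))
    · by_cases hz : η z = 0
      · rw [hz]; simp
      · refine mul_le_mul_of_nonneg_left (hh4 i j _ (hχK _ ?_)) (hη0 z)
        have hz' : z ∈ Metric.ball z₀ (2 * R) := by
          by_contra hc; exact hz (hηU z hc)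
        rw [mem_ball_iff_norm] at hz'
        rw [mem_closedBall_iff_norm, show z + w - z₀ = (z - z₀) + w by abel]
        exact (norm_add_le _ _).trans (by linarith)
  have hti : ∀ {g : SpT n → ℝ}, IsTest g → Integrable (fun z => η z * g (z + w)) μ :=
    fun hg => (IsTest.mul hη.1 (hg.shift w)).integrable μ
  have hpi := parOp_integrable ha hb haA hbB hφ μ
  have hsi : Integrable (fun z => (1 / 2) * δ * ∑ i, ∑ j, η z * h i j (z + w)) μ :=
    (integrable_finsetSum _ fun i _ => integrable_finsetSum _ fun j _ => hti (hh1 i j)).const_mul _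
  rw [← integral_const_mul]
  have hle := integral_mono ((hti hf).const_mul _) ((hpi.neg.add hsi).add (integrable_const (K₀ * (Cs * m)))) hpt
  refine hle.trans ?_
  rw [integral_add' (hpi.neg.add hsi) (integrable_const _), integral_add' hpi.neg hsi, integral_neg', hφ0,
    integral_const_mul, integral_finsetSum _ fun i _ => integrable_finsetSum _ fun j _ => hti (hh1 i j),
    integral_const, smul_eq_mul, neg_zero, zero_add]
  have : ∀ i, ∫ z, ∑ j, η z * h i j (z + w) ∂μ = ∑ j, ∫ z, η z * h i j (z + w) ∂μ :=
    fun i => integral_finsetSum _ fun j _ => hti (hh1 i j)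
  simp only [this]
  have : μ.real Set.univ * (K₀ * (Cs * m)) ≤ M * (K₀ * (Cs * m)) := by gcongr
  linarith
end absorption

section absorption
variable {n : ℕ}

lemma absorb : ∃ δ : ℝ, 0 < δ ∧ δ ≤ 1 ∧ ∀ (z₀ : SpT n) (R B M : ℝ), 0 < R → 0 ≤ B → 0 ≤ M →
    ∃ K : ℝ, 0 < K ∧
    ∀ (a : SpT n → Matrix (Fin n) (Fin n) ℝ) (b : SpT n → Fin n → ℝ) (μ : Measure (SpT n))
      [IsFiniteMeasure μ], μ.real Set.univ ≤ M →
      (∀ i j, Measurable fun z => a z i j) → (∀ i, Measurable fun z => b z i) →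
      (∀ z i j, |a z i j - if i = j then 1 else 0| ≤ δ) → (∀ z i, |b z i| ≤ B) →
      (∀ φ, IsTest φ → (∀ z, z ∉ Metric.ball z₀ (2 * R) → φ z = 0) → ∫ z, parOp a b φ z ∂μ = 0) →
    ∀ (f : SpT n → ℝ) (m : ℝ), 0 < m → IsTest f → (∀ z, 0 ≤ f z) → MorreyB f m →
      (∀ z, z ∉ Metric.ball z₀ (4 * R) → f z = 0) →
    ∫⁻ z in Metric.closedBall z₀ R, ENNReal.ofReal (f z) ∂μ ≤ ENNReal.ofReal (K * m) := by
  obtain ⟨Cd, hCd, hstep⟩ := absorb_step (n := n)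
  set I := ∫ ξ : Fin n → ℝ, gdens ξ
  have hI : 0 < I := integral_gdens_pos
  set δ : ℝ := min 1 (I / (n ^ 2 * Cd + 1))
  have hden : (0 : ℝ) < n ^ 2 * Cd + 1 := by positivity
  have hδ : 0 < δ := lt_min one_pos (by positivity)
  have hδI : δ * (n ^ 2 * Cd) ≤ I := by
    have h1 : δ ≤ I / (n ^ 2 * Cd + 1) := min_le_right _ _
    rw [le_div_iff₀ hden] at h1
    linarith
  refine ⟨δ, hδ, min_le_left _ _, fun z₀ R B M hR hB hM => ?_⟩
  obtain ⟨η, hη, hη0, hη1, hηK, hηU⟩ := exists_cutoff (Metric.isClosed_closedBall (x := z₀) (ε := R))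
    (Metric.isOpen_ball (x := z₀) (ε := 2 * R)) (Metric.closedBall_subset_ball (by linarith))
    Metric.isBounded_ball
  obtain ⟨K, hK, hs⟩ := hstep z₀ R B M hR hB hM η hη hη0 hη1 hηU
  obtain ⟨CL, hCL, hL1⟩ := morrey_L1 z₀ (by positivity : 0 < 4 * R)
  refine ⟨2 * (K / I) + 1, by positivity, fun a b μ _ hμ ha hb had hbB hgen f m hm hf hf0 hfM hfU => ?_⟩
  set Λ : SpT n → (SpT n → ℝ) → ℝ := fun w f => ∫ z, η z * f (z + w) ∂μ
  have hΛc : ∀ {f}, IsTest f → Continuous fun w => Λ w f := by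
    intro f hf
    obtain ⟨C, hC, hb⟩ := hf.bounded
    refine continuous_of_dominated (bound := fun _ => C)
      (fun w => (IsTest.mul hη.1 (hf.shift w)).continuous.aestronglyMeasurable)
      (fun w => ae_of_all _ fun z => ?_) (integrable_const _) (ae_of_all _ fun z => ?_)
    · rw [norm_mul, Real.norm_of_nonneg (hη0 z)]
      exact (mul_le_of_le_one_left (norm_nonneg _) (hη1 z)).trans (hb _)
    · have := hf.continuous
      fun_prop
  have main : ∀ ε, 0 < ε → ε ≤ R → ∫ w in Metric.closedBall (0 : SpT n) ε, Λ w f ≤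
      2 * (K / I) * volume.real (Metric.closedBall (0 : SpT n) ε) * m := by
    intro ε hε hεR
    set V := volume.real (Metric.closedBall (0 : SpT n) ε)
    have hV : 0 ≤ V := measureReal_nonneg
    have hfin : IsFiniteMeasure (volume.restrict (Metric.closedBall (0 : SpT n) ε)) :=
      ⟨by rw [Measure.restrict_apply_univ]; exact measure_closedBall_lt_top⟩
    have hΛi : ∀ {f}, IsTest f → IntegrableOn (fun w => Λ w f) (Metric.closedBall (0 : SpT n) ε) :=
      fun hf => (hΛc hf).continuousOn.integrableOn_compact (isCompact_closedBall _ _)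
    have apriori : ∀ (f : SpT n → ℝ) (m : ℝ), 0 < m → IsTest f → (∀ z, 0 ≤ f z) → MorreyB f m →
        (∀ z, z ∉ Metric.ball z₀ (4 * R) → f z = 0) →
        ∫ w in Metric.closedBall (0 : SpT n) ε, Λ w f ≤ (M * CL) * m := by
      intro f m hm hf hf0 hfM hfU
      have hintg : ∫ z, f z ≤ CL * m := by
        have := hL1 hm hfM hfU
        have e : ∀ z, ‖f z‖ₑ = ENNReal.ofReal (f z) := fun z => Real.enorm_of_nonneg (hf0 z)
        simp only [e] at this
        rw [← ofReal_integral_eq_lintegral_ofReal (hf.integrable _) (ae_of_all _ hf0)] at this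
        exact (ENNReal.ofReal_le_ofReal_iff (by positivity)).1 this
      obtain ⟨C, hC, hb⟩ := hf.bounded
      have hsw := integral_integral_swap (μ := volume.restrict (Metric.closedBall (0 : SpT n) ε)) (ν := μ)
        (f := fun w z => η z * f (z + w)) (Integrable.of_bound (by
          have h1 := hf.continuous
          have h2 := hη.continuous
          have h3 : Continuous (Function.uncurry fun w z : SpT n => η z * f (z + w)) := by
            unfold Function.uncurry; fun_prop
          exact h3.aestronglyMeasurable) C (ae_of_all _ fun p => by
          rw [Function.uncurry, norm_mul, Real.norm_of_nonneg (hη0 _)]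
          exact (mul_le_of_le_one_left (norm_nonneg _) (hη1 _)).trans (hb _)))
      rw [hsw]
      have hb2 : ∀ z, ∫ w in Metric.closedBall (0 : SpT n) ε, η z * f (z + w) ≤ CL * m := by
        intro z
        rw [integral_const_mul]
        have hi : Integrable (fun w => f (z + w)) := (hf.integrable volume).comp_add_left z
        have h1 : ∫ w in Metric.closedBall (0 : SpT n) ε, f (z + w) ≤ CL * m := by
          refine (setIntegral_le_integral hi (ae_of_all _ fun w => hf0 _)).trans ?_
          rw [integral_add_left_eq_self f z]; exact hintg
        have h2 : 0 ≤ ∫ w in Metric.closedBall (0 : SpT n) ε, f (z + w) := integral_nonneg fun w => hf0 _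
        exact (mul_le_of_le_one_left h2 (hη1 z)).trans h1
      refine (integral_mono_of_nonneg (ae_of_all _ fun z => integral_nonneg fun w =>
        mul_nonneg (hη0 z) (hf0 _)) (integrable_const (CL * m)) (ae_of_all _ hb2)).trans ?_
      rw [integral_const, smul_eq_mul, mul_assoc]
      gcongr
    have ind : ∀ N : ℕ, ∀ (f : SpT n → ℝ) (m : ℝ), 0 < m → IsTest f → (∀ z, 0 ≤ f z) → MorreyB f m →
        (∀ z, z ∉ Metric.ball z₀ (4 * R) → f z = 0) →
        ∫ w in Metric.closedBall (0 : SpT n) ε, Λ w f ≤ (M * CL * (1 / 2) ^ N + 2 * (K / I) * V) * m := by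
      intro N
      induction N with
      | zero =>
        intro f m hm hf hf0 hfM hfU
        refine (apriori f m hm hf hf0 hfM hfU).trans ?_
        have : 0 ≤ 2 * (K / I) * V := by positivity
        gcongr
        linarith
      | succ N ih =>
        intro f m hm hf hf0 hfM hfU
        obtain ⟨h, hh, hle⟩ := hs δ a b μ hδ.le (min_le_left _ _) hμ ha hb had hbB hgen f m hm hf hfM hfU
        set D := M * CL * (1 / 2) ^ N + 2 * (K / I) * V
        have hD : 0 ≤ D := by positivity
        have e1 : I * ∫ w in Metric.closedBall (0 : SpT n) ε, Λ w f ≤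
            (1 / 2) * δ * ∑ i, ∑ j, (∫ w in Metric.closedBall (0 : SpT n) ε, Λ w (h i j)) + K * m * V := by
          have hsum : IntegrableOn (fun w => (1 / 2) * δ * ∑ i, ∑ j, Λ w (h i j))
              (Metric.closedBall (0 : SpT n) ε) :=
            (integrable_finsetSum _ fun i _ => integrable_finsetSum _ fun j _ => hΛi (hh i j).1).const_mul _
          have q := setIntegral_mono_on ((hΛi hf).const_mul I) (hsum.add (integrable_const (K * m)))
            Metric.isClosed_closedBall.measurableSet fun w hw =>
              hle w ((mem_closedBall_zero_iff.1 hw).trans hεR)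
          rw [integral_const_mul] at q
          refine q.trans (le_of_eq ?_)
          rw [integral_add' hsum (integrable_const _), integral_const_mul,
            integral_finsetSum _ fun i _ => integrable_finsetSum _ fun j _ => hΛi (hh i j).1]
          have : ∀ i, ∫ w in Metric.closedBall (0 : SpT n) ε, ∑ j, Λ w (h i j) =
              ∑ j, ∫ w in Metric.closedBall (0 : SpT n) ε, Λ w (h i j) :=
            fun i => integral_finsetSum _ fun j _ => hΛi (hh i j).1
          simp only [this, setIntegral_const, smul_eq_mul]
          ring
        have e2 : ∑ i, ∑ j, (∫ w in Metric.closedBall (0 : SpT n) ε, Λ w (h i j)) ≤ n ^ 2 * (D * (Cd * m)) := by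
          refine (Finset.sum_le_sum fun i _ => Finset.sum_le_sum fun j _ =>
            ih (h i j) (Cd * m) (by positivity) (hh i j).1 (hh i j).2.1 (hh i j).2.2.2 (hh i j).2.2.1).trans ?_
          simp only [Finset.sum_const, Finset.card_univ, Fintype.card_fin, nsmul_eq_mul]
          exact le_of_eq (by ring)
        have e3 : I * ∫ w in Metric.closedBall (0 : SpT n) ε, Λ w f ≤ I * ((1 / 2) * D * m + K / I * V * m) := by
          refine e1.trans ?_
          have q1 : (1 / 2) * δ * ∑ i, ∑ j, (∫ w in Metric.closedBall (0 : SpT n) ε, Λ w (h i j)) ≤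
              (1 / 2) * δ * (n ^ 2 * (D * (Cd * m))) := by gcongr
          have q2 : (1 / 2) * δ * (n ^ 2 * (D * (Cd * m))) ≤ (1 / 2) * (I * (D * m)) := by
            have := mul_le_mul_of_nonneg_right hδI (by positivity : 0 ≤ D * m)
            linarith
          have q3 : I * ((1 / 2) * D * m + K / I * V * m) = (1 / 2) * (I * (D * m)) + K * m * V := by
            field_simp
          linarith
        refine (le_of_mul_le_mul_left e3 hI).trans (le_of_eq ?_)
        simp only [D]; rw [pow_succ]; ring
    have hlim : Tendsto (fun N : ℕ => (M * CL * (1 / 2) ^ N + 2 * (K / I) * V) * m) atTop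
        (𝓝 ((M * CL * 0 + 2 * (K / I) * V) * m)) :=
      (((tendsto_pow_atTop_nhds_zero_of_lt_one (by norm_num) (by norm_num)).const_mul _).add_const _).mul_const _
    have := ge_of_tendsto' hlim fun N => ind N f m hm hf hf0 hfM hfU
    simpa using this
  have h0 : Λ 0 f ≤ 2 * (K / I) * m := by
    by_contra! hc
    set t := (Λ 0 f + 2 * (K / I) * m) / 2
    have ht1 : t < Λ 0 f := by simp only [t]; linarith
    have ht2 : 2 * (K / I) * m < t := by simp only [t]; linarith
    obtain ⟨ε₀, hε₀, hball⟩ := Metric.eventually_nhds_iff_ball.1 ((hΛc hf).continuousAt.eventually (lt_mem_nhds ht1))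
    set ε := min (ε₀ / 2) R
    have hε : 0 < ε := lt_min (by positivity) hR
    have hV : 0 < volume.real (Metric.closedBall (0 : SpT n) ε) := by
      rw [measureReal_def]
      exact ENNReal.toReal_pos (Metric.measure_closedBall_pos _ _ hε).ne' measure_closedBall_lt_top.ne
    have q1 := main ε hε (min_le_right _ _)
    have q2 : ∫ w in Metric.closedBall (0 : SpT n) ε, t ≤ ∫ w in Metric.closedBall (0 : SpT n) ε, Λ w f := by
      refine setIntegral_mono_on (integrableOn_const measure_closedBall_lt_top.ne)
        ((hΛc hf).continuousOn.integrableOn_compact (isCompact_closedBall _ _))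
        Metric.isClosed_closedBall.measurableSet fun w hw => (hball w ?_).le
      exact Metric.closedBall_subset_ball ((min_le_left _ _).trans_lt (by linarith)) hw
    rw [setIntegral_const, smul_eq_mul] at q2
    have := mul_lt_mul_of_pos_left ht2 hV
    linarith
  calc ∫⁻ z in Metric.closedBall z₀ R, ENNReal.ofReal (f z) ∂μ ≤ ∫⁻ z, ENNReal.ofReal (η z * f (z + 0)) ∂μ := by
        rw [← lintegral_indicator Metric.isClosed_closedBall.measurableSet]
        refine lintegral_mono fun z => ?_
        by_cases hz : z ∈ Metric.closedBall z₀ R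
        · rw [Set.indicator_of_mem hz, hηK z hz, one_mul, add_zero]
        · rw [Set.indicator_of_notMem hz]; exact zero_le
    _ = ENNReal.ofReal (Λ 0 f) := by
        rw [← ofReal_integral_eq_lintegral_ofReal ((IsTest.mul hη.1 (hf.shift 0)).integrable μ)
          (ae_of_all _ fun z => mul_nonneg (hη0 z) (hf0 _))]
    _ ≤ _ := ENNReal.ofReal_le_ofReal (h0.trans (by gcongr; linarith))
end absorption

section absorption
variable {n : ℕ}

lemma parOp_congr {a a' : SpT n → Matrix (Fin n) (Fin n) ℝ} {b b' : SpT n → Fin n → ℝ}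
    {φ : SpT n → ℝ} {z : SpT n} (h : z ∈ tsupport φ → a z = a' z ∧ b z = b' z) :
    parOp a b φ z = parOp a' b' φ z := by
  by_cases hz : z ∈ tsupport φ
  · obtain ⟨h1, h2⟩ := h hz
    simp only [parOp, h1, h2]
  · have h0 : ∀ v, tsupport (dirD v φ) ⊆ tsupport φ := fun v => tsupport_fderiv_apply_subset ℝ v
    have e1 : ∀ v, dirD v φ z = 0 := fun v => image_eq_zero_of_notMem_tsupport fun h => hz (h0 v h)
    have e2 : ∀ v w, dirD v (dirD w φ) z = 0 := fun v w => image_eq_zero_of_notMem_tsupport fun h =>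
      hz (h0 w (tsupport_fderiv_apply_subset ℝ v h))
    simp only [parOp, e1, e2, mul_zero, Finset.sum_const_zero]

lemma morreyB_of_small {m : ℝ} (hm : 0 < m) {f : SpT n → ℝ} {O : Set (SpT n)} (hO : MeasurableSet O)
    (hf0 : ∀ z, 0 ≤ f z) (hf1 : ∀ z, f z ≤ 1) (hfO : ∀ z, z ∉ O → f z = 0)
    (hv : volume O ≤ ENNReal.ofReal (m ^ 2 * (m ^ 2 / 2 ^ (n + 1)) ^ (n + 1))) : MorreyB f m := by
  intro z ρ hρ
  have h1 : ∫⁻ w in Pcyl z ρ, ‖f w‖ₑ ^ 2 ≤ volume (O ∩ Pcyl z ρ) := by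
    rw [← Measure.restrict_apply hO, ← lintegral_indicator_one hO]
    refine lintegral_mono fun w => ?_
    by_cases hw : w ∈ O
    · rw [Set.indicator_of_mem hw, Real.enorm_of_nonneg (hf0 w)]
      exact pow_le_one₀ zero_le (ENNReal.ofReal_le_one.2 (hf1 w))
    · simp [hfO w hw]
  refine h1.trans ?_
  rcases le_total ρ (m ^ 2 / 2 ^ (n + 1)) with h | h
  · refine (measure_mono Set.inter_subset_right).trans ?_
    rw [volume_Pcyl z hρ.le]
    refine ENNReal.ofReal_le_ofReal ?_
    rw [le_div_iff₀ (by positivity)] at h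
    calc _ = ρ * 2 ^ (n + 1) * ρ ^ (n + 1) := by ring
      _ ≤ _ := by gcongr
  · refine (measure_mono Set.inter_subset_left).trans (hv.trans (ENNReal.ofReal_le_ofReal ?_))
    gcongr

/-- Uniform local absolute continuity when the coefficients are close to the identity. -/
lemma local_uac : ∃ δ : ℝ, 0 < δ ∧ ∀ (z₀ : SpT n) (R B M ε : ℝ), 0 < R → 0 ≤ B → 0 ≤ M → 0 < ε →
    ∃ ν : ℝ, 0 < ν ∧
    ∀ (a : SpT n → Matrix (Fin n) (Fin n) ℝ) (b : SpT n → Fin n → ℝ) (μ : Measure (SpT n))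
      [IsFiniteMeasure μ], μ.real Set.univ ≤ M →
      (∀ i j, Measurable fun z => a z i j) → (∀ i, Measurable fun z => b z i) →
      (∀ z ∈ Metric.ball z₀ (3 * R), ∀ i j, |a z i j - if i = j then 1 else 0| ≤ δ) →
      (∀ z i, |b z i| ≤ B) →
      (∀ φ, IsTest φ → (∀ z, z ∉ Metric.ball z₀ (2 * R) → φ z = 0) → ∫ z, parOp a b φ z ∂μ = 0) →
    ∀ O : Set (SpT n), IsOpen O → volume O ≤ ENNReal.ofReal ν →
      μ (O ∩ Metric.ball z₀ R) ≤ ENNReal.ofReal ε := by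
  classical
  obtain ⟨δ, hδ, hδ1, habs⟩ := absorb (n := n)
  refine ⟨δ, hδ, fun z₀ R B M ε hR hB hM hε => ?_⟩
  obtain ⟨K, hK, hk⟩ := habs z₀ R B M hR hB hM
  set m := ε / K
  have hm : 0 < m := by positivity
  refine ⟨m ^ 2 * (m ^ 2 / 2 ^ (n + 1)) ^ (n + 1), by positivity,
    fun a b μ _ hμ ha hb had hbB hgen O hO hv => ?_⟩
  have hmb : MeasurableSet (Metric.ball z₀ (3 * R)) := Metric.isOpen_ball.measurableSet
  have hk' := hk (fun z => if z ∈ Metric.ball z₀ (3 * R) then a z else 1) b μ hμ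
    (fun i j => by
      have : (fun z => (if z ∈ Metric.ball z₀ (3 * R) then a z else 1) i j) =
        fun z => if z ∈ Metric.ball z₀ (3 * R) then a z i j else (1 : Matrix (Fin n) (Fin n) ℝ) i j := by
        funext z; split_ifs <;> rfl
      rw [this]
      exact Measurable.ite hmb (ha i j) measurable_const)
    hb (fun z i j => by
      by_cases hz : z ∈ Metric.ball z₀ (3 * R)
      · rw [if_pos hz]; exact had z hz i j
      · rw [if_neg hz, Matrix.one_apply, sub_self, abs_zero]; exact hδ.le) hbB
    (fun φ hφ h0 => by
      rw [← hgen φ hφ h0]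
      refine integral_congr_ae (ae_of_all _ fun z => parOp_congr fun hz => ⟨if_pos ?_, rfl⟩)
      have h1 : tsupport φ ⊆ Metric.closedBall z₀ (2 * R) :=
        closure_minimal (fun z hz => Metric.ball_subset_closedBall
          (by by_contra hc; exact hz (h0 z hc))) Metric.isClosed_closedBall
      exact Metric.closedBall_subset_ball (by linarith) (h1 hz))
  have hO' : IsOpen (O ∩ Metric.ball z₀ R) := hO.inter Metric.isOpen_ball
  rw [hO'.measure_eq_iSup_isCompact]
  refine iSup₂_le fun S hS => iSup_le fun hSc => ?_
  obtain ⟨f, hf, hf0, hf1, hfK, hfU⟩ := exists_cutoff hSc.isClosed hO' hS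
    (Metric.isBounded_ball.subset Set.inter_subset_right)
  have hfM : MorreyB f m := morreyB_of_small hm hO'.measurableSet hf0 hf1 hfU
    ((measure_mono Set.inter_subset_left).trans hv)
  have h1 := hk' f m hm hf hf0 hfM fun z hz => hfU z fun h => hz
    (Metric.ball_subset_ball (by linarith) h.2)
  rw [show K * m = ε by simp only [m]; field_simp] at h1
  refine le_trans ?_ h1
  have h2 : S ⊆ Metric.closedBall z₀ R := fun z hz => Metric.ball_subset_closedBall (hS hz).2
  calc μ S = ∫⁻ z in S, 1 ∂μ := by simp
    _ ≤ ∫⁻ z in S, ENNReal.ofReal (f z) ∂μ := setLIntegral_mono' hSc.measurableSet fun z hz => by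
        rw [hfK z hz]; simp
    _ ≤ _ := lintegral_mono_set h2

/-- Linear change of the space variable. -/
noncomputable def spLin (A : Matrix (Fin n) (Fin n) ℝ) (hA : IsUnit A.det) : SpT n ≃L[ℝ] SpT n :=
  (ContinuousLinearEquiv.refl ℝ ℝ).prodCongr
    (Matrix.toLinearEquiv' A ((Matrix.isUnit_iff_isUnit_det A).2 hA).invertible).toContinuousLinearEquiv

lemma spLin_apply (A : Matrix (Fin n) (Fin n) ℝ) (hA : IsUnit A.det) (z : SpT n) :
    spLin A hA z = (z.1, A.mulVec z.2) := by
  simp [spLin, Matrix.toLinearEquiv']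

lemma dirD_comp_spLin (A : Matrix (Fin n) (Fin n) ℝ) (hA : IsUnit A.det) {φ : SpT n → ℝ}
    (hφ : ContDiff ℝ (⊤ : ℕ∞) φ) (v z : SpT n) :
    dirD v (fun z => φ (spLin A hA z)) z = dirD (spLin A hA v) φ (spLin A hA z) := by
  simp only [dirD]
  have h := (hφ.differentiable (by simp) (spLin A hA z)).hasFDerivAt.comp z
    (spLin A hA).toContinuousLinearMap.hasFDerivAt
  have h2 := h.fderiv
  change fderiv ℝ (φ ∘ ⇑(spLin A hA)) z v = _
  exact (congrArg (fun L => L v) h2)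

lemma spLin_eT (A : Matrix (Fin n) (Fin n) ℝ) (hA : IsUnit A.det) : spLin A hA (eT n) = eT n := by
  rw [spLin_apply]; simp [eT]

lemma dirD_spLin_eX (A : Matrix (Fin n) (Fin n) ℝ) (hA : IsUnit A.det) (φ : SpT n → ℝ) (i : Fin n) (z : SpT n) :
    dirD (spLin A hA (eX i)) φ z = ∑ k, A k i * dirD (eX k) φ z := by
  rw [spLin_apply]
  have := fderiv_split φ z 0 (A.mulVec (Pi.single i 1))
  simp only [dirD, eX] at this ⊢
  rw [this]
  simp

lemma dirD_sum_mul {ι : Type*} (s : Finset ι) (c : ι → ℝ) {g : ι → SpT n → ℝ}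
    (hg : ∀ i, ContDiff ℝ (⊤ : ℕ∞) (g i)) (v z : SpT n) :
    dirD v (fun z => ∑ i ∈ s, c i * g i z) z = ∑ i ∈ s, c i * dirD v (g i) z := by
  simp only [_root_.dirD]
  rw [fderiv_fun_sum fun i _ => ((hg i).differentiable (by simp) z).const_mul (c i)]
  rw [_root_.sum_apply]
  refine Finset.sum_congr rfl fun i _ => ?_
  rw [fderiv_const_mul ((hg i).differentiable (by simp) z)]; rfl

lemma parOp_spLin (A : Matrix (Fin n) (Fin n) ℝ) (hA : IsUnit A.det)
    (a : SpT n → Matrix (Fin n) (Fin n) ℝ) (b : SpT n → Fin n → ℝ) {φ : SpT n → ℝ} (hφ : IsTest φ) (z : SpT n) :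
    parOp a b (fun z => φ (spLin A hA z)) z =
      parOp (fun w => A * a ((spLin A hA).symm w) * Aᵀ) (fun w => A.mulVec (b ((spLin A hA).symm w))) φ
        (spLin A hA z) := by
  have h1 : ∀ i, dirD (eX i) (fun z => φ (spLin A hA z)) =
      fun z => ∑ k, A k i * dirD (eX k) φ (spLin A hA z) := by
    intro i; funext z
    rw [dirD_comp_spLin A hA hφ.1, dirD_spLin_eX]
  have h2 : ∀ i j, dirD (eX i) (dirD (eX j) (fun z => φ (spLin A hA z))) z =
      ∑ k, A k j * ∑ l, A l i * dirD (eX l) (dirD (eX k) φ) (spLin A hA z) := by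
    intro i j
    rw [h1, dirD_sum_mul _ _ (g := fun k z => dirD (eX k) φ (spLin A hA z))
      fun k => (contDiff_dirD hφ.1 _).comp (spLin A hA).contDiff]
    refine Finset.sum_congr rfl fun k _ => ?_
    rw [dirD_comp_spLin A hA (contDiff_dirD hφ.1 _), dirD_spLin_eX]
  simp only [parOp, h2]
  simp only [dirD_comp_spLin A hA hφ.1, dirD_spLin_eX, spLin_eT, ContinuousLinearEquiv.symm_apply_apply]
  congr 1
  · congr 2
    have e : ∀ l k, (A * a z * Aᵀ) l k = ∑ i, ∑ j, A l i * a z i j * A k j := by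
      intro l k
      simp only [Matrix.mul_apply, Matrix.transpose_apply, Finset.sum_mul]
      rw [Finset.sum_comm]
    simp only [e, Finset.mul_sum, Finset.sum_mul]
    calc _ = ∑ i, ∑ j, ∑ l, ∑ k, a z i j * (A k j * (A l i * dirD (eX l) (dirD (eX k) φ) (spLin A hA z))) :=
          Finset.sum_congr rfl fun i _ => Finset.sum_congr rfl fun j _ => Finset.sum_comm
      _ = ∑ i, ∑ l, ∑ j, ∑ k, a z i j * (A k j * (A l i * dirD (eX l) (dirD (eX k) φ) (spLin A hA z))) :=
          Finset.sum_congr rfl fun i _ => Finset.sum_comm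
      _ = ∑ l, ∑ i, ∑ j, ∑ k, a z i j * (A k j * (A l i * dirD (eX l) (dirD (eX k) φ) (spLin A hA z))) :=
          Finset.sum_comm
      _ = ∑ l, ∑ i, ∑ k, ∑ j, a z i j * (A k j * (A l i * dirD (eX l) (dirD (eX k) φ) (spLin A hA z))) :=
          Finset.sum_congr rfl fun i _ => Finset.sum_congr rfl fun j _ => Finset.sum_comm
      _ = ∑ l, ∑ k, ∑ i, ∑ j, a z i j * (A k j * (A l i * dirD (eX l) (dirD (eX k) φ) (spLin A hA z))) :=
          Finset.sum_congr rfl fun i _ => Finset.sum_comm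
      _ = _ := by
        refine Finset.sum_congr rfl fun i _ => Finset.sum_congr rfl fun j _ => Finset.sum_congr rfl fun k _ =>
          Finset.sum_congr rfl fun l _ => ?_
        ring
  · simp only [Matrix.mulVec, dotProduct, Finset.mul_sum, Finset.sum_mul]
    rw [Finset.sum_comm]
    refine Finset.sum_congr rfl fun i _ => Finset.sum_congr rfl fun j _ => ?_
    ring
end absorption

section uacCompact
variable {n : ℕ}

lemma IsTest.comp_spLin {φ : SpT n → ℝ} (hφ : IsTest φ) (A : Matrix (Fin n) (Fin n) ℝ) (hA : IsUnit A.det) :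
    IsTest fun z => φ (spLin A hA z) :=
  ⟨hφ.1.comp (spLin A hA).contDiff, hφ.2.comp_homeomorph (spLin A hA).toHomeomorph⟩

/-- Uniform absolute continuity near a point for continuous nondegenerate diffusion coefficients. -/
lemma uac_nhds {W : Set (SpT n)} (hW : IsOpen W) {s : SpT n → Matrix (Fin n) (Fin n) ℝ} (hs : Continuous s)
    (hdet : ∀ z, IsUnit (s z).det) {B M : ℝ} (hB : 0 ≤ B) (hM : 0 ≤ M) {z₀ : SpT n}
    (hz₀ : z₀ ∈ W) :
    ∃ U ∈ 𝓝 z₀, ∀ ε : ℝ, 0 < ε → ∃ ν : ℝ, 0 < ν ∧ ∀ (b : SpT n → Fin n → ℝ) (μ : Measure (SpT n))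
      [IsFiniteMeasure μ], μ.real Set.univ ≤ M → (∀ i, Measurable fun z => b z i) →
      (∀ z i, |b z i| ≤ B) →
      (∀ φ, IsTest φ → (∀ z, z ∉ W → φ z = 0) → ∫ z, parOp (fun z => s z * (s z)ᵀ) b φ z ∂μ = 0) →
    ∀ O : Set (SpT n), IsOpen O → volume O ≤ ENNReal.ofReal ν → μ (O ∩ U) ≤ ENNReal.ofReal ε := by
  obtain ⟨δ, hδ, hloc⟩ := local_uac (n := n)
  set A := (s z₀)⁻¹ with hAdef
  have hA : IsUnit A.det := by
    rw [hAdef, Matrix.det_nonsing_inv]; exact (hdet z₀).ringInverse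
  set g := spLin A hA
  set a' : SpT n → Matrix (Fin n) (Fin n) ℝ := fun w => A * (s (g.symm w) * (s (g.symm w))ᵀ) * Aᵀ with ha'
  have hc' : Continuous a' := by
    have : Continuous fun w => s (g.symm w) := hs.comp g.symm.continuous
    simp only [ha']
    fun_prop
  have h1 : a' (g z₀) = 1 := by
    simp only [ha', ContinuousLinearEquiv.symm_apply_apply]
    rw [← Matrix.mul_assoc, Matrix.nonsing_inv_mul _ (hdet z₀), Matrix.one_mul, ← Matrix.transpose_mul,
      Matrix.nonsing_inv_mul _ (hdet z₀), Matrix.transpose_one]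
  have hev : ∀ᶠ w in 𝓝 (g z₀), (∀ i j, |a' w i j - if i = j then 1 else 0| ≤ δ) ∧ g.symm w ∈ W := by
    refine Filter.Eventually.and ?_ ?_
    · refine eventually_all.2 fun i => eventually_all.2 fun j => ?_
      have hcij : Continuous fun w => |a' w i j - if i = j then 1 else 0| := by
        have := hc'.matrix_elem i j
        fun_prop
      have h0 : |a' (g z₀) i j - if i = j then 1 else 0| < δ := by
        rw [h1, Matrix.one_apply, sub_self, abs_zero]; exact hδ
      exact (hcij.continuousAt.eventually_lt continuousAt_const h0).mono fun _ h => h.le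
    · refine g.symm.continuous.continuousAt.eventually (hW.mem_nhds ?_)
      rwa [ContinuousLinearEquiv.symm_apply_apply]
  obtain ⟨R', hR', hball⟩ := Metric.eventually_nhds_iff_ball.1 hev
  set R := R' / 3
  have hR : 0 < R := by positivity
  have h3R : 3 * R = R' := by simp only [R]; ring
  set B' := ∑ i, ∑ j, |A i j| * B
  set D := |LinearMap.det ((g : SpT n →L[ℝ] SpT n) : SpT n →ₗ[ℝ] SpT n)|
  refine ⟨g ⁻¹' Metric.ball (g z₀) R,
    g.continuous.continuousAt.preimage_mem_nhds (Metric.ball_mem_nhds _ hR), fun ε hε => ?_⟩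
  obtain ⟨ν, hν, hmain⟩ := hloc (g z₀) R B' M ε hR (by positivity) hM hε
  refine ⟨ν / (D + 1), by positivity, fun b μ _ hμ hb hbB hgen O hO hv => ?_⟩
  have hgm : Measurable g := g.continuous.measurable
  have hge : MeasurableEmbedding g := g.toHomeomorph.measurableEmbedding
  have hgsm : Measurable g.symm := g.symm.continuous.measurable
  have key := hmain a' (fun w => A.mulVec (b (g.symm w))) (μ.map g)
    (by rw [map_measureReal_apply hgm MeasurableSet.univ]; simpa using hμ)
    (fun i j => (hc'.matrix_elem i j).measurable)
    (fun i => by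
      simp only [Matrix.mulVec, dotProduct]
      exact Finset.measurable_fun_sum _ fun j _ => ((hb j).comp hgsm).const_mul _)
    (fun z hz => (hball z (by rwa [h3R] at hz)).1)
    (fun z i => by
      simp only [Matrix.mulVec, dotProduct]
      refine (Finset.abs_sum_le_sum_abs _ _).trans ?_
      refine le_trans (Finset.sum_le_sum fun j _ => ?_)
        (Finset.single_le_sum (f := fun i => ∑ j, |A i j| * B) (fun i _ => by positivity) (Finset.mem_univ i))
      rw [abs_mul]
      exact mul_le_mul_of_nonneg_left (hbB _ _) (abs_nonneg _))
    (fun φ hφ h0 => by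
      rw [← hgen _ (hφ.comp_spLin A hA) fun z hz => h0 _ fun hz' => hz ?_]
      · rw [hge.integral_map]
        congr 1
        funext z
        rw [parOp_spLin A hA _ b hφ z]
      · have := (hball _ (Metric.ball_subset_ball (by linarith : 2 * R ≤ R') hz')).2
        rwa [ContinuousLinearEquiv.symm_apply_apply] at this)
    (g.symm ⁻¹' O) (hO.preimage g.symm.continuous) (by
      rw [← ContinuousLinearEquiv.image_eq_preimage_symm, Measure.addHaar_image_continuousLinearEquiv]
      calc _ ≤ ENNReal.ofReal D * ENNReal.ofReal (ν / (D + 1)) := mul_le_mul le_rfl hv zero_le zero_le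
        _ ≤ _ := by
          rw [← ENNReal.ofReal_mul (abs_nonneg _)]
          refine ENNReal.ofReal_le_ofReal ?_
          rw [← mul_div_assoc, div_le_iff₀ (by positivity)]
          nlinarith)
  rw [Measure.map_apply hgm ((hO.preimage g.symm.continuous).inter Metric.isOpen_ball).measurableSet,
    Set.preimage_inter] at key
  have e : g ⁻¹' (g.symm ⁻¹' O) = O := Set.ext fun z => by
    rw [Set.mem_preimage, Set.mem_preimage, g.symm_apply_apply]
  rwa [e] at key

lemma uac_compact {W : Set (SpT n)} (hW : IsOpen W) {s : SpT n → Matrix (Fin n) (Fin n) ℝ} (hs : Continuous s)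
    (hdet : ∀ z, IsUnit (s z).det) {B M : ℝ} (hB : 0 ≤ B) (hM : 0 ≤ M) {Kc : Set (SpT n)} (hK : IsCompact Kc)
    (hKW : Kc ⊆ W) :
    ∀ ε : ℝ, 0 < ε → ∃ ν : ℝ, 0 < ν ∧ ∀ (b : SpT n → Fin n → ℝ) (μ : Measure (SpT n))
      [IsFiniteMeasure μ], μ.real Set.univ ≤ M → (∀ i, Measurable fun z => b z i) →
      (∀ z i, |b z i| ≤ B) →
      (∀ φ, IsTest φ → (∀ z, z ∉ W → φ z = 0) → ∫ z, parOp (fun z => s z * (s z)ᵀ) b φ z ∂μ = 0) →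
    ∀ O : Set (SpT n), IsOpen O → volume O ≤ ENNReal.ofReal ν → μ (O ∩ Kc) ≤ ENNReal.ofReal ε := by
  refine hK.induction_on (p := fun S => ∀ ε : ℝ, 0 < ε → ∃ ν : ℝ, 0 < ν ∧ ∀ (b : SpT n → Fin n → ℝ)
      (μ : Measure (SpT n)) [IsFiniteMeasure μ], μ.real Set.univ ≤ M → (∀ i, Measurable fun z => b z i) →
      (∀ z i, |b z i| ≤ B) →
      (∀ φ, IsTest φ → (∀ z, z ∉ W → φ z = 0) → ∫ z, parOp (fun z => s z * (s z)ᵀ) b φ z ∂μ = 0) →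
      ∀ O : Set (SpT n), IsOpen O → volume O ≤ ENNReal.ofReal ν → μ (O ∩ S) ≤ ENNReal.ofReal ε) ?_ ?_ ?_ ?_
  · exact fun ε hε => ⟨1, one_pos, fun b μ _ _ _ _ _ O _ _ => by simp⟩
  · intro S T hST hT ε hε
    obtain ⟨ν, hν, h⟩ := hT ε hε
    exact ⟨ν, hν, fun b μ _ h1 h2 h3 h4 O h5 h6 =>
      (measure_mono (Set.inter_subset_inter_right _ hST)).trans (h b μ h1 h2 h3 h4 O h5 h6)⟩
  · intro S T hS hT ε hε
    obtain ⟨ν, hν, h⟩ := hS (ε / 2) (by positivity)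
    obtain ⟨ν', hν', h'⟩ := hT (ε / 2) (by positivity)
    refine ⟨min ν ν', lt_min hν hν', fun b μ _ h1 h2 h3 h4 O h5 h6 => ?_⟩
    rw [Set.inter_union_distrib_left]
    refine (measure_union_le _ _).trans ?_
    rw [← add_halves ε, ENNReal.ofReal_add (by positivity) (by positivity)]
    exact add_le_add (h b μ h1 h2 h3 h4 O h5 (h6.trans (ENNReal.ofReal_le_ofReal (min_le_left _ _))))
      (h' b μ h1 h2 h3 h4 O h5 (h6.trans (ENNReal.ofReal_le_ofReal (min_le_right _ _))))
  · intro z hz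
    obtain ⟨U, hU, h⟩ := uac_nhds hW hs hdet hB hM (hKW hz)
    exact ⟨U, mem_nhdsWithin_of_mem_nhds hU, h⟩
end uacCompact

section pathMeasurability
variable {n : ℕ} {r : ℝ}

lemma continuous_Xcan : Continuous fun p : ℝ × PathSp n r => Xcan n r p.1 p.2 := by
  have : LocallyCompactSpace (Set.Ici r) := (isClosed_Ici).isClosedEmbedding_subtypeVal.locallyCompactSpace
  unfold Xcan
  have h : Continuous fun p : ℝ × PathSp n r => (⟨max p.1 r, le_max_right p.1 r⟩ : Set.Ici r) :=
    Continuous.subtype_mk (by fun_prop) _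
  exact continuous_snd.eval h

lemma continuous_Xcan_time (ω : PathSp n r) : Continuous fun u => Xcan n r u ω :=
  continuous_Xcan.comp (by fun_prop : Continuous fun u : ℝ => (u, ω))

lemma continuous_Xcan_path (u : ℝ) : Continuous fun ω : PathSp n r => Xcan n r u ω :=
  continuous_Xcan.comp (by fun_prop : Continuous fun ω : PathSp n r => (u, ω))

/-- The time-space process. -/
def Zp (v : ℝ) (ω : PathSp n r) : SpT n := (v, Xcan n r v ω)

lemma Xcan_measurable_canonFiltr {u s : ℝ} (hrs : r ≤ s) (hus : u ≤ s) :
    Measurable[canonFiltr n r s] (Xcan n r u) := by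
  have h : Xcan n r u = (fun f : Set.Icc r s → Fin n → ℝ => f ⟨max u r, le_max_right u r, max_le hus hrs⟩) ∘
      fun (ω : PathSp n r) (u : Set.Icc r s) => ω ⟨u.1, u.2.1⟩ := rfl
  rw [h]
  exact (measurable_pi_apply _).comp (comap_measurable _)

lemma measurable_timeIntegral {Ω : Type*} [MeasurableSpace Ω] {Y : ℝ → Ω → Fin n → ℝ}
    (hY : ∀ ω, Continuous fun u => Y u ω) (hm : ∀ u, Measurable (Y u)) {c : SpT n → ℝ} (hc : Measurable c)
    (S : Set ℝ) : Measurable fun ω => ∫ v in S, c (v, Y v ω) := by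
  have h1 : Measurable (Function.uncurry Y) := measurable_uncurry_of_continuous_of_measurable hY hm
  have h2 : Measurable fun p : Ω × ℝ => c (p.2, Y p.2 p.1) :=
    hc.comp (measurable_snd.prodMk (h1.comp (measurable_snd.prodMk measurable_fst)))
  exact (h2.stronglyMeasurable.integral_prod_right (ν := volume.restrict S)).measurable

lemma timeIntegral_measurable_canonFiltr {c : SpT n → ℝ} (hc : Measurable c) {t s : ℝ} (hrs : r ≤ s)
    (hts : t ≤ s) : Measurable[canonFiltr n r s] fun ω : PathSp n r => ∫ v in Set.Ioc r t, c (Zp v ω) := by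
  have h := @measurable_timeIntegral n (PathSp n r) (canonFiltr n r s) (fun v ω => Xcan n r (min v s) ω)
    (fun ω => (continuous_Xcan_time ω).comp (by fun_prop))
    (fun u => Xcan_measurable_canonFiltr hrs (min_le_right _ _)) c hc (Set.Ioc r t)
  convert h using 2 with ω
  refine setIntegral_congr_fun measurableSet_Ioc fun v hv => ?_
  simp only [Zp]
  rw [min_eq_left (hv.2.trans hts)]

lemma measurable_Zp_time (ω : PathSp n r) : Measurable fun v => (Zp v ω : SpT n) :=
  measurable_id.prodMk (continuous_Xcan_time ω).measurable

lemma integrableOn_time {c : SpT n → ℝ} (hc : Measurable c) {K : ℝ} (hK : ∀ z, |c z| ≤ K) (s t : ℝ)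
    (ω : PathSp n r) : IntegrableOn (fun v => c (Zp v ω)) (Set.Ioc s t) :=
  Measure.integrableOn_of_bounded (M := K) (by simp) (hc.comp (measurable_Zp_time ω)).aestronglyMeasurable
    (ae_of_all _ fun v => hK _)

lemma abs_timeIntegral_le {c : SpT n → ℝ} {K : ℝ} (hK : ∀ z, |c z| ≤ K) {s t : ℝ} (hst : s ≤ t)
    (ω : PathSp n r) : |∫ v in Set.Ioc s t, c (Zp v ω)| ≤ K * (t - s) := by
  have := norm_setIntegral_le_of_norm_le_const (μ := volume) (s := Set.Ioc s t) (C := K)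
    (f := fun v => c (Zp v ω)) (by simp) fun v _ => hK _
  simpa [Measure.real, hst] using this

variable [MeasurableSpace (PathSp n r)] [BorelSpace (PathSp n r)]

lemma measurable_Xcan (u : ℝ) : Measurable (Xcan n r u) := (continuous_Xcan_path u).measurable

lemma measurable_Zp_uncurry : Measurable fun p : ℝ × PathSp n r => (Zp p.1 p.2 : SpT n) :=
  measurable_fst.prodMk continuous_Xcan.measurable

lemma measurable_Zp (v : ℝ) : Measurable (Zp v : PathSp n r → SpT n) :=
  measurable_const.prodMk (measurable_Xcan v)

lemma canonFiltr_le (s : ℝ) : canonFiltr n r s ≤ (inferInstance : MeasurableSpace (PathSp n r)) := by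
  refine Measurable.comap_le ?_
  exact measurable_pi_lambda _ fun u => (continuous_eval_const _).measurable

end pathMeasurability

section expMartingale
variable {n : ℕ} {r : ℝ}

/-- Standing regularity assumptions on the coefficients, with a common bound `C`. -/
structure GoodCoef (σ : ℝ → (Fin n → ℝ) → Matrix (Fin n) (Fin n) ℝ) (l : ℝ → (Fin n → ℝ) → (Fin n → ℝ))
    (C : ℝ) : Prop where
  cont : Continuous fun p : SpT n => σ p.1 p.2
  measL : Measurable fun p : SpT n => l p.1 p.2
  nonneg : 0 ≤ C
  bdDrift : ∀ (p : SpT n) i, |((σ p.1 p.2).mulVec (l p.1 p.2)) i| ≤ C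
  bdDiff : ∀ (p : SpT n) i j, |(σ p.1 p.2 * (σ p.1 p.2)ᵀ) i j| ≤ C

variable {σ : ℝ → (Fin n → ℝ) → Matrix (Fin n) (Fin n) ℝ} {l : ℝ → (Fin n → ℝ) → (Fin n → ℝ)} {C : ℝ}

/-- The drift vector field. -/
def driftF (σ : ℝ → (Fin n → ℝ) → Matrix (Fin n) (Fin n) ℝ) (l : ℝ → (Fin n → ℝ) → (Fin n → ℝ))
    (p : SpT n) : Fin n → ℝ := (σ p.1 p.2).mulVec (l p.1 p.2)

/-- The diffusion matrix field. -/
def diffF (σ : ℝ → (Fin n → ℝ) → Matrix (Fin n) (Fin n) ℝ) (p : SpT n) : Matrix (Fin n) (Fin n) ℝ :=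
  σ p.1 p.2 * (σ p.1 p.2)ᵀ

/-- The rate of the exponential compensator. -/
noncomputable def expRate (σ : ℝ → (Fin n → ℝ) → Matrix (Fin n) (Fin n) ℝ)
    (l : ℝ → (Fin n → ℝ) → (Fin n → ℝ)) (θ : Fin n → ℝ) (p : SpT n) : ℝ :=
  θ ⬝ᵥ driftF σ l p + (1 / 2) * (θ ⬝ᵥ (diffF σ p).mulVec θ)

/-- A bound for `expRate`. -/
noncomputable def rateBd (C : ℝ) (θ : Fin n → ℝ) : ℝ := C * (∑ i, |θ i|) + (1 / 2) * (C * (∑ i, |θ i|) ^ 2)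

lemma GoodCoef.measurable_driftF (h : GoodCoef σ l C) (i : Fin n) : Measurable fun p => driftF σ l p i := by
  simp only [driftF, Matrix.mulVec, dotProduct]
  exact Finset.measurable_fun_sum _ fun j _ =>
    (h.cont.matrix_elem i j).measurable.mul ((measurable_pi_apply j).comp h.measL)

lemma GoodCoef.continuous_diffF (h : GoodCoef σ l C) : Continuous (diffF σ) :=
  h.cont.matrix_mul h.cont.matrix_transpose

lemma GoodCoef.abs_dot_driftF_le (h : GoodCoef σ l C) (θ : Fin n → ℝ) (p : SpT n) :
    |θ ⬝ᵥ driftF σ l p| ≤ C * ∑ i, |θ i| := by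
  refine (Finset.abs_sum_le_sum_abs _ _).trans ?_
  rw [Finset.mul_sum]
  refine Finset.sum_le_sum fun i _ => ?_
  rw [abs_mul, mul_comm]
  exact mul_le_mul_of_nonneg_right (h.bdDrift p i) (abs_nonneg _)

lemma GoodCoef.abs_quad_diffF_le (h : GoodCoef σ l C) (θ : Fin n → ℝ) (p : SpT n) :
    |θ ⬝ᵥ (diffF σ p).mulVec θ| ≤ C * (∑ i, |θ i|) ^ 2 := by
  simp only [dotProduct, Matrix.mulVec, Finset.mul_sum]
  refine (Finset.abs_sum_le_sum_abs _ _).trans ?_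
  rw [sq, Finset.sum_mul, Finset.mul_sum]
  refine Finset.sum_le_sum fun i _ => (Finset.abs_sum_le_sum_abs _ _).trans ?_
  rw [Finset.mul_sum, Finset.mul_sum]
  refine Finset.sum_le_sum fun j _ => ?_
  rw [abs_mul, abs_mul]
  have := mul_le_mul_of_nonneg_right (h.bdDiff p i j) (mul_nonneg (abs_nonneg (θ i)) (abs_nonneg (θ j)))
  calc _ = |diffF σ p i j| * (|θ i| * |θ j|) := by ring
    _ ≤ _ := this

lemma GoodCoef.measurable_dot_driftF (h : GoodCoef σ l C) (θ : Fin n → ℝ) :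
    Measurable fun p => θ ⬝ᵥ driftF σ l p :=
  Finset.measurable_fun_sum _ fun i _ => (h.measurable_driftF i).const_mul _

lemma GoodCoef.continuous_quad_diffF (h : GoodCoef σ l C) (θ : Fin n → ℝ) :
    Continuous fun p => θ ⬝ᵥ (diffF σ p).mulVec θ :=
  continuous_const.dotProduct (h.continuous_diffF.matrix_mulVec continuous_const)

lemma GoodCoef.measurable_expRate (h : GoodCoef σ l C) (θ : Fin n → ℝ) : Measurable (expRate σ l θ) :=
  (h.measurable_dot_driftF θ).add ((h.continuous_quad_diffF θ).measurable.const_mul _)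

lemma GoodCoef.abs_expRate_le (h : GoodCoef σ l C) (θ : Fin n → ℝ) (p : SpT n) :
    |expRate σ l θ p| ≤ rateBd C θ := by
  refine (abs_add_le _ _).trans (add_le_add (h.abs_dot_driftF_le θ p) ?_)
  rw [abs_mul, abs_of_nonneg (by norm_num : (0:ℝ) ≤ 1 / 2)]
  exact mul_le_mul_of_nonneg_left (h.abs_quad_diffF_le θ p) (by norm_num)

lemma GoodCoef.rateBd_nonneg (h : GoodCoef σ l C) (θ : Fin n → ℝ) : 0 ≤ rateBd C θ := by
  have := h.nonneg
  have : 0 ≤ ∑ i, |θ i| := Finset.sum_nonneg fun i _ => abs_nonneg _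
  unfold rateBd; positivity

lemma GoodCoef.MexpP_eq (h : GoodCoef σ l C) (x θ : Fin n → ℝ) (u : ℝ) (ω : PathSp n r) :
    MexpP n r σ l x θ u ω =
      Real.exp (θ ⬝ᵥ (Xcan n r u ω - x) - ∫ v in Set.Ioc r u, expRate σ l θ (Zp v ω)) := by
  simp only [expRate]
  rw [integral_add (integrableOn_time (h.measurable_dot_driftF θ) (h.abs_dot_driftF_le θ) r u ω)
    ((integrableOn_time (h.continuous_quad_diffF θ).measurable (h.abs_quad_diffF_le θ) r u ω).const_mul _),
    integral_const_mul]
  unfold MexpP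
  congr 1
  simp only [driftF, diffF, Zp]
  ring

lemma GoodCoef.measurable_MexpP_canonFiltr (h : GoodCoef σ l C) (x θ : Fin n → ℝ) {u s : ℝ} (hrs : r ≤ s)
    (hus : u ≤ s) : Measurable[canonFiltr n r s] (MexpP n r σ l x θ u) := by
  rw [show MexpP n r σ l x θ u = _ from funext fun ω => h.MexpP_eq x θ u ω]
  refine Real.measurable_exp.comp (Measurable.sub ?_ (timeIntegral_measurable_canonFiltr
    (h.measurable_expRate θ) hrs hus))
  have h1 : Measurable fun y : Fin n → ℝ => θ ⬝ᵥ (y - x) := by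
    refine Continuous.measurable ?_
    exact continuous_const.dotProduct (by fun_prop)
  exact h1.comp (Xcan_measurable_canonFiltr hrs hus)

lemma MexpP_pos (x θ : Fin n → ℝ) (u : ℝ) (ω : PathSp n r) : 0 < MexpP n r σ l x θ u ω := Real.exp_pos _

variable [MeasurableSpace (PathSp n r)] [BorelSpace (PathSp n r)]

lemma GoodCoef.measurable_MexpP (h : GoodCoef σ l C) (x θ : Fin n → ℝ) (u : ℝ) :
    Measurable (MexpP n r σ l x θ u) :=
  (h.measurable_MexpP_canonFiltr x θ (le_max_left r u) (le_max_right r u)).mono (canonFiltr_le _) le_rfl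

lemma mart_trim {x : Fin n → ℝ} {P : Measure (PathSp n r)}
    (hP : SolvesMP n r σ l x P) (θ : Fin n → ℝ) {s t : ℝ} (hrs : r ≤ s) (hst : s ≤ t) :
    (P.withDensity fun ω => ENNReal.ofReal (MexpP n r σ l x θ t ω)).trim (canonFiltr_le s) =
      (P.withDensity fun ω => ENNReal.ofReal (MexpP n r σ l x θ s ω)).trim (canonFiltr_le s) := by
  refine @Measure.ext _ (canonFiltr n r s) _ _ fun A hA => ?_
  rw [trim_measurableSet_eq _ hA, trim_measurableSet_eq _ hA,
    withDensity_apply _ (canonFiltr_le s A hA), withDensity_apply _ (canonFiltr_le s A hA)]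
  obtain ⟨h1, h2⟩ := hP.2 θ s t hrs hst
  obtain ⟨h3, -⟩ := hP.2 θ s s hrs le_rfl
  rw [← ofReal_integral_eq_lintegral_ofReal h1.integrableOn (ae_of_all _ fun ω => (MexpP_pos x θ t ω).le),
    ← ofReal_integral_eq_lintegral_ofReal h3.integrableOn (ae_of_all _ fun ω => (MexpP_pos x θ s ω).le), h2 A hA]

lemma mart_lintegral (h : GoodCoef σ l C) {x : Fin n → ℝ} {P : Measure (PathSp n r)}
    (hP : SolvesMP n r σ l x P) (θ : Fin n → ℝ) {s t : ℝ} (hrs : r ≤ s) (hst : s ≤ t)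
    {G : PathSp n r → ENNReal} (hG : Measurable[canonFiltr n r s] G) :
    ∫⁻ ω, ENNReal.ofReal (MexpP n r σ l x θ t ω) * G ω ∂P =
      ∫⁻ ω, ENNReal.ofReal (MexpP n r σ l x θ s ω) * G ω ∂P := by
  have hGm : Measurable G := hG.mono (canonFiltr_le s) le_rfl
  have e : ∀ u, ∫⁻ ω, ENNReal.ofReal (MexpP n r σ l x θ u ω) * G ω ∂P =
      ∫⁻ ω, G ω ∂((P.withDensity fun ω => ENNReal.ofReal (MexpP n r σ l x θ u ω)).trim (canonFiltr_le s)) := by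
    intro u
    rw [lintegral_trim _ hG, lintegral_withDensity_eq_lintegral_mul _ (h.measurable_MexpP x θ u).ennreal_ofReal hGm]
    rfl
  rw [e, e, mart_trim hP θ hrs hst]

lemma mart_integral (h : GoodCoef σ l C) {x : Fin n → ℝ} {P : Measure (PathSp n r)}
    (hP : SolvesMP n r σ l x P) (θ : Fin n → ℝ) {s t : ℝ} (hrs : r ≤ s) (hst : s ≤ t)
    {G : PathSp n r → ℝ} (hG : Measurable[canonFiltr n r s] G) :
    ∫ ω, MexpP n r σ l x θ t ω * G ω ∂P = ∫ ω, MexpP n r σ l x θ s ω * G ω ∂P := by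
  have e : ∀ u, ∫ ω, MexpP n r σ l x θ u ω * G ω ∂P =
      ∫ ω, G ω ∂((P.withDensity fun ω => ENNReal.ofReal (MexpP n r σ l x θ u ω)).trim (canonFiltr_le s)) := by
    intro u
    rw [← integral_trim _ hG.stronglyMeasurable, integral_withDensity_eq_integral_toReal_smul
      (h.measurable_MexpP x θ u).ennreal_ofReal (ae_of_all _ fun _ => ENNReal.ofReal_lt_top)]
    refine integral_congr_ae (ae_of_all _ fun ω => ?_)
    simp [ENNReal.toReal_ofReal (MexpP_pos x θ u ω).le]
  rw [e, e, mart_trim hP θ hrs hst]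

lemma SolvesMP.ae_start {x : Fin n → ℝ} {P : Measure (PathSp n r)} [IsProbabilityMeasure P]
    (hP : SolvesMP n r σ l x P) : ∀ᵐ ω ∂P, Xcan n r r ω = x := by
  have h1 : MeasurableSet {ω : PathSp n r | ω ⟨r, le_refl r⟩ = x} :=
    (isClosed_singleton.preimage (continuous_eval_const (⟨r, le_refl r⟩ : Set.Ici r))).measurableSet
  have h2 := (prob_compl_eq_zero_iff h1).2 hP.1
  filter_upwards [mem_ae_iff.2 h2] with ω hω
  have : (⟨max r r, le_max_right r r⟩ : Set.Ici r) = ⟨r, le_refl r⟩ := Subtype.ext (max_self r)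
  simpa only [Xcan, this] using hω

lemma SolvesMP.integral_MexpP (h : GoodCoef σ l C) {x : Fin n → ℝ} {P : Measure (PathSp n r)}
    [IsProbabilityMeasure P] (hP : SolvesMP n r σ l x P) (θ : Fin n → ℝ) {t : ℝ} (ht : r ≤ t) :
    ∫ ω, MexpP n r σ l x θ t ω ∂P = 1 := by
  have h1 := mart_integral h hP θ le_rfl ht (G := fun _ => 1) measurable_const
  simp only [mul_one] at h1
  rw [h1]
  have : ∀ᵐ ω ∂P, MexpP n r σ l x θ r ω = 1 := by
    filter_upwards [hP.ae_start] with ω hω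
    simp [h.MexpP_eq, hω]
  rw [integral_congr_ae this]; simp

/-- Exponential moments of increments. -/
lemma SolvesMP.lintegral_exp_incr_le (h : GoodCoef σ l C) {x : Fin n → ℝ} {P : Measure (PathSp n r)}
    [IsProbabilityMeasure P] (hP : SolvesMP n r σ l x P) (θ : Fin n → ℝ) {s t : ℝ} (hrs : r ≤ s) (hst : s ≤ t) :
    ∫⁻ ω, ENNReal.ofReal (Real.exp (θ ⬝ᵥ (Xcan n r t ω - Xcan n r s ω))) ∂P ≤
      ENNReal.ofReal (Real.exp (rateBd C θ * (t - s))) := by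
  have hms := h.measurable_MexpP_canonFiltr x θ hrs (le_refl s)
  have h1 := mart_lintegral h hP θ hrs hst (G := fun ω => ENNReal.ofReal (MexpP n r σ l x θ s ω)⁻¹)
    (hms.inv.ennreal_ofReal)
  have h2 : ∀ ω, ENNReal.ofReal (MexpP n r σ l x θ s ω) * ENNReal.ofReal (MexpP n r σ l x θ s ω)⁻¹ = 1 := by
    intro ω
    rw [← ENNReal.ofReal_mul (MexpP_pos x θ s ω).le, mul_inv_cancel₀ (MexpP_pos x θ s ω).ne', ENNReal.ofReal_one]
  simp only [h2, lintegral_const, measure_univ, mul_one] at h1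
  calc _ ≤ ∫⁻ ω, ENNReal.ofReal (Real.exp (rateBd C θ * (t - s))) *
        (ENNReal.ofReal (MexpP n r σ l x θ t ω) * ENNReal.ofReal (MexpP n r σ l x θ s ω)⁻¹) ∂P := by
        refine lintegral_mono fun ω => ?_
        rw [← ENNReal.ofReal_mul (MexpP_pos x θ t ω).le, ← ENNReal.ofReal_mul (Real.exp_pos _).le]
        refine ENNReal.ofReal_le_ofReal ?_
        rw [h.MexpP_eq, h.MexpP_eq, ← Real.exp_neg, ← Real.exp_add, ← Real.exp_add, Real.exp_le_exp]
        have e1 : ∫ v in Set.Ioc r t, expRate σ l θ (Zp v ω) = (∫ v in Set.Ioc r s, expRate σ l θ (Zp v ω)) +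
            ∫ v in Set.Ioc s t, expRate σ l θ (Zp v ω) := by
          rw [← Set.Ioc_union_Ioc_eq_Ioc hrs hst, setIntegral_union (Set.Ioc_disjoint_Ioc_of_le le_rfl) measurableSet_Ioc
            (integrableOn_time (h.measurable_expRate θ) (h.abs_expRate_le θ) _ _ ω)
            (integrableOn_time (h.measurable_expRate θ) (h.abs_expRate_le θ) _ _ ω)]
        have e2 := (abs_le.1 (abs_timeIntegral_le (h.abs_expRate_le θ) hst ω)).2
        rw [e1]
        simp only [dotProduct_sub]
        linarith
    _ = _ := by rw [lintegral_const_mul' _ _ ENNReal.ofReal_ne_top, h1, mul_one]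
end expMartingale

section dynkinExp

lemma exp_timeIntegral_sub_one {q : ℝ → ℝ} (hq : Measurable q) {K : ℝ} (hK : ∀ v, |q v| ≤ K) {r t : ℝ}
    (hrt : r ≤ t) :
    Real.exp (∫ v in Set.Ioc r t, q v) - 1 =
      ∫ v in Set.Ioc r t, q v * Real.exp (∫ u in Set.Ioc r v, q u) := by
  have hintg : ∀ a b, IntervalIntegrable q volume a b := fun a b => by
    rw [intervalIntegrable_iff]
    exact Measure.integrableOn_of_bounded (M := K) (by simp) hq.aestronglyMeasurable (ae_of_all _ hK)
  set F : ℝ → ℝ := fun v => ∫ u in r..v, q u with hF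
  have hFL : LipschitzWith K.toNNReal F := by
    refine LipschitzWith.of_dist_le_mul fun a b => ?_
    rw [Real.dist_eq, hF]
    simp only
    rw [intervalIntegral.integral_interval_sub_left (hintg _ _) (hintg _ _), ← Real.norm_eq_abs, Real.dist_eq]
    have hK0 : 0 ≤ K := (abs_nonneg _).trans (hK 0)
    rw [Real.coe_toNNReal _ hK0]
    exact intervalIntegral.norm_integral_le_of_norm_le_const fun v _ => hK v
  have hAC : AbsolutelyContinuousOnInterval (fun v => Real.exp (F v)) r t := by
    have hc : IsCompact (F '' Set.uIcc r t) := isCompact_uIcc.image hFL.continuous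
    obtain ⟨L, hL⟩ := hc.isBounded.subset_closedBall 0
    have hexp : LipschitzOnWith (Real.exp L).toNNReal Real.exp (Metric.closedBall 0 L) := by
      refine Convex.lipschitzOnWith_of_nnnorm_deriv_le (fun x _ => Real.differentiableAt_exp) (fun x hx => ?_)
        (convex_closedBall 0 L)
      rw [Real.deriv_exp, ← NNReal.coe_le_coe, coe_nnnorm, Real.coe_toNNReal _ (Real.exp_pos _).le,
        Real.norm_of_nonneg (Real.exp_pos _).le]
      rw [mem_closedBall_zero_iff] at hx
      exact Real.exp_le_exp.2 ((le_abs_self _).trans hx)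
    exact (hexp.comp (hFL.lipschitzOnWith) fun v hv => hL ⟨v, hv, rfl⟩).absolutelyContinuousOnInterval
  have h1 := hAC.integral_deriv_eq_sub
  have e : ∀ v, r ≤ v → F v = ∫ u in Set.Ioc r v, q u := fun v hv => intervalIntegral.integral_of_le hv
  have hFr : F r = 0 := by simp [hF]
  rw [e t hrt, hFr, Real.exp_zero] at h1
  rw [← h1, intervalIntegral.integral_of_le hrt]
  refine setIntegral_congr_ae measurableSet_Ioc ?_
  filter_upwards [(hintg r t).ae_hasDerivAt_integral] with v hv hvt
  have hvI : v ∈ Set.uIcc r t := by rw [Set.uIcc_of_le hrt]; exact ⟨hvt.1.le, hvt.2⟩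
  have h2 := (hv hvI r Set.left_mem_uIcc).exp
  rw [h2.deriv, ← e v hvt.1.le, mul_comm]

variable {n : ℕ} {r : ℝ} {σ : ℝ → (Fin n → ℝ) → Matrix (Fin n) (Fin n) ℝ}
  {l : ℝ → (Fin n → ℝ) → (Fin n → ℝ)} {C : ℝ}

/-- A linear functional on time-space. -/
def linF (τ : ℝ) (θ : Fin n → ℝ) (z : SpT n) : ℝ := τ * z.1 + θ ⬝ᵥ z.2

lemma continuous_linF (τ : ℝ) (θ : Fin n → ℝ) : Continuous (linF τ θ) :=
  (continuous_const.mul continuous_fst).add (continuous_const.dotProduct continuous_snd)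

variable [MeasurableSpace (PathSp n r)] [BorelSpace (PathSp n r)]

lemma SolvesMP.lintegral_exp_linF_le (h : GoodCoef σ l C) {x : Fin n → ℝ} {P : Measure (PathSp n r)}
    [IsProbabilityMeasure P] (hP : SolvesMP n r σ l x P) (τ : ℝ) (θ : Fin n → ℝ) {t T : ℝ} (hrt : r ≤ t)
    (htT : t ≤ T) :
    ∫⁻ ω, ENNReal.ofReal (Real.exp (linF τ θ (Zp t ω))) ∂P ≤
      ENNReal.ofReal (Real.exp (linF τ θ (r, x) + (|τ| + rateBd C θ) * (T - r))) := by
  have hb := h.rateBd_nonneg θ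
  calc _ = ∫⁻ ω, ENNReal.ofReal (Real.exp (τ * t + θ ⬝ᵥ x)) *
        ENNReal.ofReal (Real.exp (θ ⬝ᵥ (Xcan n r t ω - Xcan n r r ω))) ∂P := by
        refine lintegral_congr_ae ?_
        filter_upwards [hP.ae_start] with ω hω
        rw [← ENNReal.ofReal_mul (Real.exp_pos _).le, ← Real.exp_add, hω, dotProduct_sub]
        simp only [linF, Zp]
        congr 2; ring
    _ ≤ ENNReal.ofReal (Real.exp (τ * t + θ ⬝ᵥ x)) * ENNReal.ofReal (Real.exp (rateBd C θ * (t - r))) := by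
        rw [lintegral_const_mul' _ _ ENNReal.ofReal_ne_top]
        exact mul_le_mul le_rfl (hP.lintegral_exp_incr_le h θ le_rfl hrt) zero_le zero_le
    _ ≤ _ := by
        rw [← ENNReal.ofReal_mul (Real.exp_pos _).le, ← Real.exp_add]
        refine ENNReal.ofReal_le_ofReal (Real.exp_le_exp.2 ?_)
        have h1 : τ * (t - r) ≤ |τ| * (T - r) :=
          mul_le_mul (le_abs_self _) (by linarith) (by linarith) (abs_nonneg _)
        have h2 : rateBd C θ * (t - r) ≤ rateBd C θ * (T - r) := by gcongr
        simp only [linF]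
        linarith

/-- The product of time on `(r, T]` and the path measure. -/
noncomputable def timeProd (r T : ℝ) {n : ℕ} [MeasurableSpace (PathSp n r)] (P : Measure (PathSp n r)) :
    Measure (ℝ × PathSp n r) := (volume.restrict (Set.Ioc r T)).prod P

/-- The occupation measure on `(r, T]`. -/
noncomputable def occM (r T : ℝ) {n : ℕ} [MeasurableSpace (PathSp n r)] (P : Measure (PathSp n r)) :
    Measure (SpT n) := (timeProd r T P).map fun p => Zp p.1 p.2

instance (T : ℝ) (P : Measure (PathSp n r)) [IsFiniteMeasure P] : IsFiniteMeasure (timeProd r T P) := by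
  unfold timeProd
  have : IsFiniteMeasure (volume.restrict (Set.Ioc r T)) := ⟨by simp⟩
  infer_instance

instance (T : ℝ) (P : Measure (PathSp n r)) [IsFiniteMeasure P] : IsFiniteMeasure (occM r T P) := by
  unfold occM
  infer_instance

lemma SolvesMP.integrable_exp_linF (h : GoodCoef σ l C) {x : Fin n → ℝ} {P : Measure (PathSp n r)}
    [IsProbabilityMeasure P] (hP : SolvesMP n r σ l x P) (τ : ℝ) (θ : Fin n → ℝ) {t : ℝ} (hrt : r ≤ t) :
    Integrable (fun z => Real.exp (linF τ θ z)) (P.map (Zp t)) := by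
  rw [integrable_map_measure (by have := continuous_linF τ θ; fun_prop) (measurable_Zp t).aemeasurable]
  refine ⟨(((Real.continuous_exp.comp (continuous_linF τ θ)).measurable.comp (measurable_Zp t))).aestronglyMeasurable, ?_⟩
  simp only [Function.comp_def]
  rw [hasFiniteIntegral_iff_ofReal (ae_of_all _ fun ω => (Real.exp_pos _).le)]
  exact (hP.lintegral_exp_linF_le h τ θ hrt le_rfl).trans_lt ENNReal.ofReal_lt_top

lemma SolvesMP.integrable_exp_linF_occM (h : GoodCoef σ l C) {x : Fin n → ℝ} {P : Measure (PathSp n r)}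
    [IsProbabilityMeasure P] (hP : SolvesMP n r σ l x P) (τ : ℝ) (θ : Fin n → ℝ) (T : ℝ) :
    Integrable (fun z => Real.exp (linF τ θ z)) (occM r T P) := by
  have hc : Continuous fun z : SpT n => Real.exp (linF τ θ z) := Real.continuous_exp.comp (continuous_linF τ θ)
  unfold occM
  rw [integrable_map_measure hc.aestronglyMeasurable measurable_Zp_uncurry.aemeasurable]
  have hm : Measurable fun p : ℝ × PathSp n r => Real.exp (linF τ θ (Zp p.1 p.2)) :=
    hc.measurable.comp measurable_Zp_uncurry
  refine ⟨hm.aestronglyMeasurable, ?_⟩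
  simp only [Function.comp_def]
  rw [hasFiniteIntegral_iff_ofReal (ae_of_all _ fun ω => (Real.exp_pos _).le), timeProd,
    lintegral_prod _ hm.ennreal_ofReal.aemeasurable]
  refine (setLIntegral_mono' measurableSet_Ioc fun v hv =>
    hP.lintegral_exp_linF_le h τ θ hv.1.le hv.2).trans_lt ?_
  rw [setLIntegral_const]
  exact ENNReal.mul_lt_top ENNReal.ofReal_lt_top (by simp)

lemma integral_occM {P : Measure (PathSp n r)} [IsFiniteMeasure P] {T : ℝ} {f : SpT n → ℝ}
    (hf : Measurable f) : ∫ z, f z ∂(occM r T P) = ∫ p, f (Zp p.1 p.2) ∂(timeProd r T P) :=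
  integral_map measurable_Zp_uncurry.aemeasurable hf.aestronglyMeasurable

/-- Dynkin's formula for exponentials of linear functions. -/
lemma SolvesMP.dynkin_exp (h : GoodCoef σ l C) {x : Fin n → ℝ} {P : Measure (PathSp n r)}
    [IsProbabilityMeasure P] (hP : SolvesMP n r σ l x P) (τ : ℝ) (θ : Fin n → ℝ) {t : ℝ} (hrt : r ≤ t) :
    ∫ z, Real.exp (linF τ θ z) ∂(P.map (Zp t)) - Real.exp (linF τ θ (r, x)) =
      ∫ z, (τ + expRate σ l θ z) * Real.exp (linF τ θ z) ∂(occM r t P) := by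
  have hc : Continuous fun z : SpT n => Real.exp (linF τ θ z) := Real.continuous_exp.comp (continuous_linF τ θ)
  set q : SpT n → ℝ := fun z => τ + expRate σ l θ z with hq
  have hqm : Measurable q := measurable_const.add (h.measurable_expRate θ)
  have hqK : ∀ z, |q z| ≤ |τ| + rateBd C θ := fun z =>
    (abs_add_le _ _).trans (add_le_add le_rfl (h.abs_expRate_le θ z))
  set K := |τ| + rateBd C θ with hK
  have hK0 : 0 ≤ K := add_nonneg (abs_nonneg _) (h.rateBd_nonneg θ)
  -- the finite variation factor
  set Y : ℝ → PathSp n r → ℝ := fun v ω => Real.exp (∫ u in Set.Ioc r v, q (Zp u ω)) with hY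
  set y0 := Real.exp (linF τ θ (r, x)) with hy0
  have hMY : ∀ v, r ≤ v → ∀ ω, MexpP n r σ l x θ v ω * Y v ω * y0 = Real.exp (linF τ θ (Zp v ω)) := by
    intro v hv ω
    simp only [hY, hy0, hq]
    rw [h.MexpP_eq, ← Real.exp_add, ← Real.exp_add, integral_add (by simp)
      (integrableOn_time (h.measurable_expRate θ) (h.abs_expRate_le θ) r v ω)]
    simp [linF, Zp, dotProduct_sub, hv, Measure.real]
    ring
  have hYeq : ∀ ω, Y t ω = 1 + ∫ v in Set.Ioc r t, q (Zp v ω) * Y v ω := by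
    intro ω
    have := exp_timeIntegral_sub_one (hqm.comp (measurable_Zp_time ω)) (fun v => hqK _) hrt
    simp only [Function.comp] at this
    simp only [hY]
    linarith
  have hYb : ∀ v, v ≤ t → ∀ ω, |Y v ω| ≤ Real.exp (K * (t - r)) := by
    intro v hv ω
    simp only [hY]
    rw [abs_of_pos (Real.exp_pos _), Real.exp_le_exp]
    rcases le_total r v with h' | h'
    · exact ((abs_le.1 (abs_timeIntegral_le hqK h' ω)).2).trans (by gcongr)
    · rw [Set.Ioc_eq_empty (by simpa using h'), setIntegral_empty]
      exact mul_nonneg hK0 (by linarith)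
  have hYjm : Measurable fun p : ℝ × PathSp n r => Y p.1 p.2 := by
    refine Real.measurable_exp.comp ?_
    have h1 : Measurable fun p : (ℝ × PathSp n r) × ℝ =>
        (Set.Ioc r p.1.1).indicator (fun u => q (Zp u p.1.2)) p.2 := by
      have : (fun p : (ℝ × PathSp n r) × ℝ => (Set.Ioc r p.1.1).indicator (fun u => q (Zp u p.1.2)) p.2) =
          Set.indicator {p : (ℝ × PathSp n r) × ℝ | r < p.2 ∧ p.2 ≤ p.1.1} fun p => q (Zp p.2 p.1.2) := by
        funext p; simp [Set.indicator]
      rw [this]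
      refine Measurable.indicator (hqm.comp (measurable_Zp_uncurry.comp
        (measurable_snd.prodMk (measurable_snd.comp measurable_fst)))) ?_
      exact (measurableSet_lt measurable_const measurable_snd).inter
        (measurableSet_le measurable_snd (measurable_fst.comp measurable_fst))
    have h2 := (h1.stronglyMeasurable.integral_prod_right' (ν := volume)).measurable
    convert h2 using 2 with p
    exact (integral_indicator measurableSet_Ioc).symm
  have hYad : ∀ v, r ≤ v → Measurable[canonFiltr n r v] fun ω => q (Zp v ω) * Y v ω := by
    intro v hv
    refine Measurable.mul ?_ (Real.measurable_exp.comp (timeIntegral_measurable_canonFiltr hqm hv le_rfl))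
    exact hqm.comp (measurable_const.prodMk (Xcan_measurable_canonFiltr hv le_rfl))
  have hMi : Integrable (MexpP n r σ l x θ t) P := (hP.2 θ t t hrt le_rfl).1
  have hmem : ∀ᵐ p ∂(timeProd r t P), p.1 ∈ Set.Ioc r t := by
    unfold timeProd
    exact Measure.quasiMeasurePreserving_fst.ae (ae_restrict_mem measurableSet_Ioc)
  have hfin : IsFiniteMeasure (volume.restrict (Set.Ioc r t)) := ⟨by simp⟩
  have hgi : Integrable (fun p : ℝ × PathSp n r => MexpP n r σ l x θ t p.2 * (q (Zp p.1 p.2) * Y p.1 p.2))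
      (timeProd r t P) := by
    have h1 : Integrable (fun p : ℝ × PathSp n r => MexpP n r σ l x θ t p.2) (timeProd r t P) := by
      unfold timeProd
      exact hMi.comp_snd _
    refine (h1.mul_const (K * Real.exp (K * (t - r)))).mono (Measurable.aestronglyMeasurable ?_) ?_
    · exact ((h.measurable_MexpP x θ t).comp measurable_snd).mul ((hqm.comp measurable_Zp_uncurry).mul hYjm)
    · filter_upwards [hmem] with p hp
      rw [norm_mul, norm_mul (MexpP n r σ l x θ t p.2) (K * _)]
      refine mul_le_mul_of_nonneg_left ?_ (norm_nonneg _)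
      rw [norm_mul]
      exact (mul_le_mul (hqK _) (hYb _ hp.2 _) (abs_nonneg _) hK0).trans (le_abs_self _)
  have hei : Integrable (fun p : ℝ × PathSp n r => q (Zp p.1 p.2) * Real.exp (linF τ θ (Zp p.1 p.2)))
      (timeProd r t P) := by
    have h1 : Integrable (fun p : ℝ × PathSp n r => Real.exp (linF τ θ (Zp p.1 p.2))) (timeProd r t P) :=
      (integrable_map_measure hc.aestronglyMeasurable measurable_Zp_uncurry.aemeasurable).1
        (hP.integrable_exp_linF_occM h τ θ t)
    exact h1.bdd_mul (c := K) (hqm.comp measurable_Zp_uncurry).aestronglyMeasurable (ae_of_all _ fun p => hqK _)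
  rw [integral_map (measurable_Zp t).aemeasurable hc.aestronglyMeasurable,
    integral_occM (f := fun z => q z * Real.exp (linF τ θ z)) (hqm.mul hc.measurable)]
  have s1 : ∫ ω, Real.exp (linF τ θ (Zp t ω)) ∂P =
      y0 * (1 + ∫ ω, (∫ v in Set.Ioc r t, MexpP n r σ l x θ t ω * (q (Zp v ω) * Y v ω)) ∂P) := by
    rw [← hP.integral_MexpP h θ hrt, ← integral_add hMi, ← integral_const_mul]
    · refine integral_congr_ae (ae_of_all _ fun ω => ?_)
      simp only
      rw [← hMY t hrt ω, integral_const_mul]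
      conv_lhs => rw [hYeq ω]
      ring
    · exact hgi.integral_prod_right
  have s2 : ∫ ω, (∫ v in Set.Ioc r t, MexpP n r σ l x θ t ω * (q (Zp v ω) * Y v ω)) ∂P =
      ∫ v in Set.Ioc r t, ∫ ω, MexpP n r σ l x θ t ω * (q (Zp v ω) * Y v ω) ∂P :=
    integral_integral_swap
      (f := fun ω v => MexpP n r σ l x θ t ω * (q (Zp v ω) * Y v ω)) hgi.swap
  have s3 : y0 * ∫ v in Set.Ioc r t, ∫ ω, MexpP n r σ l x θ t ω * (q (Zp v ω) * Y v ω) ∂P =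
      ∫ v in Set.Ioc r t, ∫ ω, q (Zp v ω) * Real.exp (linF τ θ (Zp v ω)) ∂P := by
    rw [← integral_const_mul]
    refine setIntegral_congr_fun measurableSet_Ioc fun v hv => ?_
    rw [mart_integral h hP θ hv.1.le hv.2 (hYad v hv.1.le), ← integral_const_mul]
    refine integral_congr_ae (ae_of_all _ fun ω => ?_)
    simp only
    rw [← hMY v hv.1.le ω]
    ring
  rw [s1, mul_add, s2, s3, timeProd, integral_prod _ hei]
  ring
end dynkinExp

section complexify

lemma entire_integral_exp {Ω : Type*} [MeasurableSpace Ω] (μ : Measure Ω) {U g : Ω → ℝ} (hU : Measurable U)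
    (hintg : ∀ s : ℝ, Integrable (fun ω => Real.exp (s * U ω)) μ) (hg : Measurable g) {K : ℝ}
    (hK : ∀ ω, |g ω| ≤ K) :
    AnalyticOnNhd ℂ (fun z : ℂ => ∫ ω, (g ω : ℂ) * Complex.exp (z * U ω) ∂μ) Set.univ := by
  have hnn : ∀ (f : Ω → ℝ) (L : ℝ), Measurable f → (∀ ω, 0 ≤ f ω) → (∀ ω, f ω ≤ L) →
      AnalyticOnNhd ℂ (fun z : ℂ => ∫ ω, (f ω : ℂ) * Complex.exp (z * U ω) ∂μ) Set.univ := by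
    intro f L hf h0 hL
    have h1 := ProbabilityTheory.analyticOnNhd_complexMGF (X := U) (μ := μ.withDensity fun ω => ENNReal.ofReal (f ω))
    have h2 : ProbabilityTheory.integrableExpSet U (μ.withDensity fun ω => ENNReal.ofReal (f ω)) = Set.univ := by
      refine Set.eq_univ_of_forall fun s => ?_
      change Integrable _ _
      rw [integrable_withDensity_iff_integrable_smul' hf.ennreal_ofReal (ae_of_all _ fun _ => ENNReal.ofReal_lt_top)]
      refine (hintg s).bdd_mul (c := L) (f := fun ω => (ENNReal.ofReal (f ω)).toReal) hf.ennreal_ofReal.ennreal_toReal.aestronglyMeasurable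
        (ae_of_all _ fun ω => ?_)
      rw [ENNReal.toReal_ofReal (h0 ω), Real.norm_of_nonneg (h0 ω)]; exact hL ω
    rw [h2] at h1
    simp only [interior_univ, Set.mem_univ, Set.ofPred_true] at h1
    refine h1.congr isOpen_univ fun z _ => ?_
    simp only [ProbabilityTheory.complexMGF]
    rw [integral_withDensity_eq_integral_toReal_smul hf.ennreal_ofReal (ae_of_all _ fun _ => ENNReal.ofReal_lt_top)]
    refine integral_congr_ae (ae_of_all _ fun ω => ?_)
    simp only [ENNReal.toReal_ofReal (h0 ω), Complex.real_smul]
  have h1 := hnn (fun ω => g ω + K) (K + K) (hg.add_const K) (fun ω => by linarith [(abs_le.1 (hK ω)).1])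
    (fun ω => by linarith [(abs_le.1 (hK ω)).2])
  have h2 := hnn (fun _ => max K 0) (max K 0) measurable_const (fun ω => le_max_right _ _) (fun ω => le_rfl)
  have hexp : ∀ z : ℂ, Integrable (fun ω => Complex.exp (z * U ω)) μ := fun z => by
    refine (hintg z.re).mono' (by fun_prop) (ae_of_all _ fun ω => ?_)
    rw [Complex.norm_exp]; simp
  refine (h1.sub h2).congr isOpen_univ fun z _ => ?_
  rcases isEmpty_or_nonempty Ω with hΩ | ⟨⟨ω₀⟩⟩
  · simp [Measure.eq_zero_of_isEmpty μ]
  have hK0 : 0 ≤ K := (abs_nonneg _).trans (hK ω₀)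
  have hb : ∀ (f : Ω → ℝ) (L : ℝ), Measurable f → (∀ ω, |f ω| ≤ L) →
      Integrable (fun ω => (f ω : ℂ) * Complex.exp (z * U ω)) μ := fun f L hf hL =>
    (hexp z).bdd_mul (c := L) (by fun_prop) (ae_of_all _ fun ω => by simpa using hL ω)
  simp only [Pi.sub_apply]
  rw [← integral_sub (hb _ (K + K) (hg.add_const K) fun ω => ?_) (hb _ K measurable_const fun ω => ?_)]
  · refine integral_congr_ae (ae_of_all _ fun ω => ?_)
    simp only [max_eq_left hK0]
    push_cast; ring
  · exact (abs_add_le _ _).trans (add_le_add (hK ω) (abs_of_nonneg hK0).le)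
  · rw [max_eq_left hK0, abs_of_nonneg hK0]

lemma eq_of_analytic_of_eq_real {f g : ℂ → ℂ} (hf : AnalyticOnNhd ℂ f Set.univ) (hg : AnalyticOnNhd ℂ g Set.univ)
    (h : ∀ s : ℝ, f s = g s) (z : ℂ) : f z = g z := by
  refine hf.eqOn_of_preconnected_of_frequently_eq hg isPreconnected_univ (Set.mem_univ 0) ?_ (Set.mem_univ z)
  have ht : Tendsto (fun k : ℕ => (((1 : ℝ) / ((k : ℝ) + 1) : ℝ) : ℂ)) atTop (𝓝[≠] 0) := by
    refine tendsto_nhdsWithin_iff.2 ⟨?_, Eventually.of_forall fun k => ?_⟩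
    · have := (Complex.continuous_ofReal.tendsto 0).comp (tendsto_one_div_add_atTop_nhds_zero_nat (𝕜 := ℝ))
      simpa [Function.comp_def] using this
    · simp only [Set.mem_compl_iff, Set.mem_singleton_iff, Complex.ofReal_eq_zero]
      positivity
  exact ht.frequently (Frequently.of_forall fun k => h _)

variable {n : ℕ}

lemma measurable_linF (τ : ℝ) (θ : Fin n → ℝ) : Measurable (linF τ θ) := (continuous_linF τ θ).measurable

lemma linF_smul (s τ : ℝ) (θ : Fin n → ℝ) (z : SpT n) : linF (s * τ) (s • θ) z = s * linF τ θ z := by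
  simp only [linF, smul_dotProduct, smul_eq_mul]; ring

/-- The Dynkin identity for characters, by analytic continuation from real exponentials. -/
lemma dynkin_char {a : SpT n → Matrix (Fin n) (Fin n) ℝ} {b : SpT n → Fin n → ℝ} {K : ℝ}
    (ha : ∀ i j, Measurable fun z => a z i j) (hb : ∀ i, Measurable fun z => b z i)
    (haK : ∀ z i j, |a z i j| ≤ K) (hbK : ∀ z i, |b z i| ≤ K) {ν μ : Measure (SpT n)}
    (hν : ∀ τ θ, Integrable (fun z => Real.exp (linF τ θ z)) ν)
    (hμ : ∀ τ θ, Integrable (fun z => Real.exp (linF τ θ z)) μ) {z₀ : SpT n}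
    (hE : ∀ τ θ, ∫ z, Real.exp (linF τ θ z) ∂ν - Real.exp (linF τ θ z₀) =
      ∫ z, (τ + (θ ⬝ᵥ b z + (1 / 2) * (θ ⬝ᵥ (a z).mulVec θ))) * Real.exp (linF τ θ z) ∂μ)
    (τ : ℝ) (θ : Fin n → ℝ) (w : ℂ) :
    ∫ z, Complex.exp (w * linF τ θ z) ∂ν - Complex.exp (w * linF τ θ z₀) =
      w * τ * (∫ z, ((1 : ℝ) : ℂ) * Complex.exp (w * linF τ θ z) ∂μ) +
      (1 / 2) * ∑ i, ∑ j, (w * θ i) * (w * θ j) * (∫ z, (a z i j : ℂ) * Complex.exp (w * linF τ θ z) ∂μ) +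
      ∑ i, (w * θ i) * ∫ z, (b z i : ℂ) * Complex.exp (w * linF τ θ z) ∂μ := by
  have hUν : ∀ s : ℝ, Integrable (fun z => Real.exp (s * linF τ θ z)) ν := fun s => by
    simpa only [linF_smul] using hν (s * τ) (s • θ)
  have hUμ : ∀ s : ℝ, Integrable (fun z => Real.exp (s * linF τ θ z)) μ := fun s => by
    simpa only [linF_smul] using hμ (s * τ) (s • θ)
  have hl := measurable_linF τ θ
  have an : AnalyticOnNhd ℂ (fun w : ℂ => ∫ z, Complex.exp (w * linF τ θ z) ∂ν) Set.univ := by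
    have := entire_integral_exp ν hl hUν (g := fun _ => 1) measurable_const (K := 1) (fun _ => by simp)
    simpa using this
  have a1 := entire_integral_exp μ hl hUμ (g := fun _ => 1) measurable_const (K := 1) (fun _ => by simp)
  have aa := fun i j => entire_integral_exp μ hl hUμ (ha i j) fun z => haK z i j
  have ab := fun i => entire_integral_exp μ hl hUμ (hb i) fun z => hbK z i
  have aid : AnalyticOnNhd ℂ (fun w : ℂ => w) Set.univ := analyticOnNhd_id
  have ac : ∀ c : ℂ, AnalyticOnNhd ℂ (fun _ : ℂ => c) Set.univ := fun c => analyticOnNhd_const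
  have acexp : AnalyticOnNhd ℂ (fun w : ℂ => Complex.exp (w * linF τ θ z₀)) Set.univ :=
    (aid.mul (ac _)).cexp
  refine eq_of_analytic_of_eq_real
    (f := fun w => ∫ z, Complex.exp (w * linF τ θ z) ∂ν - Complex.exp (w * linF τ θ z₀))
    (g := fun w => w * τ * (∫ z, ((1 : ℝ) : ℂ) * Complex.exp (w * linF τ θ z) ∂μ) +
      (1 / 2) * ∑ i, ∑ j, (w * θ i) * (w * θ j) * (∫ z, (a z i j : ℂ) * Complex.exp (w * linF τ θ z) ∂μ) +
      ∑ i, (w * θ i) * ∫ z, (b z i : ℂ) * Complex.exp (w * linF τ θ z) ∂μ)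
    (an.sub acexp) ?_ (fun s => ?_) w
  · refine (((aid.mul (ac _)).mul a1).add ((ac _).mul ?_)).add ?_
    · exact Finset.analyticOnNhd_fun_sum _ fun i _ => Finset.analyticOnNhd_fun_sum _ fun j _ =>
        ((aid.mul (ac _)).mul (aid.mul (ac _))).mul (aa i j)
    · exact Finset.analyticOnNhd_fun_sum _ fun i _ => (aid.mul (ac _)).mul (ab i)
  · have e : ∀ (ρ : Measure (SpT n)) (f : SpT n → ℝ), ∫ z, (f z : ℂ) * Complex.exp (s * linF τ θ z) ∂ρ =
        ((∫ z, f z * Real.exp (s * linF τ θ z) ∂ρ : ℝ) : ℂ) := fun ρ f => by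
      rw [← integral_complex_ofReal]; push_cast; rfl
    have e' : ∀ (ρ : Measure (SpT n)), ∫ z, Complex.exp (s * linF τ θ z) ∂ρ =
        ((∫ z, Real.exp (s * linF τ θ z) ∂ρ : ℝ) : ℂ) := fun ρ => by
      rw [← integral_complex_ofReal]; push_cast; rfl
    simp only [e, e']
    suffices real : (∫ z, Real.exp (s * linF τ θ z) ∂ν) - Real.exp (s * linF τ θ z₀) =
        s * τ * (∫ z, 1 * Real.exp (s * linF τ θ z) ∂μ) +
        (1 / 2) * ∑ i, ∑ j, (s * θ i) * (s * θ j) * (∫ z, a z i j * Real.exp (s * linF τ θ z) ∂μ) +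
        ∑ i, (s * θ i) * ∫ z, b z i * Real.exp (s * linF τ θ z) ∂μ by
      have h := congrArg (fun y : ℝ => (y : ℂ)) real
      simp only [Complex.ofReal_sub, Complex.ofReal_add, Complex.ofReal_mul, Complex.ofReal_sum,
        Complex.ofReal_exp] at h
      rw [h]
      norm_num
    have hs := hE (s * τ) (s • θ)
    simp only [linF_smul] at hs
    have hi : ∀ {f : SpT n → ℝ} {L : ℝ}, Measurable f → (∀ z, |f z| ≤ L) →
        Integrable (fun z => f z * Real.exp (s * linF τ θ z)) μ := fun hf hL =>
      (hUμ s).bdd_mul hf.aestronglyMeasurable (ae_of_all _ hL)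
    have i1 : Integrable (fun z => (1 : ℝ) * Real.exp (s * linF τ θ z)) μ :=
      hi (f := fun _ => 1) (L := 1) measurable_const (fun _ => by simp)
    have ia := fun i j => hi (ha i j) fun z => haK z i j
    have ib := fun i => hi (hb i) fun z => hbK z i
    rw [hs]
    have : ∀ z, (s * τ + ((s • θ) ⬝ᵥ b z + (1 / 2) * ((s • θ) ⬝ᵥ (a z).mulVec (s • θ)))) *
        Real.exp (s * linF τ θ z) = s * τ * (1 * Real.exp (s * linF τ θ z)) +
        (1 / 2) * ∑ i, ∑ j, (s * θ i) * (s * θ j) * (a z i j * Real.exp (s * linF τ θ z)) +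
        ∑ i, (s * θ i) * (b z i * Real.exp (s * linF τ θ z)) := by
      intro z
      simp only [dotProduct, Matrix.mulVec, Pi.smul_apply, smul_eq_mul]
      rw [add_mul, add_mul, Finset.sum_mul, mul_assoc (1 / 2), Finset.sum_mul]
      rw [add_assoc, add_comm (∑ i, _) (1 / 2 * _), one_mul]
      congr 2
      · congr 1
        refine Finset.sum_congr rfl fun i _ => ?_
        rw [Finset.mul_sum, Finset.sum_mul]
        exact Finset.sum_congr rfl fun j _ => by ring
      · exact Finset.sum_congr rfl fun j _ => by ring
    simp only [this]
    have j1 : Integrable (fun z => s * τ * (1 * Real.exp (s * linF τ θ z))) μ := i1.const_mul _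
    have j2 : ∀ i, Integrable (fun z => ∑ j, (s * θ i) * (s * θ j) * (a z i j * Real.exp (s * linF τ θ z))) μ :=
      fun i => integrable_finsetSum _ fun j _ => (ia i j).const_mul _
    have j2' : Integrable (fun z => (1 / 2) * ∑ i, ∑ j, (s * θ i) * (s * θ j) *
        (a z i j * Real.exp (s * linF τ θ z))) μ :=
      Integrable.const_mul (integrable_finsetSum _ fun i _ => j2 i) _
    have j3 : ∀ i, Integrable (fun z => (s * θ i) * (b z i * Real.exp (s * linF τ θ z))) μ :=
      fun i => (ib i).const_mul _
    have j12 : Integrable (fun z => s * τ * (1 * Real.exp (s * linF τ θ z)) + (1 / 2) * ∑ i, ∑ j,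
        (s * θ i) * (s * θ j) * (a z i j * Real.exp (s * linF τ θ z))) μ := j1.add j2'
    rw [integral_add j12 (integrable_finsetSum _ fun i _ => j3 i), integral_add j1 j2', integral_const_mul (s * τ),
      integral_const_mul (1 / 2 : ℝ), integral_finsetSum _ fun i _ => j2 i, integral_finsetSum _ fun i _ => j3 i]
    simp only [integral_const_mul]
    have e3 : ∀ i, ∫ z, ∑ j, (s * θ i) * (s * θ j) * (a z i j * Real.exp (s * linF τ θ z)) ∂μ =
        ∑ j, (s * θ i) * (s * θ j) * ∫ z, (a z i j * Real.exp (s * linF τ θ z)) ∂μ := by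
      intro i
      rw [integral_finsetSum _ fun j _ => (ia i j).const_mul _]
      simp only [integral_const_mul]
    simp only [e3]
end complexify

section fourierTest
open FourierTransform SchwartzMap LineDeriv

variable {n : ℕ}

/-- A Euclidean model of space-time. -/
abbrev EucT (n : ℕ) := EuclideanSpace ℝ (Fin (Module.finrank ℝ (SpT n)))

/-- Identification of space-time with its Euclidean model. -/
noncomputable def eucT (n : ℕ) : SpT n ≃L[ℝ] EucT n := toEuclidean

/-- A test function as a Schwartz function on the Euclidean model. -/
noncomputable def testS {φ : SpT n → ℝ} (hφ : IsTest φ) : 𝓢(EucT n, ℂ) :=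
  HasCompactSupport.toSchwartzMap (f := fun v => (φ ((eucT n).symm v) : ℂ))
    (((hφ.2.comp_homeomorph (eucT n).symm.toHomeomorph).comp_left (g := fun y : ℝ => (y : ℂ)) Complex.ofReal_zero))
    (Complex.ofRealCLM.contDiff.comp (hφ.1.comp (eucT n).symm.contDiff))

lemma testS_apply {φ : SpT n → ℝ} (hφ : IsTest φ) (v : EucT n) : testS hφ v = (φ ((eucT n).symm v) : ℂ) := rfl

/-- The time frequency. -/
noncomputable def freqT (ξ : EucT n) : ℝ := 2 * Real.pi * inner ℝ ξ (eucT n (eT n))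

/-- The space frequency. -/
noncomputable def freqX (ξ : EucT n) (i : Fin n) : ℝ := 2 * Real.pi * inner ℝ ξ (eucT n (eX i))

lemma linF_freq (ξ : EucT n) (z : SpT n) :
    linF (freqT ξ) (freqX ξ) z = 2 * Real.pi * inner ℝ ξ (eucT n z) := by
  have e : z = z.1 • eT n + ∑ i, z.2 i • (eX i : SpT n) := by
    refine Prod.ext ?_ ?_
    · simp [eT, eX, Prod.fst_sum]
    · funext j
      simp [eT, eX, Prod.snd_sum, Pi.single_apply]
  conv_rhs => rw [e]
  simp only [map_add, map_smul, map_sum, inner_add_right, inner_smul_right, inner_sum, linF, freqT, freqX,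
    dotProduct, mul_add, Finset.mul_sum]
  congr 1
  · ring
  · exact Finset.sum_congr rfl fun i _ => by ring

lemma continuous_linF_freq : Continuous fun p : EucT n × SpT n => linF (freqT p.1) (freqX p.1) p.2 := by
  simp only [linF_freq]
  fun_prop

lemma integrable_hat {φ : SpT n → ℝ} (hφ : IsTest φ) : Integrable (fun ξ => 𝓕 (testS hφ) ξ) := (𝓕 (testS hφ)).integrable

lemma test_eq_integral_hat {φ : SpT n → ℝ} (hφ : IsTest φ) (z : SpT n) :
    (φ z : ℂ) = ∫ ξ, 𝓕 (testS hφ) ξ * Complex.exp (Complex.I * linF (freqT ξ) (freqX ξ) z) := by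
  have h : 𝓕⁻ (𝓕 (⇑(testS hφ))) (eucT n z) = testS hφ (eucT n z) := by
    rw [Continuous.fourierInv_fourier_eq (testS hφ).continuous (testS hφ).integrable]
    rw [← SchwartzMap.fourier_coe]
    exact (𝓕 (testS hφ)).integrable
  rw [testS_apply, ContinuousLinearEquiv.symm_apply_apply] at h
  rw [← h, Real.fourierInv_eq']
  refine integral_congr_ae (ae_of_all _ fun ξ => ?_)
  simp only [linF_freq, SchwartzMap.fourier_coe, smul_eq_mul]
  rw [mul_comm, mul_comm Complex.I]

lemma hat_dirD {φ : SpT n → ℝ} (hφ : IsTest φ) (v : SpT n) (ξ : EucT n) :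
    𝓕 (testS (hφ.dirD v)) ξ = Complex.I * ((2 * Real.pi * inner ℝ ξ (eucT n v) : ℝ) : ℂ) * 𝓕 (testS hφ) ξ := by
  have e : testS (hφ.dirD v) = ∂_{eucT n v} (testS hφ) := by
    ext w
    rw [testS_apply, SchwartzMap.lineDerivOp_apply_eq_fderiv]
    have h1 : HasFDerivAt (fun w => φ ((eucT n).symm w))
        ((fderiv ℝ φ ((eucT n).symm w)).comp ((eucT n).symm : EucT n →L[ℝ] SpT n)) w :=
      (hφ.differentiable _).hasFDerivAt.comp w (eucT n).symm.hasFDerivAt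
    have h2 : HasFDerivAt (fun w => ((φ ((eucT n).symm w) : ℝ) : ℂ)) (Complex.ofRealCLM.comp
        ((fderiv ℝ φ ((eucT n).symm w)).comp ((eucT n).symm : EucT n →L[ℝ] SpT n))) w :=
      Complex.ofRealCLM.hasFDerivAt.comp w h1
    have h3 : fderiv ℝ (testS hφ) w = _ := h2.fderiv
    rw [h3]
    simp [dirD]
  rw [e, SchwartzMap.fourier_lineDerivOp_eq]
  have : (inner ℝ · (eucT n v) : EucT n → ℝ).HasTemperateGrowth := by fun_prop
  simp only [_root_.smul_apply, SchwartzMap.smulLeftCLM_apply_apply this, smul_eq_mul, Complex.real_smul]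
  push_cast
  ring

/-- Fourier representation of the integral of a test function. -/
lemma integral_mul_test_eq {g : SpT n → ℝ} (hg : Measurable g) {K : ℝ} (hK : ∀ z, |g z| ≤ K)
    (μ : Measure (SpT n)) [IsFiniteMeasure μ] {φ : SpT n → ℝ} (hφ : IsTest φ) :
    Integrable (fun ξ => 𝓕 (testS hφ) ξ *
      ∫ z, (g z : ℂ) * Complex.exp (Complex.I * linF (freqT ξ) (freqX ξ) z) ∂μ) ∧
    ((∫ z, g z * φ z ∂μ : ℝ) : ℂ) = ∫ ξ, 𝓕 (testS hφ) ξ *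
      ∫ z, (g z : ℂ) * Complex.exp (Complex.I * linF (freqT ξ) (freqX ξ) z) ∂μ := by
  have hcont := continuous_linF_freq (n := n)
  have hintg : Integrable (fun p : EucT n × SpT n => 𝓕 (testS hφ) p.1 * ((g p.2 : ℂ) *
      Complex.exp (Complex.I * linF (freqT p.1) (freqX p.1) p.2))) (volume.prod μ) := by
    have h1 : Integrable (fun p : EucT n × SpT n => 𝓕 (testS hφ) p.1) (volume.prod μ) := by
      simpa using (integrable_hat hφ).mul_prod (integrable_const (1 : ℂ) (μ := μ))
    refine h1.mul_bdd (c := K) ?_ (ae_of_all _ fun p => ?_)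
    · refine Measurable.aestronglyMeasurable ?_
      have : Measurable fun p : EucT n × SpT n => linF (freqT p.1) (freqX p.1) p.2 := hcont.measurable
      have : Measurable fun p : EucT n × SpT n => g p.2 := hg.comp measurable_snd
      fun_prop
    · rw [norm_mul, mul_comm Complex.I, Complex.norm_exp_ofReal_mul_I, mul_one]
      simpa using hK p.2
  have e : ∀ ξ, 𝓕 (testS hφ) ξ * ∫ z, (g z : ℂ) * Complex.exp (Complex.I * linF (freqT ξ) (freqX ξ) z) ∂μ =
      ∫ z, 𝓕 (testS hφ) ξ * ((g z : ℂ) * Complex.exp (Complex.I * linF (freqT ξ) (freqX ξ) z)) ∂μ := fun ξ =>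
    (integral_const_mul _ _).symm
  simp only [e]
  refine ⟨hintg.integral_prod_left, ?_⟩
  rw [integral_integral_swap hintg, ← integral_complex_ofReal]
  refine integral_congr_ae (ae_of_all _ fun z => ?_)
  simp only
  push_cast
  rw [test_eq_integral_hat hφ z, ← integral_const_mul]
  exact integral_congr_ae (ae_of_all _ fun ξ => by ring)

/-- The Dynkin identity for test functions, from the one for exponentials. -/
lemma dynkin_test_of_exp {a : SpT n → Matrix (Fin n) (Fin n) ℝ} {b : SpT n → Fin n → ℝ} {K : ℝ}
    (ha : ∀ i j, Measurable fun z => a z i j) (hb : ∀ i, Measurable fun z => b z i)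
    (haK : ∀ z i j, |a z i j| ≤ K) (hbK : ∀ z i, |b z i| ≤ K) {ν μ : Measure (SpT n)}
    [IsFiniteMeasure ν] [IsFiniteMeasure μ]
    (hν : ∀ τ θ, Integrable (fun z => Real.exp (linF τ θ z)) ν)
    (hμ : ∀ τ θ, Integrable (fun z => Real.exp (linF τ θ z)) μ) {z₀ : SpT n}
    (hE : ∀ τ θ, ∫ z, Real.exp (linF τ θ z) ∂ν - Real.exp (linF τ θ z₀) =
      ∫ z, (τ + (θ ⬝ᵥ b z + (1 / 2) * (θ ⬝ᵥ (a z).mulVec θ))) * Real.exp (linF τ θ z) ∂μ)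
    {φ : SpT n → ℝ} (hφ : IsTest φ) :
    ∫ z, φ z ∂ν - φ z₀ = ∫ z, parOp a b φ z ∂μ := by
  have h1 : ∀ z : SpT n, |(1 : ℝ)| ≤ 1 := fun _ => by simp
  obtain ⟨iν, eν⟩ := integral_mul_test_eq (measurable_const (a := (1 : ℝ))) h1 ν hφ
  obtain ⟨iz, ez⟩ := integral_mul_test_eq (measurable_const (a := (1 : ℝ))) h1 (Measure.dirac z₀) hφ
  obtain ⟨iT, eT'⟩ := integral_mul_test_eq (measurable_const (a := (1 : ℝ))) h1 μ (hφ.dirD (eT n))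
  have iA := fun i j => (integral_mul_test_eq (ha i j) (fun z => haK z i j) μ ((hφ.dirD (eX j)).dirD (eX i))).1
  have eA := fun i j => (integral_mul_test_eq (ha i j) (fun z => haK z i j) μ ((hφ.dirD (eX j)).dirD (eX i))).2
  have iB := fun i => (integral_mul_test_eq (hb i) (fun z => hbK z i) μ (hφ.dirD (eX i))).1
  have eB := fun i => (integral_mul_test_eq (hb i) (fun z => hbK z i) μ (hφ.dirD (eX i))).2
  simp only [one_mul, Complex.ofReal_one, integral_dirac] at eν ez eT' iν iz iT
  have hmul : ∀ {g : SpT n → ℝ} {ψ : SpT n → ℝ}, Measurable g → (∀ z, |g z| ≤ K) → IsTest ψ →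
      Integrable (fun z => g z * ψ z) μ := fun {g ψ} hg hK hψ => by
    obtain ⟨C, _, hC⟩ := hψ.bounded
    exact (Integrable.of_bound hψ.continuous.aestronglyMeasurable C (ae_of_all _ hC)).bdd_mul
      hg.aestronglyMeasurable (ae_of_all _ hK)
  have jT : Integrable (fun z => dirD (eT n) φ z) μ := by
    obtain ⟨C, _, hC⟩ := (hφ.dirD (eT n)).bounded
    exact Integrable.of_bound (hφ.dirD (eT n)).continuous.aestronglyMeasurable C (ae_of_all _ hC)
  have jA := fun i j => hmul (ha i j) (fun z => haK z i j) ((hφ.dirD (eX j)).dirD (eX i))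
  have jB := fun i => hmul (hb i) (fun z => hbK z i) (hφ.dirD (eX i))
  have jA' : ∀ i, Integrable (fun z => ∑ j, a z i j * dirD (eX i) (dirD (eX j) φ) z) μ :=
    fun i => integrable_finsetSum _ fun j _ => jA i j
  have jA'' : Integrable (fun z => (1 / 2) * ∑ i, ∑ j, a z i j * dirD (eX i) (dirD (eX j) φ) z) μ :=
    Integrable.const_mul (integrable_finsetSum _ fun i _ => jA' i) _
  have jTA : Integrable (fun z => dirD (eT n) φ z +
      (1 / 2) * ∑ i, ∑ j, a z i j * dirD (eX i) (dirD (eX j) φ) z) μ := jT.add jA''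
  have hR : ∫ z, parOp a b φ z ∂μ = (∫ z, dirD (eT n) φ z ∂μ) +
      (1 / 2) * (∑ i, ∑ j, ∫ z, a z i j * dirD (eX i) (dirD (eX j) φ) z ∂μ) +
      ∑ i, ∫ z, b z i * dirD (eX i) φ z ∂μ := by
    unfold parOp
    rw [integral_add jTA (integrable_finsetSum _ fun i _ => jB i), integral_add jT jA'',
      integral_const_mul (1 / 2 : ℝ), integral_finsetSum _ fun i _ => jA' i, integral_finsetSum _ fun i _ => jB i]
    congr 3
    exact Finset.sum_congr rfl fun i _ => integral_finsetSum _ fun j _ => jA i j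
  apply Complex.ofReal_injective
  rw [hR]
  simp only [Complex.ofReal_sub, Complex.ofReal_add, Complex.ofReal_mul, Complex.ofReal_sum]
  rw [eν, ez, eT', ← integral_sub iν iz]
  simp only [eA, eB]
  have kA : ∀ i, Integrable (fun ξ => ∑ j, 𝓕 (testS ((hφ.dirD (eX j)).dirD (eX i))) ξ *
      ∫ z, (a z i j : ℂ) * Complex.exp (Complex.I * linF (freqT ξ) (freqX ξ) z) ∂μ) :=
    fun i => integrable_finsetSum _ fun j _ => iA i j
  have kA' := (integrable_finsetSum Finset.univ fun i _ => kA i).const_mul (1 / 2 : ℂ)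
  have e1 : ∀ i, ∑ j, ∫ ξ, 𝓕 (testS ((hφ.dirD (eX j)).dirD (eX i))) ξ *
      ∫ z, (a z i j : ℂ) * Complex.exp (Complex.I * linF (freqT ξ) (freqX ξ) z) ∂μ =
      ∫ ξ, ∑ j, 𝓕 (testS ((hφ.dirD (eX j)).dirD (eX i))) ξ *
      ∫ z, (a z i j : ℂ) * Complex.exp (Complex.I * linF (freqT ξ) (freqX ξ) z) ∂μ :=
    fun i => (integral_finsetSum _ fun j _ => iA i j).symm
  simp only [e1]
  rw [← integral_finsetSum _ fun i _ => kA i, ← integral_finsetSum _ fun i _ => iB i]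
  have e2 : ((1 / 2 : ℝ) : ℂ) = 1 / 2 := by norm_num
  rw [e2, ← integral_const_mul (1 / 2 : ℂ), ← integral_add iT kA',
    ← integral_add (iT.fun_add kA') (integrable_finsetSum _ fun i _ => iB i)]
  refine integral_congr_ae (ae_of_all _ fun ξ => ?_)
  have g1 := hat_dirD hφ (eT n) ξ
  have g2 := fun i : Fin n => hat_dirD hφ (eX i) ξ
  have g3 := fun i j : Fin n => hat_dirD (hφ.dirD (eX j)) (eX i) ξ
  have gT : 2 * Real.pi * inner ℝ ξ (eucT n (eT n)) = freqT ξ := rfl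
  have gX : ∀ i : Fin n, 2 * Real.pi * inner ℝ ξ (eucT n (eX i)) = freqX ξ i := fun _ => rfl
  rw [gT] at g1
  simp only [gX] at g2 g3
  simp only [g1, g2, g3]
  rw [← mul_sub, dynkin_char ha hb haK hbK hν hμ hE (freqT ξ) (freqX ξ) Complex.I]
  simp only [Complex.ofReal_one, one_mul, mul_add, Finset.mul_sum]
  congr 1
  · congr 1
    · ring
    · refine Finset.sum_congr rfl fun i _ => Finset.sum_congr rfl fun j _ => ?_
      ring
  · refine Finset.sum_congr rfl fun i _ => ?_
    ring
end fourierTest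

section uac
variable {n : ℕ} {r : ℝ} {σ : ℝ → (Fin n → ℝ) → Matrix (Fin n) (Fin n) ℝ}
  {l : ℝ → (Fin n → ℝ) → (Fin n → ℝ)} {C : ℝ}

lemma rateBd_single (i : Fin n) (c : ℝ) : rateBd C (Pi.single i c) = C * |c| + (1 / 2) * (C * |c| ^ 2) := by
  have : ∑ j, |(Pi.single i c : Fin n → ℝ) j| = |c| := by
    rw [Finset.sum_eq_single i]
    · simp
    · intro j _ hj; simp [hj]
    · simp
  rw [rateBd, this]

variable [MeasurableSpace (PathSp n r)] [BorelSpace (PathSp n r)]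

/-- Exponential tail bound for increments. -/
lemma SolvesMP.incr_tail (h : GoodCoef σ l C) {x : Fin n → ℝ} {P : Measure (PathSp n r)}
    [IsProbabilityMeasure P] (hP : SolvesMP n r σ l x P) {s t : ℝ} (hrs : r ≤ s) (hst : s ≤ t)
    {c δ : ℝ} (hc : 0 < c) (hδ : 0 ≤ δ) :
    P {ω | δ < ‖Xcan n r t ω - Xcan n r s ω‖} ≤
      ENNReal.ofReal (2 * n * Real.exp ((C * c + (1 / 2) * (C * c ^ 2)) * (t - s) - c * δ)) := by
  set E := Real.exp ((C * c + (1 / 2) * (C * c ^ 2)) * (t - s) - c * δ) with hE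
  have one : ∀ (i : Fin n) (d : ℝ), |d| = c →
      P {ω | c * δ ≤ d * (Xcan n r t ω - Xcan n r s ω) i} ≤ ENNReal.ofReal E := by
    intro i d hd
    have h1 := hP.lintegral_exp_incr_le h (Pi.single i d) hrs hst
    rw [rateBd_single, hd] at h1
    simp only [single_dotProduct] at h1
    have hm : Measurable fun ω : PathSp n r => ENNReal.ofReal (Real.exp (d * (Xcan n r t ω - Xcan n r s ω) i)) := by
      have hi : Measurable fun ω : PathSp n r => (Xcan n r t ω - Xcan n r s ω) i :=
        ((measurable_pi_apply i).comp (measurable_Xcan t)).sub ((measurable_pi_apply i).comp (measurable_Xcan s))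
      exact (Real.measurable_exp.comp (hi.const_mul d)).ennreal_ofReal
    have h2 := mul_meas_ge_le_lintegral (μ := P) hm (ENNReal.ofReal (Real.exp (c * δ)))
    have h3 : P {ω | c * δ ≤ d * (Xcan n r t ω - Xcan n r s ω) i} ≤ P {ω | ENNReal.ofReal (Real.exp (c * δ)) ≤
        ENNReal.ofReal (Real.exp (d * (Xcan n r t ω - Xcan n r s ω) i))} :=
      measure_mono fun ω hω => ENNReal.ofReal_le_ofReal (Real.exp_le_exp.2 hω)
    have h4 := (mul_le_mul_right h3 (ENNReal.ofReal (Real.exp (c * δ)))).trans (h2.trans h1)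
    have h5 := mul_le_mul_right h4 (ENNReal.ofReal (Real.exp (-(c * δ))))
    rw [← mul_assoc, ← ENNReal.ofReal_mul (Real.exp_pos _).le, ← ENNReal.ofReal_mul (Real.exp_pos _).le,
      ← Real.exp_add, ← Real.exp_add, neg_add_cancel, Real.exp_zero, ENNReal.ofReal_one, one_mul] at h5
    rw [hE, sub_eq_neg_add]
    exact h5
  have sub : {ω : PathSp n r | δ < ‖Xcan n r t ω - Xcan n r s ω‖} ⊆
      ⋃ i : Fin n, ({ω | c * δ ≤ c * (Xcan n r t ω - Xcan n r s ω) i} ∪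
        {ω | c * δ ≤ -c * (Xcan n r t ω - Xcan n r s ω) i}) := by
    intro ω hω
    by_contra hcon
    simp only [Set.mem_iUnion, not_exists, Set.mem_union, not_or, Set.mem_ofPred_eq, not_le] at hcon
    refine absurd hω (not_lt.2 ((pi_norm_le_iff_of_nonneg hδ).2 fun i => ?_))
    obtain ⟨h1, h2⟩ := hcon i
    rw [Real.norm_eq_abs, abs_le]
    constructor
    · by_contra h3; push Not at h3; nlinarith
    · exact (lt_of_mul_lt_mul_left h1 hc.le).le
  refine (measure_mono sub).trans ((measure_iUnion_le _).trans ?_)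
  rw [tsum_fintype]
  calc _ ≤ ∑ _i : Fin n, (ENNReal.ofReal E + ENNReal.ofReal E) := Finset.sum_le_sum fun i _ =>
        (measure_union_le _ _).trans (add_le_add (one i c (abs_of_pos hc)) (one i (-c) (by rw [abs_neg, abs_of_pos hc])))
    _ = ENNReal.ofReal (2 * n * E) := by
        have hE0 : 0 ≤ E := (Real.exp_pos _).le
        rw [← ENNReal.ofReal_add hE0 hE0, ← ENNReal.ofReal_sum_of_nonneg (fun _ _ => by positivity)]
        congr 1
        simp; ring

/-- Dynkin's formula for test functions. -/
lemma SolvesMP.dynkin_test (h : GoodCoef σ l C) {x : Fin n → ℝ} {P : Measure (PathSp n r)}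
    [IsProbabilityMeasure P] (hP : SolvesMP n r σ l x P) {t : ℝ} (hrt : r ≤ t) {φ : SpT n → ℝ} (hφ : IsTest φ) :
    ∫ z, φ z ∂(P.map (Zp t)) - φ (r, x) = ∫ z, parOp (diffF σ) (driftF σ l) φ z ∂(occM r t P) := by
  have : IsProbabilityMeasure (P.map (Zp t)) := Measure.isProbabilityMeasure_map (measurable_Zp t).aemeasurable
  exact dynkin_test_of_exp (fun i j => (h.continuous_diffF.matrix_elem i j).measurable) h.measurable_driftF
    (fun z i j => h.bdDiff z i j) (fun z i => h.bdDrift z i) (fun τ θ => hP.integrable_exp_linF h τ θ hrt)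
    (fun τ θ => hP.integrable_exp_linF_occM h τ θ t) (fun τ θ => hP.dynkin_exp h τ θ hrt) hφ

lemma occM_apply {P : Measure (PathSp n r)} [IsFiniteMeasure P] {T : ℝ} {S : Set (SpT n)} (hS : MeasurableSet S) :
    occM r T P S = ∫⁻ v in Set.Ioc r T, P {ω | Zp v ω ∈ S} := by
  rw [occM, Measure.map_apply measurable_Zp_uncurry hS, timeProd, Measure.prod_apply (measurable_Zp_uncurry hS)]
  rfl

/-- Uniform absolute continuity of the occupation measures. -/
lemma occM_uac (h : GoodCoef σ l C) (hdet : ∀ z : SpT n, IsUnit (σ z.1 z.2).det) {T : ℝ} (hrT : r ≤ T) (ρ : ℝ)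
    {ε : ℝ} (hε : 0 < ε) : ∃ R ν : ℝ, 0 < ν ∧ ∀ x : Fin n → ℝ, ‖x‖ ≤ ρ → ∀ (P : Measure (PathSp n r))
      [IsProbabilityMeasure P], SolvesMP n r σ l x P → ∀ V : Set (SpT n), IsOpen V →
        volume (V ∩ Metric.ball 0 R) ≤ ENNReal.ofReal ν → occM r T P V ≤ ENNReal.ofReal ε := by
  set D := Real.exp ((C * 1 + (1 / 2) * (C * 1 ^ 2)) * (T - r)) with hD
  -- the spatial truncation radius
  obtain ⟨R₀, hR₀, hR⟩ : ∃ R₀ : ℝ, 0 ≤ R₀ ∧ (T - r) * (2 * n * (D * Real.exp (-R₀))) ≤ ε / 4 := by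
    have h1 : Tendsto (fun R : ℝ => (T - r) * (2 * n * (D * Real.exp (-R)))) atTop
        (𝓝 ((T - r) * (2 * n * (D * 0)))) :=
      ((Real.tendsto_exp_neg_atTop_nhds_zero.const_mul D).const_mul _).const_mul _
    have h2 : (T - r) * (2 * n * (D * 0)) < ε / 4 := by simp; positivity
    obtain ⟨R, h3, h4⟩ := ((h1.eventually (gt_mem_nhds h2)).and (eventually_ge_atTop 0)).exists
    exact ⟨R, h4, h3.le⟩
  set η := ε / 8 with hη
  set Kc : Set (SpT n) := Set.Icc (r + η) (T - η) ×ˢ Metric.closedBall 0 (ρ + R₀) with hKc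
  have hKcomp : IsCompact Kc := isCompact_Icc.prod (isCompact_closedBall _ _)
  set W : Set (SpT n) := Set.Ioo r T ×ˢ Set.univ with hW
  have hKW : Kc ⊆ W := Set.prod_mono (fun t ht => ⟨by linarith [ht.1], by linarith [ht.2]⟩) (Set.subset_univ _)
  obtain ⟨ν, hν, huac⟩ := uac_compact (isOpen_Ioo.prod isOpen_univ : IsOpen W) (s := fun z => σ z.1 z.2) h.cont hdet
    (B := C) (M := T - r) h.nonneg (by linarith) hKcomp hKW (ε / 2) (by positivity)
  obtain ⟨R, hKR⟩ := hKcomp.isBounded.subset_ball (0 : SpT n)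
  refine ⟨R, ν, hν, fun x hx P _ hP V hV hvol => ?_⟩
  have hmass : (occM r T P).real Set.univ ≤ T - r := by
    rw [Measure.real, occM_apply MeasurableSet.univ]
    simp [hrT]
  have hdyn : ∀ φ, IsTest φ → (∀ z, z ∉ W → φ z = 0) →
      ∫ z, parOp (fun z => σ z.1 z.2 * (σ z.1 z.2)ᵀ) (driftF σ l) φ z ∂(occM r T P) = 0 := by
    intro φ hφ h0
    have h1 := hP.dynkin_test h hrT hφ
    have h2 : ∫ z, φ z ∂(P.map (Zp T)) = 0 := by
      rw [integral_map (measurable_Zp T).aemeasurable hφ.continuous.aestronglyMeasurable]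
      refine integral_eq_zero_of_ae (ae_of_all _ fun ω => h0 _ ?_)
      simp [hW, Zp]
    rw [h2, h0 (r, x) (by simp [hW])] at h1
    rw [sub_zero] at h1
    exact h1.symm
  have hmain := huac (driftF σ l) (occM r T P) hmass h.measurable_driftF (fun z i => h.bdDrift z i) hdyn
    (V ∩ Metric.ball 0 R) (hV.inter Metric.isOpen_ball) hvol
  have hrest : occM r T P Kcᶜ ≤ ENNReal.ofReal (ε / 2) := by
    have hsub : Kcᶜ ⊆ ((Set.Ioo r (r + η) ∪ Set.Ioc (T - η) T) ×ˢ Set.univ) ∪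
        ((Set.Ioc r T)ᶜ ×ˢ Set.univ) ∪ (Set.univ ×ˢ (Metric.closedBall 0 (ρ + R₀))ᶜ) := by
      rintro ⟨t, y⟩ hz
      simp only [hKc, Set.mem_compl_iff, Set.mem_prod, not_and_or, Set.mem_Icc, not_le, Set.mem_union,
        Set.mem_univ, and_true, true_and, Set.mem_Ioo, Set.mem_Ioc] at hz ⊢
      by_cases hy : y ∈ Metric.closedBall 0 (ρ + R₀)
      · left
        by_cases h1 : r < t
        · by_cases h2 : t ≤ T
          · left
            rcases hz with (h3 | h3) | h3
            · exact Or.inl ⟨h1, h3⟩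
            · exact Or.inr ⟨h3, h2⟩
            · exact absurd hy h3
          · exact Or.inr (Or.inr (by simpa using h2))
        · exact Or.inr (Or.inl (by simpa using h1))
      · exact Or.inr hy
    have m1 : MeasurableSet ((Set.Ioo r (r + η) ∪ Set.Ioc (T - η) T) ×ˢ (Set.univ : Set (Fin n → ℝ))) :=
      (measurableSet_Ioo.union measurableSet_Ioc).prod MeasurableSet.univ
    have m2 : MeasurableSet ((Set.Ioc r T)ᶜ ×ˢ (Set.univ : Set (Fin n → ℝ))) :=
      measurableSet_Ioc.compl.prod MeasurableSet.univ
    have m3 : MeasurableSet ((Set.univ : Set ℝ) ×ˢ (Metric.closedBall (0 : Fin n → ℝ) (ρ + R₀))ᶜ) :=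
      MeasurableSet.univ.prod measurableSet_closedBall.compl
    have b1 : occM r T P ((Set.Ioo r (r + η) ∪ Set.Ioc (T - η) T) ×ˢ Set.univ) ≤ ENNReal.ofReal (ε / 4) := by
      have hS : MeasurableSet (Set.Ioo r (r + η) ∪ Set.Ioc (T - η) T) := measurableSet_Ioo.union measurableSet_Ioc
      rw [occM_apply m1]
      calc _ ≤ ∫⁻ v in Set.Ioc r T, (Set.Ioo r (r + η) ∪ Set.Ioc (T - η) T).indicator 1 v := by
            refine lintegral_mono fun v => ?_
            by_cases hv : v ∈ Set.Ioo r (r + η) ∪ Set.Ioc (T - η) T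
            · rw [Set.indicator_of_mem hv]; exact prob_le_one
            · rw [Set.indicator_of_notMem hv]
              have : {ω : PathSp n r | Zp v ω ∈ (Set.Ioo r (r + η) ∪ Set.Ioc (T - η) T) ×ˢ
                  (Set.univ : Set (Fin n → ℝ))} = ∅ :=
                Set.eq_empty_of_forall_notMem fun ω hω => hv hω.1
              rw [this]; simp
        _ ≤ volume (Set.Ioo r (r + η) ∪ Set.Ioc (T - η) T) := by
            rw [lintegral_indicator_one hS]; exact Measure.restrict_apply_le _ _
        _ ≤ ENNReal.ofReal η + ENNReal.ofReal η := by
            refine (measure_union_le _ _).trans (add_le_add ?_ ?_) <;> simp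
        _ = _ := by
            have : 0 ≤ η := by positivity
            rw [← ENNReal.ofReal_add this this]; congr 1; rw [hη]; ring
    have b2 : occM r T P ((Set.Ioc r T)ᶜ ×ˢ Set.univ) = 0 := by
      rw [occM_apply m2]
      refine (setLIntegral_congr_fun measurableSet_Ioc fun v hv => ?_).trans lintegral_zero
      have : {ω : PathSp n r | Zp v ω ∈ (Set.Ioc r T)ᶜ ×ˢ (Set.univ : Set (Fin n → ℝ))} = ∅ :=
        Set.eq_empty_of_forall_notMem fun ω hω => hω.1 hv
      simp only [this, measure_empty]
    have b3 : occM r T P (Set.univ ×ˢ (Metric.closedBall 0 (ρ + R₀))ᶜ) ≤ ENNReal.ofReal (ε / 4) := by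
      rw [occM_apply m3]
      calc _ ≤ ∫⁻ v in Set.Ioc r T, ENNReal.ofReal (2 * n * (D * Real.exp (-R₀))) := by
            refine setLIntegral_mono' measurableSet_Ioc fun v hv => ?_
            have ht := hP.incr_tail h le_rfl hv.1.le one_pos hR₀
            have hle : P {ω | Zp v ω ∈ (Set.univ : Set ℝ) ×ˢ (Metric.closedBall (0 : Fin n → ℝ) (ρ + R₀))ᶜ} ≤
                P {ω | R₀ < ‖Xcan n r v ω - Xcan n r r ω‖} := by
              refine measure_mono_ae ?_
              filter_upwards [hP.ae_start] with ω hω hmem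
              have h1 : ρ + R₀ < ‖Xcan n r v ω‖ := by
                have := hmem.2
                simpa [Zp] using this
              have h2 := norm_sub_norm_le (Xcan n r v ω) (Xcan n r r ω)
              rw [hω] at h2
              change R₀ < ‖Xcan n r v ω - Xcan n r r ω‖
              rw [hω]
              linarith
            refine hle.trans (ht.trans (ENNReal.ofReal_le_ofReal ?_))
            refine mul_le_mul_of_nonneg_left ?_ (by positivity)
            rw [hD, ← Real.exp_add, Real.exp_le_exp]
            have hC := h.nonneg
            have := mul_le_mul_of_nonneg_left (sub_le_sub_right hv.2 r)
              (by positivity : 0 ≤ C * 1 + (1 / 2) * (C * 1 ^ 2))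
            linarith
        _ = ENNReal.ofReal ((T - r) * (2 * n * (D * Real.exp (-R₀)))) := by
            rw [setLIntegral_const, Real.volume_Ioc, mul_comm, ← ENNReal.ofReal_mul (by linarith)]
        _ ≤ _ := ENNReal.ofReal_le_ofReal hR
    refine (measure_mono hsub).trans ((measure_union_le _ _).trans ((add_le_add_left (measure_union_le _ _) _).trans ?_))
    rw [b2, add_zero]
    refine (add_le_add b1 b3).trans ?_
    rw [← ENNReal.ofReal_add (by positivity) (by positivity)]
    exact ENNReal.ofReal_le_ofReal (by linarith)
  have hsplit : V ⊆ ((V ∩ Metric.ball 0 R) ∩ Kc) ∪ Kcᶜ := fun z hz => by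
    by_cases hk : z ∈ Kc
    · exact Or.inl ⟨⟨hz, hKR hk⟩, hk⟩
    · exact Or.inr hk
  refine (measure_mono hsplit).trans ((measure_union_le _ _).trans ((add_le_add hmain hrest).trans ?_))
  rw [← ENNReal.ofReal_add (by positivity) (by positivity)]
  exact ENNReal.ofReal_le_ofReal (by linarith)
end uac

section chaining
variable {E : Type*} [NormedAddCommGroup E]

lemma grid_walk {f : ℝ → E} {h c : ℝ} {L : ℕ}
    (hf : ∀ k : ℕ, k < L → ‖f ((k + 1 : ℕ) * h) - f (k * h)‖ ≤ c) (a d : ℕ) (had : a + d ≤ L) :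
    ‖f ((a + d : ℕ) * h) - f (a * h)‖ ≤ d * c := by
  induction d with
  | zero => simp
  | succ d ih =>
    have h1 := ih (by omega)
    have h2 := hf (a + d) (by omega)
    calc _ = ‖(f ((a + d + 1 : ℕ) * h) - f ((a + d : ℕ) * h)) + (f ((a + d : ℕ) * h) - f (a * h))‖ := by
          rw [sub_add_sub_cancel]; rfl
      _ ≤ c + d * c := (norm_add_le _ _).trans (add_le_add h2 h1)
      _ = _ := by push_cast; ring

/-- Dyadic-type chaining with mesh sizes `16⁻ᵐ`. -/
lemma chaining_modulus {f : ℝ → E} (hfc : Continuous f) {N m₀ : ℕ}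
    (hf : ∀ m, m₀ ≤ m → ∀ k : ℕ, k < N * 16 ^ m →
      ‖f ((k + 1 : ℕ) * ((1 : ℝ) / 16 ^ m)) - f (k * ((1 : ℝ) / 16 ^ m))‖ ≤ (1 / 2) ^ m) {m : ℕ} (hm : m₀ ≤ m)
    {u v : ℝ} (hu : 0 ≤ u) (huv : u ≤ v) (hv : v ≤ N) (hd : v - u ≤ 1 / 16 ^ m) :
    ‖f v - f u‖ ≤ 31 * (1 / 2) ^ m := by
  have key : ∀ w : ℝ, 0 ≤ w → w ≤ N → ‖f w - f (⌊w * 16 ^ m⌋₊ * ((1 : ℝ) / 16 ^ m))‖ ≤ 15 * (1 / 2) ^ m := by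
    intro w hw0 hwN
    have hstep : ∀ j : ℕ, ‖f (⌊w * 16 ^ (m + j)⌋₊ * ((1 : ℝ) / 16 ^ (m + j))) -
        f (⌊w * 16 ^ m⌋₊ * ((1 : ℝ) / 16 ^ m))‖ ≤ 15 * ((1 / 2) ^ m - (1 / 2) ^ (m + j)) := by
      intro j
      induction j with
      | zero => simp
      | succ j ih =>
        set M := m + j with hM
        set p := ⌊w * 16 ^ M⌋₊ with hp
        set q := ⌊w * 16 ^ (M + 1)⌋₊ with hq
        have hpos : 0 ≤ w * 16 ^ M := by positivity
        have hpos' : 0 ≤ w * 16 ^ (M + 1) := by positivity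
        have hpq : 16 * p ≤ q := by
          rw [hq, Nat.le_floor_iff hpos']
          have := Nat.floor_le hpos
          push_cast
          rw [pow_succ]; rw [← hp] at this; linarith
        have hqp : q < 16 * p + 16 := by
          rw [hq, Nat.floor_lt hpos']
          have := Nat.lt_floor_add_one (w * 16 ^ M)
          push_cast
          rw [pow_succ]; rw [← hp] at this; linarith
        have hqN : q ≤ N * 16 ^ (M + 1) := by
          have : (q : ℝ) ≤ ((N * 16 ^ (M + 1) : ℕ) : ℝ) := by
            refine (Nat.floor_le hpos').trans ?_
            push_cast
            exact mul_le_mul_of_nonneg_right hwN (by positivity)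
          exact_mod_cast this
        obtain ⟨d, hd⟩ := Nat.exists_eq_add_of_le hpq
        have h1 := grid_walk (f := f) (hf (M + 1) (by omega)) (16 * p) d (by omega)
        rw [← hd] at h1
        have e : ((16 * p : ℕ) : ℝ) * ((1 : ℝ) / 16 ^ (M + 1)) = p * ((1 : ℝ) / 16 ^ M) := by
          push_cast; rw [pow_succ]; field_simp
        rw [e] at h1
        have hd15 : (d : ℝ) ≤ 15 := by exact_mod_cast (by omega : d ≤ 15)
        have h2 : (d : ℝ) * (1 / 2) ^ (M + 1) ≤ 15 * (1 / 2) ^ (M + 1) :=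
          mul_le_mul_of_nonneg_right hd15 (by positivity)
        have e2 : m + (j + 1) = M + 1 := by omega
        rw [e2]
        refine (norm_sub_le_norm_sub_add_norm_sub _ (f (p * ((1 : ℝ) / 16 ^ M))) _).trans ?_
        refine (add_le_add (h1.trans h2) ih).trans (le_of_eq ?_)
        rw [pow_succ]; ring
    have hlim : Tendsto (fun j : ℕ => (⌊w * 16 ^ (m + j)⌋₊ : ℝ) * ((1 : ℝ) / 16 ^ (m + j))) atTop (𝓝 w) := by
      have h0 : Tendsto (fun j : ℕ => (1 : ℝ) / 16 ^ (m + j)) atTop (𝓝 0) := by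
        have := (tendsto_pow_atTop_nhds_zero_of_lt_one (by norm_num : (0 : ℝ) ≤ 1 / 16) (by norm_num)).comp
          (tendsto_add_atTop_nat m)
        refine this.congr fun j => ?_
        simp [add_comm]
      refine tendsto_of_tendsto_of_tendsto_of_le_of_le (g := fun j : ℕ => w - (1 : ℝ) / 16 ^ (m + j)) (h := fun _ => w)
        (by simpa using tendsto_const_nhds.sub h0) tendsto_const_nhds (fun j => ?_) (fun j => ?_)
      · have := Nat.lt_floor_add_one (w * 16 ^ (m + j))
        have hp : (0 : ℝ) < 16 ^ (m + j) := by positivity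
        simp only
        rw [mul_one_div, sub_le_iff_le_add, ← add_div, le_div_iff₀ hp]
        exact this.le
      · have := Nat.floor_le (by positivity : 0 ≤ w * 16 ^ (m + j))
        have hp : (0 : ℝ) < 16 ^ (m + j) := by positivity
        simp only
        rw [mul_one_div, div_le_iff₀ hp]
        exact this
    have hl2 := (((hfc.tendsto w).comp hlim).sub_const (f (⌊w * 16 ^ m⌋₊ * ((1 : ℝ) / 16 ^ m)))).norm
    refine le_of_tendsto hl2 (Eventually.of_forall fun j => (hstep j).trans ?_)
    have : (0 : ℝ) ≤ (1 / 2) ^ (m + j) := by positivity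
    linarith
  have hv0 := hu.trans huv
  have hp : (0 : ℝ) < 16 ^ m := by positivity
  set p := ⌊u * 16 ^ m⌋₊ with hpdef
  set q := ⌊v * 16 ^ m⌋₊ with hqdef
  have hpq : p ≤ q := Nat.floor_le_floor (mul_le_mul_of_nonneg_right huv hp.le)
  have hqp : q < p + 2 := by
    rw [hqdef, Nat.floor_lt (by positivity)]
    have h1 := Nat.lt_floor_add_one (u * 16 ^ m)
    rw [le_div_iff₀ hp, sub_mul] at hd
    push_cast
    linarith
  have hqN : q ≤ N * 16 ^ m := by
    have : (q : ℝ) ≤ ((N * 16 ^ m : ℕ) : ℝ) := by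
      refine (Nat.floor_le (by positivity)).trans ?_
      push_cast
      exact mul_le_mul_of_nonneg_right hv hp.le
    exact_mod_cast this
  obtain ⟨d, hd'⟩ := Nat.exists_eq_add_of_le hpq
  have h1 := grid_walk (f := f) (hf m hm) p d (by omega)
  rw [← hd'] at h1
  have hd1 : (d : ℝ) ≤ 1 := by exact_mod_cast (by omega : d ≤ 1)
  have h2 : (d : ℝ) * (1 / 2) ^ m ≤ 1 * (1 / 2) ^ m := mul_le_mul_of_nonneg_right hd1 (by positivity)
  have h3 := key v hv0 hv
  have h4 := key u hu (huv.trans hv)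
  rw [norm_sub_rev] at h4
  have h5 := norm_sub_le_norm_sub_add_norm_sub (f v) (f (q * ((1 : ℝ) / 16 ^ m))) (f u)
  have h6 := norm_sub_le_norm_sub_add_norm_sub (f (q * ((1 : ℝ) / 16 ^ m))) (f (p * ((1 : ℝ) / 16 ^ m))) (f u)
  linarith
end chaining

section compactness
variable {n : ℕ} {r : ℝ}

/-- Functions with a prescribed modulus of continuity on each bounded interval. -/
def modSet (n : ℕ) (r : ℝ) (M : ℕ → ℕ) (ρ : ℝ) : Set (Set.Ici r → Fin n → ℝ) :=
  {g | ‖g ⟨r, le_refl r⟩‖ ≤ ρ ∧ ∀ (N m : ℕ), M N ≤ m → ∀ u v : Set.Ici r, u.1 ≤ v.1 → v.1 ≤ r + N →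
    v.1 - u.1 ≤ 1 / 16 ^ m → ‖g v - g u‖ ≤ 31 * (1 / 2) ^ m}

lemma isClosed_modSet (M : ℕ → ℕ) (ρ : ℝ) : IsClosed (modSet n r M ρ) := by
  have : modSet n r M ρ = {g | ‖g ⟨r, le_refl r⟩‖ ≤ ρ} ∩ ⋂ (N : ℕ) (m : ℕ) (_ : M N ≤ m) (u : Set.Ici r)
      (v : Set.Ici r) (_ : u.1 ≤ v.1) (_ : v.1 ≤ r + N) (_ : v.1 - u.1 ≤ 1 / 16 ^ m),
      {g | ‖g v - g u‖ ≤ 31 * (1 / 2) ^ m} := by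
    ext g; simp only [modSet, Set.mem_ofPred_eq, Set.mem_inter_iff, Set.mem_iInter]
  rw [this]
  refine (isClosed_le (by fun_prop) continuous_const).inter ?_
  refine isClosed_iInter fun N => isClosed_iInter fun m => isClosed_iInter fun _ => isClosed_iInter fun u =>
    isClosed_iInter fun v => isClosed_iInter fun _ => isClosed_iInter fun _ => isClosed_iInter fun _ =>
    isClosed_le (by fun_prop) continuous_const

lemma modSet_bounded (M : ℕ → ℕ) (ρ : ℝ) (u : Set.Ici r) : ∃ B : ℝ, ∀ g ∈ modSet n r M ρ, ‖g u‖ ≤ B := by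
  set N := ⌈u.1 - r⌉₊ + 1 with hN
  set m := M N
  set J := N * 16 ^ m with hJ
  have hJ0 : (0 : ℝ) < J := by
    have : 0 < J := by positivity
    exact_mod_cast this
  have hu0 : 0 ≤ u.1 - r := sub_nonneg.2 u.2
  have huN : u.1 - r ≤ N := (Nat.le_ceil _).trans (by rw [hN]; push_cast; linarith)
  refine ⟨ρ + J * 31, fun g hg => ?_⟩
  have hstep : ∀ j : ℕ, j ≤ J → ∀ hj : r ≤ r + j * ((u.1 - r) / J), ‖g ⟨r + j * ((u.1 - r) / J), hj⟩‖ ≤ ρ + j * 31 := by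
    intro j
    induction j with
    | zero => intro _ hj; simpa using hg.1
    | succ j ih =>
      intro hjJ hj
      have hj' : r ≤ r + j * ((u.1 - r) / J) := by
        have : 0 ≤ j * ((u.1 - r) / J) := by positivity
        linarith
      have h1 := ih (by omega) hj'
      have h2 := hg.2 N m le_rfl ⟨r + j * ((u.1 - r) / J), hj'⟩ ⟨r + (j + 1 : ℕ) * ((u.1 - r) / J), hj⟩ ?_ ?_ ?_
      · have h3 := norm_sub_norm_le (g ⟨r + (j + 1 : ℕ) * ((u.1 - r) / J), hj⟩) (g ⟨r + j * ((u.1 - r) / J), hj'⟩)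
        have h4 : ((1 : ℝ) / 2) ^ m ≤ 1 := pow_le_one₀ (by norm_num) (by norm_num)
        have h5 : ρ + ((j + 1 : ℕ) : ℝ) * 31 = ρ + j * 31 + 31 := by push_cast; ring
        rw [h5]
        linarith
      · have : 0 ≤ (u.1 - r) / J := by positivity
        push_cast
        linarith
      · have h5 : (((j + 1 : ℕ) : ℝ)) * ((u.1 - r) / J) ≤ J * ((u.1 - r) / J) :=
          mul_le_mul_of_nonneg_right (by exact_mod_cast hjJ) (by positivity)
        rw [mul_div_cancel₀ _ hJ0.ne'] at h5
        simp only
        linarith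
      · have : (r + (j + 1 : ℕ) * ((u.1 - r) / J)) - (r + j * ((u.1 - r) / J)) = (u.1 - r) / J := by push_cast; ring
        simp only
        rw [this, div_le_div_iff₀ hJ0 (by positivity), one_mul, hJ]
        push_cast
        exact mul_le_mul_of_nonneg_right huN (by positivity)
  have e : r + (J : ℝ) * ((u.1 - r) / J) = u.1 := by rw [mul_div_cancel₀ _ hJ0.ne']; ring
  have := hstep J le_rfl (by rw [e]; exact u.2)
  convert this using 3
  exact Subtype.ext e.symm

lemma modSet_equicontinuous (M : ℕ → ℕ) (ρ : ℝ) :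
    Equicontinuous (fun g : modSet n r M ρ => (g : Set.Ici r → Fin n → ℝ)) := by
  intro u
  rw [Metric.equicontinuousAt_iff]
  intro ε hε
  set N := ⌈u.1 - r⌉₊ + 1 with hN
  obtain ⟨k, hk⟩ := exists_pow_lt_of_lt_one (by positivity : 0 < ε / 31) (by norm_num : (1 / 2 : ℝ) < 1)
  set m := max (M N) k
  have hm : 31 * ((1 : ℝ) / 2) ^ m < ε := by
    have : ((1 : ℝ) / 2) ^ m ≤ (1 / 2) ^ k := pow_le_pow_of_le_one (by norm_num) (by norm_num) (le_max_right _ _)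
    rw [lt_div_iff₀ (by norm_num)] at hk
    linarith
  have huN : u.1 + 1 ≤ r + N := by
    have := Nat.le_ceil (u.1 - r)
    rw [hN]; push_cast; linarith
  have h16 : (1 : ℝ) / 16 ^ m ≤ 1 := by
    rw [div_le_one (by positivity)]; exact one_le_pow₀ (by norm_num)
  refine ⟨1 / 16 ^ m, by positivity, fun v hv g => ?_⟩
  rw [Subtype.dist_eq, Real.dist_eq, abs_lt] at hv
  rcases le_total u.1 v.1 with huv | huv
  · rw [dist_comm, dist_eq_norm]
    exact (g.2.2 N m (le_max_left _ _) u v huv (by linarith [hv.2]) (by linarith [hv.2])).trans_lt hm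
  · rw [dist_eq_norm]
    exact (g.2.2 N m (le_max_left _ _) v u huv (by linarith [hv.2]) (by linarith [hv.1])).trans_lt hm

lemma isCompact_modSet (M : ℕ → ℕ) (ρ : ℝ) : IsCompact {ω : PathSp n r | (ω : Set.Ici r → Fin n → ℝ) ∈ modSet n r M ρ} := by
  choose B hB using modSet_bounded (n := n) (r := r) M ρ
  refine ArzelaAscoli.isCompact_of_equicontinuous _ ?_ ?_
  · have e : ContinuousMap.toFun '' {ω : PathSp n r | (ω : Set.Ici r → Fin n → ℝ) ∈ modSet n r M ρ} = modSet n r M ρ := by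
      refine Set.Subset.antisymm ?_ fun g hg => ?_
      · rintro _ ⟨ω, hω, rfl⟩; exact hω
      · exact ⟨⟨g, (modSet_equicontinuous M ρ).continuous ⟨g, hg⟩⟩, hg, rfl⟩
    rw [e]
    refine (isCompact_univ_pi fun u => isCompact_closedBall (0 : Fin n → ℝ) (B u)).of_isClosed_subset
      (isClosed_modSet M ρ) fun g hg u _ => ?_
    rw [mem_closedBall_zero_iff]
    exact hB u g hg
  · exact (modSet_equicontinuous M ρ).comp fun ω : {ω : PathSp n r | (ω : Set.Ici r → Fin n → ℝ) ∈ modSet n r M ρ} =>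
      (⟨ω.1, ω.2⟩ : modSet n r M ρ)

lemma mem_modSet_of_grid {ω : PathSp n r} {M : ℕ → ℕ} {ρ : ℝ} (h0 : ‖Xcan n r r ω‖ ≤ ρ)
    (hf : ∀ N m : ℕ, M N ≤ m → ∀ k : ℕ, k < N * 16 ^ m → ‖Xcan n r (r + (k + 1 : ℕ) * ((1 : ℝ) / 16 ^ m)) ω -
      Xcan n r (r + k * ((1 : ℝ) / 16 ^ m)) ω‖ ≤ (1 / 2) ^ m) :
    (ω : Set.Ici r → Fin n → ℝ) ∈ modSet n r M ρ := by
  have e : ∀ u : Set.Ici r, ω u = Xcan n r (r + (u.1 - r)) ω := fun u => by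
    unfold Xcan
    congr 1
    refine Subtype.ext ?_
    have := u.2
    simp only [Set.mem_Ici] at this
    simp [this]
  refine ⟨?_, fun N m hm u v huv hv hd => ?_⟩
  · rw [e]; simpa using h0
  · rw [e, e]
    exact chaining_modulus (f := fun t => Xcan n r (r + t) ω) ((continuous_Xcan_time ω).comp (by fun_prop)) (hf N) hm
      (sub_nonneg.2 u.2) (by linarith) (by linarith) (by linarith)
end compactness

section tightness

variable {n : ℕ} {r : ℝ} {σ : ℝ → (Fin n → ℝ) → Matrix (Fin n) (Fin n) ℝ}
  {l : ℝ → (Fin n → ℝ) → (Fin n → ℝ)} {C : ℝ} [MeasurableSpace (PathSp n r)] [BorelSpace (PathSp n r)]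

lemma sixteen_pow_mul_exp_neg_le (m : ℕ) : (16 : ℝ) ^ m * Real.exp (-2 ^ m) ≤ 120 * (1 / 2) ^ m := by
  have h1 := Real.pow_div_factorial_le_exp ((2 : ℝ) ^ m) (by positivity) 5
  have h2 : (16 : ℝ) ^ m = ((2 : ℝ) ^ m) ^ 4 := by rw [← pow_mul, mul_comm, pow_mul]; norm_num
  have h3 : (0 : ℝ) < 2 ^ m := by positivity
  have h4 : ((Nat.factorial 5 : ℕ) : ℝ) = 120 := by norm_num [Nat.factorial]
  rw [h4] at h1
  rw [Real.exp_neg, h2, one_div, inv_pow, ← div_eq_mul_inv, ← div_eq_mul_inv, div_le_div_iff₀ (Real.exp_pos _) h3]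
  have : ((2 : ℝ) ^ m) ^ 4 * 2 ^ m = ((2 : ℝ) ^ m) ^ 5 := by ring
  rw [this]; linarith

lemma SolvesMP.grid_tail (h : GoodCoef σ l C) {x : Fin n → ℝ} {P : Measure (PathSp n r)} [IsProbabilityMeasure P]
    (hP : SolvesMP n r σ l x P) (N m : ℕ) :
    P {ω | ∃ k : ℕ, k < N * 16 ^ m ∧ (1 / 2) ^ m < ‖Xcan n r (r + (k + 1 : ℕ) * ((1 : ℝ) / 16 ^ m)) ω -
      Xcan n r (r + k * ((1 : ℝ) / 16 ^ m)) ω‖} ≤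
      ENNReal.ofReal (N * (240 * n * Real.exp (3 / 2 * C)) * (1 / 2) ^ m) := by
  have hC := h.nonneg
  have e : {ω : PathSp n r | ∃ k : ℕ, k < N * 16 ^ m ∧ (1 / 2) ^ m < ‖Xcan n r (r + (k + 1 : ℕ) * ((1 : ℝ) / 16 ^ m)) ω -
      Xcan n r (r + k * ((1 : ℝ) / 16 ^ m)) ω‖} = ⋃ k ∈ Finset.range (N * 16 ^ m), {ω | (1 / 2) ^ m <
      ‖Xcan n r (r + (k + 1 : ℕ) * ((1 : ℝ) / 16 ^ m)) ω - Xcan n r (r + k * ((1 : ℝ) / 16 ^ m)) ω‖} := by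
    ext ω; simp
  have hb : ∀ k : ℕ, P {ω | (1 / 2) ^ m < ‖Xcan n r (r + (k + 1 : ℕ) * ((1 : ℝ) / 16 ^ m)) ω -
      Xcan n r (r + k * ((1 : ℝ) / 16 ^ m)) ω‖} ≤ ENNReal.ofReal (2 * n * (Real.exp (3 / 2 * C) * Real.exp (-2 ^ m))) := by
    intro k
    have hk : (0 : ℝ) ≤ k * (1 / 16 ^ m) := by positivity
    have hk' : (0 : ℝ) ≤ 1 / 16 ^ m := by positivity
    refine (hP.incr_tail h (s := r + k * ((1 : ℝ) / 16 ^ m)) (by linarith) (by push_cast; linarith)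
      (c := 4 ^ m) (by positivity) (δ := (1 / 2) ^ m) (by positivity)).trans ?_
    refine ENNReal.ofReal_le_ofReal ?_
    rw [← Real.exp_add]
    refine mul_le_mul_of_nonneg_left (Real.exp_le_exp.2 ?_) (by positivity)
    have e1 : r + (k + 1 : ℕ) * ((1 : ℝ) / 16 ^ m) - (r + k * ((1 : ℝ) / 16 ^ m)) = 1 / 16 ^ m := by push_cast; ring
    have e2 : (4 : ℝ) ^ m * (1 / 2) ^ m = 2 ^ m := by rw [← mul_pow]; norm_num
    have e3 : ((4 : ℝ) ^ m) ^ 2 = 16 ^ m := by rw [← pow_mul, mul_comm, pow_mul]; norm_num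
    have e4 : (4 : ℝ) ^ m * (1 / 16 ^ m) ≤ 1 := by
      rw [mul_one_div, div_le_one (by positivity)]
      exact pow_le_pow_left₀ (by norm_num) (by norm_num) _
    have e5 : (16 : ℝ) ^ m * (1 / 16 ^ m) = 1 := by field_simp
    rw [e1, e2, e3]
    have e6 : (C * 4 ^ m + 1 / 2 * (C * 16 ^ m)) * (1 / 16 ^ m) = C * (4 ^ m * (1 / 16 ^ m)) + 1 / 2 * C * ((16 : ℝ) ^ m * (1 / 16 ^ m)) := by
      ring
    rw [e6, e5]
    nlinarith [mul_le_mul_of_nonneg_left e4 hC]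
  rw [e]
  refine (measure_biUnion_finset_le _ _).trans ((Finset.sum_le_sum fun k _ => hb k).trans ?_)
  rw [Finset.sum_const, Finset.card_range, nsmul_eq_mul, ← ENNReal.ofReal_natCast, ← ENNReal.ofReal_mul (by positivity)]
  refine ENNReal.ofReal_le_ofReal ?_
  have := mul_le_mul_of_nonneg_left (sixteen_pow_mul_exp_neg_le m)
    (show 0 ≤ N * (2 * n * Real.exp (3 / 2 * C)) by positivity)
  push_cast
  nlinarith

lemma SolvesMP.exists_modSet (h : GoodCoef σ l C) (ρ : ℝ) {ε : ℝ} (hε : 0 < ε) :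
    ∃ M : ℕ → ℕ, ∀ x : Fin n → ℝ, ‖x‖ ≤ ρ → ∀ (P : Measure (PathSp n r)) [IsProbabilityMeasure P],
      SolvesMP n r σ l x P →
      P {ω : PathSp n r | (ω : Set.Ici r → Fin n → ℝ) ∈ modSet n r M ρ}ᶜ ≤ ENNReal.ofReal ε := by
  set K := 240 * n * Real.exp (3 / 2 * C) with hK
  have hM : ∀ N : ℕ, ∃ M : ℕ, N * K * (1 / 2) ^ M ≤ ε / 4 * (1 / 2) ^ N := by
    intro N
    have h1 : Tendsto (fun M : ℕ => N * K * (1 / 2 : ℝ) ^ M) atTop (𝓝 (N * K * 0)) :=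
      (tendsto_pow_atTop_nhds_zero_of_lt_one (by norm_num) (by norm_num)).const_mul _
    rw [mul_zero] at h1
    exact ((h1.eventually (gt_mem_nhds (show 0 < ε / 4 * (1 / 2 : ℝ) ^ N by positivity))).exists).imp fun _ hh => hh.le
  choose M hM using hM
  refine ⟨M, fun x hx P _ hP => ?_⟩
  let F : ℕ → ℕ → Set (PathSp n r) := fun N m => {ω | ∃ k : ℕ, k < N * 16 ^ m ∧ (1 / 2) ^ m <
    ‖Xcan n r (r + (k + 1 : ℕ) * ((1 : ℝ) / 16 ^ m)) ω - Xcan n r (r + k * ((1 : ℝ) / 16 ^ m)) ω‖}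
  have hsub : {ω : PathSp n r | (ω : Set.Ici r → Fin n → ℝ) ∈ modSet n r M ρ}ᶜ ⊆
      {ω | Xcan n r r ω = x}ᶜ ∪ ⋃ N : ℕ, ⋃ j : ℕ, F N (M N + j) := by
    intro ω hω
    by_contra hcon
    simp only [Set.mem_union, not_or, Set.mem_compl_iff, not_not, Set.mem_iUnion, not_exists] at hcon
    refine hω (mem_modSet_of_grid ?_ ?_)
    · rw [show Xcan n r r ω = x from hcon.1]; exact hx
    · intro N m hm k hk
      by_contra hlt
      refine hcon.2 N (m - M N) ?_
      rw [Nat.add_sub_cancel' hm]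
      exact ⟨k, hk, not_le.1 hlt⟩
  have h0 : P {ω | Xcan n r r ω = x}ᶜ = 0 := hP.ae_start
  have hF : ∀ N j : ℕ, P (F N (M N + j)) ≤ ENNReal.ofReal (ε / 4) * (2⁻¹ ^ N * 2⁻¹ ^ j) := by
    intro N j
    refine (SolvesMP.grid_tail h hP N (M N + j)).trans ?_
    have e1 : (2⁻¹ : ENNReal) = ENNReal.ofReal (1 / 2) := by
      rw [one_div, ENNReal.ofReal_inv_of_pos (by norm_num)]; norm_num
    rw [e1, ← ENNReal.ofReal_pow (by norm_num), ← ENNReal.ofReal_pow (by norm_num),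
      ← ENNReal.ofReal_mul (by positivity), ← ENNReal.ofReal_mul (by positivity)]
    refine ENNReal.ofReal_le_ofReal ?_
    have h1 := mul_le_mul_of_nonneg_right (hM N) (show (0 : ℝ) ≤ (1 / 2) ^ j by positivity)
    rw [pow_add]
    linarith
  have hg : ∑' j : ℕ, (2⁻¹ : ENNReal) ^ j = 2 := by
    rw [ENNReal.tsum_geometric, ENNReal.one_sub_inv_two, inv_inv]
  calc _ ≤ P ({ω | Xcan n r r ω = x}ᶜ ∪ ⋃ N : ℕ, ⋃ j : ℕ, F N (M N + j)) := measure_mono hsub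
    _ ≤ 0 + ∑' N : ℕ, ∑' j : ℕ, P (F N (M N + j)) := by
      refine (measure_union_le _ _).trans (add_le_add h0.le ?_)
      exact (measure_iUnion_le _).trans (ENNReal.tsum_le_tsum fun N => measure_iUnion_le _)
    _ ≤ 0 + ∑' N : ℕ, ∑' j : ℕ, ENNReal.ofReal (ε / 4) * (2⁻¹ ^ N * 2⁻¹ ^ j) := by
      gcongr; exact hF _ _
    _ = ENNReal.ofReal ε := by
      simp_rw [ENNReal.tsum_mul_left, hg, ENNReal.tsum_mul_right, hg]
      rw [zero_add, show (2 : ENNReal) * 2 = ENNReal.ofReal 4 by norm_num, ← ENNReal.ofReal_mul (by positivity)]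
      congr 1; ring

end tightness

section weakLimits

instance instLocallyCompactSpaceIciSubtype (r : ℝ) : LocallyCompactSpace (Set.Ici r) :=
  isClosed_Ici.isClosedEmbedding_subtypeVal.locallyCompactSpace

variable {n : ℕ} {r : ℝ}

lemma continuous_timeIntegral {f : SpT n → ℝ} (hf : Continuous f) {B : ℝ} (hB : ∀ z, |f z| ≤ B) (s t : ℝ) :
    Continuous fun ω : PathSp n r => ∫ v in Set.Ioc s t, f (Zp v ω) := by
  refine continuous_of_dominated (bound := fun _ => B) (fun ω => ?_) (fun ω => ae_of_all _ fun v => hB _)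
    (integrable_const _) (ae_of_all _ fun v => ?_)
  · exact (hf.measurable.comp (measurable_Zp_time ω)).aestronglyMeasurable
  · exact hf.comp (continuous_const.prodMk (continuous_Xcan_path v))

variable [MeasurableSpace (PathSp n r)] [BorelSpace (PathSp n r)]

lemma integral_occM_eq_iterated {P : Measure (PathSp n r)} [IsProbabilityMeasure P] {T : ℝ} {f : SpT n → ℝ}
    (hf : Measurable f) {B : ℝ} (hB : ∀ z, |f z| ≤ B) :
    ∫ z, f z ∂(occM r T P) = ∫ ω, (∫ v in Set.Ioc r T, f (Zp v ω)) ∂P := by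
  rw [integral_occM hf]
  have hi : Integrable (fun p : ℝ × PathSp n r => f (Zp p.1 p.2)) (timeProd r T P) :=
    Integrable.of_bound (hf.comp measurable_Zp_uncurry).aestronglyMeasurable B (ae_of_all _ fun p => hB _)
  unfold timeProd at hi ⊢
  rw [integral_prod_symm _ hi]

variable {ι : Type*} {F : Filter ι} {μ : ι → ProbabilityMeasure (PathSp n r)} {Q : ProbabilityMeasure (PathSp n r)}

lemma tendsto_integral_of_bdd (hμ : Tendsto μ F (𝓝 Q)) {g : PathSp n r → ℝ} (hg : Continuous g) {B : ℝ}
    (hB : ∀ ω, |g ω| ≤ B) :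
    Tendsto (fun i => ∫ ω, g ω ∂(μ i : Measure (PathSp n r))) F (𝓝 (∫ ω, g ω ∂(Q : Measure (PathSp n r)))) :=
  (ProbabilityMeasure.tendsto_iff_forall_integral_tendsto.1 hμ)
    (BoundedContinuousFunction.ofNormedAddCommGroup g hg B hB)

lemma occM_le_of_tendsto [F.NeBot] (hμ : Tendsto μ F (𝓝 Q)) {T ε : ℝ} (hε : 0 ≤ ε) {V : Set (SpT n)}
    (hV : IsOpen V) (h : ∀ᶠ i in F, occM r T (μ i : Measure (PathSp n r)) V ≤ ENNReal.ofReal ε) :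
    occM r T (Q : Measure (PathSp n r)) V ≤ ENNReal.ofReal ε := by
  by_contra hlt
  obtain ⟨K, hKV, hK, hlt⟩ := hV.exists_lt_isClosed (not_le.1 hlt)
  obtain ⟨f, f0, f1, f01⟩ := exists_continuous_zero_one_of_isClosed hV.isClosed_compl hK
    (Set.disjoint_left.2 fun z hz hz' => hz (hKV hz'))
  have hfB : ∀ z, |f z| ≤ 1 := fun z => abs_le.2 ⟨by linarith [(f01 z).1], (f01 z).2⟩
  have hfi : ∀ P : ProbabilityMeasure (PathSp n r), Integrable f (occM r T (P : Measure (PathSp n r))) := fun P =>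
    Integrable.of_bound f.continuous.aestronglyMeasurable 1 (ae_of_all _ hfB)
  have h1 : Tendsto (fun i => ∫ z, f z ∂(occM r T (μ i : Measure (PathSp n r)))) F
      (𝓝 (∫ z, f z ∂(occM r T (Q : Measure (PathSp n r))))) := by
    simp_rw [integral_occM_eq_iterated f.continuous.measurable hfB]
    refine tendsto_integral_of_bdd hμ (continuous_timeIntegral f.continuous hfB _ _)
      (B := 1 * max (T - r) 0) fun ω => ?_
    rcases le_total r T with hT | hT
    · exact (abs_timeIntegral_le hfB hT ω).trans (by gcongr; exact le_max_left _ _)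
    · simp [Set.Ioc_eq_empty_of_le hT]
  have h2 : ∀ᶠ i in F, ∫ z, f z ∂(occM r T (μ i : Measure (PathSp n r))) ≤ ε := by
    filter_upwards [h] with i hi
    rw [← ENNReal.ofReal_le_ofReal_iff hε, ofReal_integral_eq_lintegral_ofReal (hfi _) (ae_of_all _ fun z => (f01 z).1)]
    refine le_trans ?_ hi
    rw [← lintegral_indicator_one hV.measurableSet]
    refine lintegral_mono fun z => ?_
    by_cases hz : z ∈ V
    · simp only [Set.indicator_of_mem hz, Pi.one_apply]
      exact ENNReal.ofReal_le_one.2 (f01 z).2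
    · simp [f0 hz]
  have h3 := le_of_tendsto h1 h2
  refine absurd hlt (not_lt.2 ?_)
  refine le_trans ?_ (ENNReal.ofReal_le_ofReal h3)
  rw [ofReal_integral_eq_lintegral_ofReal (hfi _) (ae_of_all _ fun z => (f01 z).1),
    ← lintegral_indicator_one hK.measurableSet]
  refine lintegral_mono fun z => ?_
  by_cases hz : z ∈ K
  · simp [f1 hz, hz]
  · simp [hz]

lemma lintegral_le_of_tendsto [F.NeBot] (hμ : Tendsto μ F (𝓝 Q)) {g : PathSp n r → ℝ} (hg : Continuous g)
    (hg0 : ∀ ω, 0 ≤ g ω) {K : ℝ} (hK : 0 ≤ K)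
    (h : ∀ᶠ i in F, ∫⁻ ω, ENNReal.ofReal (g ω) ∂(μ i : Measure (PathSp n r)) ≤ ENNReal.ofReal K) :
    ∫⁻ ω, ENNReal.ofReal (g ω) ∂(Q : Measure (PathSp n r)) ≤ ENNReal.ofReal K := by
  have hb : ∀ (N : ℕ) ω, |min (g ω) N| ≤ N := fun N ω => by
    rw [abs_of_nonneg (le_min (hg0 ω) N.cast_nonneg)]; exact min_le_right _ _
  have hc : ∀ N : ℕ, Continuous fun ω => min (g ω) N := fun N => hg.min continuous_const
  have hi : ∀ (N : ℕ) (P : ProbabilityMeasure (PathSp n r)),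
      Integrable (fun ω => min (g ω) N) (P : Measure (PathSp n r)) := fun N P =>
    Integrable.of_bound (hc N).aestronglyMeasurable N (ae_of_all _ (hb N))
  have h1 : ∀ N : ℕ, ∫⁻ ω, ENNReal.ofReal (min (g ω) N) ∂(Q : Measure (PathSp n r)) ≤ ENNReal.ofReal K := by
    intro N
    rw [← ofReal_integral_eq_lintegral_ofReal (hi N Q) (ae_of_all _ fun ω => le_min (hg0 ω) N.cast_nonneg)]
    refine ENNReal.ofReal_le_ofReal (le_of_tendsto (tendsto_integral_of_bdd hμ (hc N) (hb N)) ?_)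
    filter_upwards [h] with i hi'
    rw [← ENNReal.ofReal_le_ofReal_iff hK,
      ofReal_integral_eq_lintegral_ofReal (hi N _) (ae_of_all _ fun ω => le_min (hg0 ω) N.cast_nonneg)]
    exact (lintegral_mono fun ω => ENNReal.ofReal_le_ofReal (min_le_left _ _)).trans hi'
  have h2 : ∀ ω, liminf (fun N : ℕ => ENNReal.ofReal (min (g ω) N)) atTop = ENNReal.ofReal (g ω) := by
    intro ω
    refine Tendsto.liminf_eq (tendsto_const_nhds.congr' ?_)
    filter_upwards [eventually_ge_atTop ⌈g ω⌉₊] with N hN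
    rw [min_eq_left ((Nat.le_ceil _).trans (by exact_mod_cast hN))]
  calc _ = ∫⁻ ω, liminf (fun N : ℕ => ENNReal.ofReal (min (g ω) N)) atTop ∂(Q : Measure (PathSp n r)) := by
        simp_rw [h2]
    _ ≤ liminf (fun N : ℕ => ∫⁻ ω, ENNReal.ofReal (min (g ω) N) ∂(Q : Measure (PathSp n r))) atTop :=
        lintegral_liminf_le fun N => (hc N).measurable.ennreal_ofReal
    _ ≤ _ := by
        refine (liminf_le_liminf (Eventually.of_forall h1)).trans ?_
        simp

end weakLimits

/-- A Lusin-type approximation: a bounded measurable function is uniformly close to a continuous function with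
the same bound outside an open set which has small volume in a given ball. -/
lemma exists_continuous_near_off_open {n : ℕ} {f : SpT n → ℝ} (hf : Measurable f) {B : ℝ} (hB0 : 0 ≤ B)
    (hB : ∀ z, |f z| ≤ B) (R : ℝ) {ν δ : ℝ} (hν : 0 < ν) (hδ : 0 < δ) :
    ∃ β : SpT n → ℝ, Continuous β ∧ (∀ z, |β z| ≤ B) ∧ ∃ V : Set (SpT n), IsOpen V ∧
      volume (V ∩ Metric.ball 0 R) ≤ ENNReal.ofReal ν ∧ ∀ z, z ∉ V → |f z - β z| ≤ δ := by
  have hKm : MeasurableSet (Metric.closedBall (0 : SpT n) R) := measurableSet_closedBall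
  have hL : MemLp ((Metric.closedBall (0 : SpT n) R).indicator f) 1 volume := by
    rw [memLp_one_iff_integrable, integrable_indicator_iff hKm]
    exact Measure.integrableOn_of_bounded (M := B) (isCompact_closedBall _ _).measure_lt_top.ne
      hf.aestronglyMeasurable (ae_of_all _ hB)
  obtain ⟨g, hg, -⟩ := hL.exists_boundedContinuous_eLpNorm_sub_le ENNReal.one_ne_top
    (ε := ENNReal.ofReal (δ * (ν / 2))) (ENNReal.ofReal_pos.2 (by positivity)).ne'
  set A := {z : SpT n | ENNReal.ofReal δ ≤ ‖((Metric.closedBall (0 : SpT n) R).indicator f - g) z‖ₑ} with hA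
  have hm : AEMeasurable (fun z => ‖((Metric.closedBall (0 : SpT n) R).indicator f - g) z‖ₑ) volume :=
    ((hf.indicator hKm).sub g.continuous.measurable).enorm.aemeasurable
  have hAv : volume A ≤ ENNReal.ofReal (ν / 2) := by
    have h1 := meas_ge_le_lintegral_div hm (ENNReal.ofReal_pos.2 hδ).ne' ENNReal.ofReal_ne_top
    rw [← eLpNorm_one_eq_lintegral_enorm] at h1
    refine h1.trans ?_
    rw [ENNReal.div_le_iff (ENNReal.ofReal_pos.2 hδ).ne' ENNReal.ofReal_ne_top, ← ENNReal.ofReal_mul (by positivity),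
      mul_comm]
    exact hg
  obtain ⟨V₁, hAV, hV₁, hv⟩ := A.exists_isOpen_le_add volume (ENNReal.ofReal_pos.2 (half_pos hν)).ne'
  refine ⟨fun z => max (-B) (min (g z) B), continuous_const.max (g.continuous.min continuous_const), fun z => ?_,
    V₁ ∪ (Metric.closedBall 0 R)ᶜ, hV₁.union Metric.isClosed_closedBall.isOpen_compl, ?_, fun z hz => ?_⟩
  · exact abs_le.2 ⟨le_max_left _ _, max_le (by linarith) (min_le_right _ _)⟩
  · refine (measure_mono (t := V₁) ?_).trans (hv.trans ?_)
    · rintro z ⟨hz | hz, hz'⟩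
      · exact hz
      · exact absurd (Metric.ball_subset_closedBall hz') hz
    · refine (add_le_add_left hAv _).trans ?_
      rw [← ENNReal.ofReal_add (by positivity) (by positivity), add_halves]
  · simp only [Set.mem_union, Set.mem_compl_iff, not_or, not_not] at hz
    have h1 : z ∉ A := fun h => hz.1 (hAV h)
    simp only [hA, Set.mem_ofPred_eq, not_le, Pi.sub_apply, Set.indicator_of_mem hz.2] at h1
    rw [← ofReal_norm, ENNReal.ofReal_lt_ofReal_iff hδ, Real.norm_eq_abs] at h1
    have h2 := abs_le.1 (hB z)
    refine le_trans ?_ h1.le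
    have e : f z = max (-B) (min (f z) B) := by rw [min_eq_left h2.2, max_eq_right h2.1]
    conv_lhs => rw [e]
    refine (abs_max_sub_max_le_max (-B) _ (-B) _).trans ?_
    rw [sub_self, abs_zero]
    refine max_le (abs_nonneg _) ((abs_min_sub_min_le_max _ B _ B).trans ?_)
    simp

lemma abs_exp_sub_exp_le {a b L : ℝ} (ha : |a| ≤ L) (hb : |b| ≤ L) :
    |Real.exp a - Real.exp b| ≤ Real.exp L * |a - b| := by
  have key : ∀ {a b : ℝ}, |a| ≤ L → b ≤ a → |Real.exp a - Real.exp b| ≤ Real.exp L * |a - b| := by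
    intro a b ha hba
    have h1 := Real.add_one_le_exp (b - a)
    have h2 : Real.exp b = Real.exp a * Real.exp (b - a) := by rw [← Real.exp_add]; congr 1; ring
    rw [abs_of_nonneg (sub_nonneg.2 (Real.exp_le_exp.2 hba)), abs_of_nonneg (sub_nonneg.2 hba)]
    calc Real.exp a - Real.exp b ≤ Real.exp a * (a - b) := by
          rw [h2]; nlinarith [Real.exp_pos a]
      _ ≤ _ := mul_le_mul_of_nonneg_right (Real.exp_le_exp.2 ((le_abs_self a).trans ha)) (sub_nonneg.2 hba)
  rcases le_total b a with h | h
  · exact key ha h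
  · rw [abs_sub_comm, abs_sub_comm a b]; exact key hb h

lemma abs_truncated_exp_sub_le {g Φ N I J L : ℝ} (hg : |g| ≤ 1) (hΦ : 0 < Φ) (hN : 0 < N) (hI : |I| ≤ L)
    (hJ : |J| ≤ L) :
    |g * (Φ * Real.exp (-I)) - g * (min Φ N * Real.exp (-J))| ≤
      Real.exp L / N * Φ ^ 2 + N * Real.exp L * |I - J| := by
  have h1 : |Real.exp (-I) - Real.exp (-J)| ≤ Real.exp L * |I - J| := by
    have := abs_exp_sub_exp_le (a := -I) (b := -J) (L := L) (by rwa [abs_neg]) (by rwa [abs_neg])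
    rwa [show -I - -J = -(I - J) by ring, abs_neg] at this
  have h2 : 0 ≤ Φ - min Φ N := sub_nonneg.2 (min_le_left _ _)
  have h3 : Φ - min Φ N ≤ Φ ^ 2 / N := by
    rcases le_total Φ N with h | h
    · rw [min_eq_left h, sub_self]; positivity
    · rw [min_eq_right h, le_div_iff₀ hN]; nlinarith
  have h4 : Real.exp (-I) ≤ Real.exp L := Real.exp_le_exp.2 ((neg_le_abs I).trans hI)
  have h5 : 0 ≤ min Φ N := le_min hΦ.le hN.le
  have e : g * (Φ * Real.exp (-I)) - g * (min Φ N * Real.exp (-J)) =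
      g * ((Φ - min Φ N) * Real.exp (-I) + min Φ N * (Real.exp (-I) - Real.exp (-J))) := by ring
  rw [e, abs_mul]
  calc _ ≤ 1 * (|(Φ - min Φ N) * Real.exp (-I)| + |min Φ N * (Real.exp (-I) - Real.exp (-J))|) :=
        mul_le_mul hg (abs_add_le _ _) (abs_nonneg _) zero_le_one
    _ = (Φ - min Φ N) * Real.exp (-I) + min Φ N * |Real.exp (-I) - Real.exp (-J)| := by
        rw [one_mul, abs_mul, abs_mul, abs_of_nonneg h2, abs_of_pos (Real.exp_pos _), abs_of_nonneg h5]
    _ ≤ Φ ^ 2 / N * Real.exp L + N * (Real.exp L * |I - J|) :=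
        add_le_add (mul_le_mul h3 h4 (Real.exp_pos _).le (by positivity))
          (mul_le_mul (min_le_right _ _) h1 (abs_nonneg _) hN.le)
    _ = _ := by ring

section limits

variable {n : ℕ} {r : ℝ} {σ : ℝ → (Fin n → ℝ) → Matrix (Fin n) (Fin n) ℝ}
  {l : ℝ → (Fin n → ℝ) → (Fin n → ℝ)} {C : ℝ}

/-- The exponential process without its normalisation at the starting point. -/
noncomputable def expW (σ : ℝ → (Fin n → ℝ) → Matrix (Fin n) (Fin n) ℝ)
    (l : ℝ → (Fin n → ℝ) → (Fin n → ℝ)) (θ : Fin n → ℝ) (u : ℝ) (ω : PathSp n r) : ℝ :=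
  Real.exp (θ ⬝ᵥ Xcan n r u ω) * Real.exp (-∫ v in Set.Ioc r u, expRate σ l θ (Zp v ω))

lemma GoodCoef.MexpP_eq_expW (h : GoodCoef σ l C) (x θ : Fin n → ℝ) (u : ℝ) (ω : PathSp n r) :
    MexpP n r σ l x θ u ω = Real.exp (-(θ ⬝ᵥ x)) * expW σ l θ u ω := by
  rw [h.MexpP_eq, expW, ← Real.exp_add, ← Real.exp_add, dotProduct_sub]
  congr 1; ring

lemma continuous_dot_Xcan (θ : Fin n → ℝ) (u : ℝ) : Continuous fun ω : PathSp n r => θ ⬝ᵥ Xcan n r u ω :=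
  continuous_const.dotProduct (continuous_Xcan_path u)

lemma GoodCoef.expW_le (h : GoodCoef σ l C) (θ : Fin n → ℝ) {u : ℝ} (hu : r ≤ u) (ω : PathSp n r) :
    expW σ l θ u ω ≤ Real.exp (rateBd C θ * (u - r)) * (1 + Real.exp (θ ⬝ᵥ Xcan n r u ω) ^ 2) := by
  have h1 := abs_timeIntegral_le (h.abs_expRate_le θ) hu ω
  have h2 : Real.exp (-∫ v in Set.Ioc r u, expRate σ l θ (Zp v ω)) ≤ Real.exp (rateBd C θ * (u - r)) :=
    Real.exp_le_exp.2 ((neg_le_abs _).trans h1)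
  have h3 : Real.exp (θ ⬝ᵥ Xcan n r u ω) ≤ 1 + Real.exp (θ ⬝ᵥ Xcan n r u ω) ^ 2 := by
    nlinarith [sq_nonneg (Real.exp (θ ⬝ᵥ Xcan n r u ω) - 1), sq_nonneg (Real.exp (θ ⬝ᵥ Xcan n r u ω))]
  rw [expW, mul_comm]
  exact mul_le_mul h2 h3 (Real.exp_pos _).le (Real.exp_pos _).le

lemma expW_pos (θ : Fin n → ℝ) (u : ℝ) (ω : PathSp n r) : 0 < expW σ l θ u ω :=
  mul_pos (Real.exp_pos _) (Real.exp_pos _)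

/-- A bounded continuous substitute for `g * expW`. -/
noncomputable def expWApprox (β : SpT n → ℝ) (g : PathSp n r → ℝ) (N : ℝ) (θ : Fin n → ℝ) (u : ℝ)
    (ω : PathSp n r) : ℝ :=
  g ω * (min (Real.exp (θ ⬝ᵥ Xcan n r u ω)) N * Real.exp (-∫ v in Set.Ioc r u, β (Zp v ω)))

lemma continuous_expWApprox {β : SpT n → ℝ} (hβ : Continuous β) {B : ℝ} (hB : ∀ z, |β z| ≤ B)
    {g : PathSp n r → ℝ} (hg : Continuous g) (N : ℝ) (θ : Fin n → ℝ) (u : ℝ) :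
    Continuous (expWApprox β g N θ u) :=
  hg.mul (((Real.continuous_exp.comp (continuous_dot_Xcan θ u)).min continuous_const).mul
    (Real.continuous_exp.comp (continuous_timeIntegral hβ hB r u).neg))

lemma abs_expWApprox_le {β : SpT n → ℝ} {B : ℝ} (hB : ∀ z, |β z| ≤ B) {g : PathSp n r → ℝ}
    (hg1 : ∀ ω, |g ω| ≤ 1) {N : ℝ} (hN : 0 < N) (θ : Fin n → ℝ) {u : ℝ} (hu : r ≤ u) (ω : PathSp n r) :
    |expWApprox β g N θ u ω| ≤ N * Real.exp (B * (u - r)) := by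
  have h1 := abs_timeIntegral_le hB hu ω
  have h5 : 0 ≤ min (Real.exp (θ ⬝ᵥ Xcan n r u ω)) N := le_min (Real.exp_pos _).le hN.le
  rw [expWApprox, abs_mul, abs_mul, abs_of_nonneg h5, abs_of_pos (Real.exp_pos _)]
  calc _ ≤ 1 * (N * Real.exp (B * (u - r))) :=
        mul_le_mul (hg1 ω) (mul_le_mul (min_le_right _ _) (Real.exp_le_exp.2 ((neg_le_abs _).trans h1))
          (Real.exp_pos _).le hN.le) (mul_nonneg h5 (Real.exp_pos _).le) zero_le_one
    _ = _ := one_mul _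

variable [MeasurableSpace (PathSp n r)] [BorelSpace (PathSp n r)]

lemma GoodCoef.measurable_expW (h : GoodCoef σ l C) (θ : Fin n → ℝ) (u : ℝ) :
    Measurable (expW (r := r) σ l θ u) := by
  have : expW (r := r) σ l θ u = MexpP n r σ l 0 θ u := by
    funext ω; simp [h.MexpP_eq_expW]
  rw [this]; exact h.measurable_MexpP 0 θ u

lemma occM_univ {P : Measure (PathSp n r)} [IsProbabilityMeasure P] (T : ℝ) :
    occM r T P Set.univ = ENNReal.ofReal (T - r) := by
  rw [occM_apply MeasurableSet.univ]; simp

lemma integral_abs_timeIntegral_sub_le {P : Measure (PathSp n r)} [IsProbabilityMeasure P] {T : ℝ} (hT : r ≤ T)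
    {f β : SpT n → ℝ} (hf : Measurable f) (hβ : Measurable β) {B δ : ℝ} (hδ : 0 ≤ δ)
    (hfB : ∀ z, |f z| ≤ B) (hβB : ∀ z, |β z| ≤ B) {V : Set (SpT n)} (hV : MeasurableSet V)
    (hfβ : ∀ z, z ∉ V → |f z - β z| ≤ δ) :
    ∫ ω, |(∫ v in Set.Ioc r T, f (Zp v ω)) - ∫ v in Set.Ioc r T, β (Zp v ω)| ∂P ≤
      δ * (T - r) + 2 * B * (occM r T P V).toReal := by
  have hd : ∀ z, |(|f z - β z|)| ≤ 2 * B := fun z => by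
    rw [abs_abs]; exact (abs_sub _ _).trans (by linarith [hfB z, hβB z])
  have hdm : Measurable fun z => |f z - β z| := (hf.sub hβ).abs
  have hm1 := measurable_timeIntegral (Ω := PathSp n r) continuous_Xcan_time measurable_Xcan hf (Set.Ioc r T)
  have hm2 := measurable_timeIntegral (Ω := PathSp n r) continuous_Xcan_time measurable_Xcan hβ (Set.Ioc r T)
  have hm3 := measurable_timeIntegral (Ω := PathSp n r) continuous_Xcan_time measurable_Xcan hdm (Set.Ioc r T)
  have hI : Integrable (fun ω => ∫ v in Set.Ioc r T, |f (Zp v ω) - β (Zp v ω)|) P :=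
    Integrable.of_bound hm3.aestronglyMeasurable (2 * B * (T - r)) (ae_of_all _ fun ω => abs_timeIntegral_le hd hT ω)
  have hpt : ∀ ω : PathSp n r, |(∫ v in Set.Ioc r T, f (Zp v ω)) - ∫ v in Set.Ioc r T, β (Zp v ω)| ≤
      ∫ v in Set.Ioc r T, |f (Zp v ω) - β (Zp v ω)| := fun ω => by
    rw [← integral_sub (integrableOn_time hf hfB r T ω) (integrableOn_time hβ hβB r T ω)]
    exact abs_integral_le_integral_abs
  calc _ ≤ ∫ ω, (∫ v in Set.Ioc r T, |f (Zp v ω) - β (Zp v ω)|) ∂P :=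
        integral_mono_of_nonneg (ae_of_all _ fun ω => abs_nonneg _) hI (ae_of_all _ hpt)
    _ = ∫ z, |f z - β z| ∂(occM r T P) := (integral_occM_eq_iterated hdm hd).symm
    _ ≤ ∫ z, (δ + V.indicator (fun _ => 2 * B) z) ∂(occM r T P) := by
        refine integral_mono (Integrable.of_bound hdm.aestronglyMeasurable (2 * B) (ae_of_all _ hd))
          ((integrable_const _).fun_add ((integrable_const _).indicator hV)) fun z => ?_
        by_cases hz : z ∈ V
        · simp only [Set.indicator_of_mem hz]
          linarith [(le_abs_self _).trans (hd z)]
        · simp only [Set.indicator_of_notMem hz, add_zero]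
          exact hfβ z hz
    _ = _ := by
        rw [integral_add (integrable_const _) ((integrable_const _).indicator hV), integral_const,
          integral_indicator_const _ hV, Measure.real, Measure.real, occM_univ, ENNReal.toReal_ofReal (sub_nonneg.2 hT)]
        simp only [smul_eq_mul]; ring

lemma integrable_sq_exp_dot {P : Measure (PathSp n r)} {θ : Fin n → ℝ} {u K : ℝ}
    (hK : ∫⁻ ω, ENNReal.ofReal (Real.exp (θ ⬝ᵥ Xcan n r u ω) ^ 2) ∂P ≤ ENNReal.ofReal K) :
    Integrable (fun ω => Real.exp (θ ⬝ᵥ Xcan n r u ω) ^ 2) P := by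
  refine ⟨((Real.continuous_exp.comp (continuous_dot_Xcan θ u)).pow 2).aestronglyMeasurable, ?_⟩
  rw [hasFiniteIntegral_iff_ofReal (ae_of_all _ fun ω => by positivity)]
  exact hK.trans_lt ENNReal.ofReal_lt_top

lemma GoodCoef.integrable_expW (h : GoodCoef σ l C) {P : Measure (PathSp n r)} [IsProbabilityMeasure P]
    {θ : Fin n → ℝ} {u K : ℝ} (hu : r ≤ u)
    (hK : ∫⁻ ω, ENNReal.ofReal (Real.exp (θ ⬝ᵥ Xcan n r u ω) ^ 2) ∂P ≤ ENNReal.ofReal K) :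
    Integrable (expW σ l θ u) P := by
  refine (((integrable_const (1 : ℝ)).fun_add (integrable_sq_exp_dot hK)).const_mul
    (Real.exp (rateBd C θ * (u - r)))).mono' (h.measurable_expW θ u).aestronglyMeasurable (ae_of_all _ fun ω => ?_)
  rw [Real.norm_eq_abs, abs_of_pos (expW_pos θ u ω)]
  exact h.expW_le θ hu ω

lemma GoodCoef.abs_integral_expW_sub_le (h : GoodCoef σ l C) {P : Measure (PathSp n r)} [IsProbabilityMeasure P]
    {θ : Fin n → ℝ} {u K : ℝ} (hu : r ≤ u) (hK0 : 0 ≤ K)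
    (hK : ∫⁻ ω, ENNReal.ofReal (Real.exp (θ ⬝ᵥ Xcan n r u ω) ^ 2) ∂P ≤ ENNReal.ofReal K)
    {g : PathSp n r → ℝ} (hg : Continuous g) (hg1 : ∀ ω, |g ω| ≤ 1) {N : ℝ} (hN : 0 < N)
    {β : SpT n → ℝ} (hβ : Continuous β) (hβB : ∀ z, |β z| ≤ rateBd C θ) {δ : ℝ} (hδ : 0 ≤ δ)
    {V : Set (SpT n)} (hV : MeasurableSet V) (hfβ : ∀ z, z ∉ V → |expRate σ l θ z - β z| ≤ δ) :
    |∫ ω, g ω * expW σ l θ u ω ∂P - ∫ ω, expWApprox β g N θ u ω ∂P| ≤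
      Real.exp (rateBd C θ * (u - r)) / N * K + N * Real.exp (rateBd C θ * (u - r)) *
        (δ * (u - r) + 2 * rateBd C θ * (occM r u P V).toReal) := by
  set L := rateBd C θ * (u - r) with hL
  have hsq := integrable_sq_exp_dot hK
  have hKi : ∫ ω, Real.exp (θ ⬝ᵥ Xcan n r u ω) ^ 2 ∂P ≤ K := by
    rw [← ENNReal.ofReal_le_ofReal_iff hK0, ofReal_integral_eq_lintegral_ofReal hsq (ae_of_all _ fun ω => by positivity)]
    exact hK
  have hm1 := measurable_timeIntegral (Ω := PathSp n r) continuous_Xcan_time measurable_Xcan (h.measurable_expRate θ)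
    (Set.Ioc r u)
  have hm2 := measurable_timeIntegral (Ω := PathSp n r) continuous_Xcan_time measurable_Xcan hβ.measurable (Set.Ioc r u)
  have hDi : Integrable (fun ω => |(∫ v in Set.Ioc r u, expRate σ l θ (Zp v ω)) - ∫ v in Set.Ioc r u, β (Zp v ω)|) P :=
    Integrable.of_bound (hm1.sub hm2).abs.aestronglyMeasurable (L + L) (ae_of_all _ fun ω => by
      rw [Real.norm_eq_abs, abs_abs]
      exact (abs_sub _ _).trans (add_le_add (abs_timeIntegral_le (h.abs_expRate_le θ) hu ω) (abs_timeIntegral_le hβB hu ω)))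
  have hgW : Integrable (fun ω => g ω * expW σ l θ u ω) P :=
    (h.integrable_expW hu hK).bdd_mul hg.aestronglyMeasurable (ae_of_all _ hg1)
  have hA : Integrable (expWApprox β g N θ u) P :=
    Integrable.of_bound (continuous_expWApprox hβ hβB hg N θ u).aestronglyMeasurable _
      (ae_of_all _ fun ω => abs_expWApprox_le hβB hg1 hN θ hu ω)
  rw [← integral_sub hgW hA, ← Real.norm_eq_abs]
  calc _ ≤ ∫ ω, (Real.exp L / N * Real.exp (θ ⬝ᵥ Xcan n r u ω) ^ 2 + N * Real.exp L *
        |(∫ v in Set.Ioc r u, expRate σ l θ (Zp v ω)) - ∫ v in Set.Ioc r u, β (Zp v ω)|) ∂P :=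
        norm_integral_le_of_norm_le ((hsq.const_mul _).fun_add (hDi.const_mul _)) (ae_of_all _ fun ω =>
          abs_truncated_exp_sub_le (hg1 ω) (Real.exp_pos _) hN (abs_timeIntegral_le (h.abs_expRate_le θ) hu ω)
            (abs_timeIntegral_le hβB hu ω))
    _ = Real.exp L / N * ∫ ω, Real.exp (θ ⬝ᵥ Xcan n r u ω) ^ 2 ∂P + N * Real.exp L *
        ∫ ω, |(∫ v in Set.Ioc r u, expRate σ l θ (Zp v ω)) - ∫ v in Set.Ioc r u, β (Zp v ω)| ∂P := by
        rw [integral_add (hsq.const_mul _) (hDi.const_mul _), integral_const_mul, integral_const_mul]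
    _ ≤ _ := by
        exact add_le_add (mul_le_mul_of_nonneg_left hKi (by positivity)) (mul_le_mul_of_nonneg_left
          (integral_abs_timeIntegral_sub_le hu (h.measurable_expRate θ) hβ.measurable hδ
            (h.abs_expRate_le θ) hβB hV hfβ) (by positivity))

end limits

section limitIdentification

variable {n : ℕ} {r : ℝ} {σ : ℝ → (Fin n → ℝ) → Matrix (Fin n) (Fin n) ℝ}
  {l : ℝ → (Fin n → ℝ) → (Fin n → ℝ)} {C : ℝ} [MeasurableSpace (PathSp n r)] [BorelSpace (PathSp n r)]
  {ι : Type*} {F : Filter ι} {μ : ι → ProbabilityMeasure (PathSp n r)} {Q : ProbabilityMeasure (PathSp n r)}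
  {y : ι → Fin n → ℝ} {x₀ : Fin n → ℝ}

lemma eventually_lintegral_sq_exp_le (h : GoodCoef σ l C) (hy : Tendsto y F (𝓝 x₀))
    (hsol : ∀ i, SolvesMP n r σ l (y i) (μ i : Measure (PathSp n r))) (θ : Fin n → ℝ) {u : ℝ} (hu : r ≤ u) :
    ∃ K : ℝ, 0 ≤ K ∧ ∀ᶠ i in F, ∫⁻ ω, ENNReal.ofReal (Real.exp (θ ⬝ᵥ Xcan n r u ω) ^ 2)
      ∂(μ i : Measure (PathSp n r)) ≤ ENNReal.ofReal K := by
  refine ⟨Real.exp ((((2 : ℝ) • θ) ⬝ᵥ x₀ + 1) + rateBd C ((2 : ℝ) • θ) * (u - r)), (Real.exp_pos _).le, ?_⟩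
  have hc : Continuous fun z : Fin n → ℝ => ((2 : ℝ) • θ) ⬝ᵥ z := continuous_const.dotProduct continuous_id
  have h1 := ((hc.tendsto x₀).comp hy).eventually (gt_mem_nhds (lt_add_one (((2 : ℝ) • θ) ⬝ᵥ x₀)))
  filter_upwards [h1] with i hi
  have h2 := (hsol i).lintegral_exp_linF_le h 0 ((2 : ℝ) • θ) hu le_rfl
  have e : ∀ ω : PathSp n r, Real.exp (θ ⬝ᵥ Xcan n r u ω) ^ 2 = Real.exp (linF 0 ((2 : ℝ) • θ) (Zp u ω)) := fun ω => by
    rw [← Real.exp_nat_mul]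
    simp [linF, Zp, smul_dotProduct]
  simp_rw [e]
  refine h2.trans (ENNReal.ofReal_le_ofReal (Real.exp_le_exp.2 ?_))
  simp only [Function.comp_apply] at hi
  simp only [linF, zero_mul, zero_add, abs_zero]
  linarith

lemma tendsto_integral_expW [F.NeBot] (h : GoodCoef σ l C) (hdet : ∀ z : SpT n, IsUnit (σ z.1 z.2).det)
    (hμ : Tendsto μ F (𝓝 Q)) (hy : Tendsto y F (𝓝 x₀))
    (hsol : ∀ i, SolvesMP n r σ l (y i) (μ i : Measure (PathSp n r))) (θ : Fin n → ℝ) {u : ℝ} (hu : r ≤ u)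
    {g : PathSp n r → ℝ} (hg : Continuous g) (hg1 : ∀ ω, |g ω| ≤ 1) :
    Tendsto (fun i => ∫ ω, g ω * expW σ l θ u ω ∂(μ i : Measure (PathSp n r))) F
      (𝓝 (∫ ω, g ω * expW σ l θ u ω ∂(Q : Measure (PathSp n r)))) := by
  obtain ⟨K, hK0, hK⟩ := eventually_lintegral_sq_exp_le h hy hsol θ hu
  have hKQ := lintegral_le_of_tendsto hμ ((Real.continuous_exp.comp (continuous_dot_Xcan θ u)).pow 2)
    (fun ω => sq_nonneg _) hK0 hK
  set L := rateBd C θ * (u - r) with hL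
  have hB := h.rateBd_nonneg θ
  rw [Metric.tendsto_nhds]
  intro η hη
  set N := Real.exp L * K / (η / 8) + 1 with hN
  have hN0 : 0 < N := by positivity
  have hN1 : Real.exp L / N * K ≤ η / 8 := by
    rw [div_mul_eq_mul_div, div_le_iff₀ hN0, hN, mul_add, mul_div_cancel₀ _ (by positivity)]
    linarith
  set D := N * Real.exp L with hD
  have hD0 : 0 < D := by positivity
  set δ := η / (16 * D * (u - r + 1)) with hδ
  have hur : 0 < u - r + 1 := by linarith
  have hδ0 : 0 < δ := by positivity
  have hδ1 : D * (δ * (u - r)) ≤ η / 16 := by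
    rw [hδ, div_mul_eq_mul_div, mul_div_assoc', div_le_iff₀ (by positivity)]
    have : 0 ≤ D * η := by positivity
    nlinarith
  set ε := η / (32 * D * (rateBd C θ + 1)) with hε
  have hε0 : 0 < ε := by positivity
  have hε1 : D * (2 * rateBd C θ * ε) ≤ η / 16 := by
    rw [hε, mul_div_assoc', mul_div_assoc', div_le_iff₀ (by positivity)]
    have : 0 ≤ D * η := by positivity
    nlinarith
  obtain ⟨R, ν, hν, hocc⟩ := occM_uac h hdet hu (‖x₀‖ + 1) hε0
  obtain ⟨β, hβ, hβB, V, hV, hVv, hfβ⟩ := exists_continuous_near_off_open (h.measurable_expRate θ) hB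
    (h.abs_expRate_le θ) R hν hδ0
  have hyρ : ∀ᶠ i in F, ‖y i‖ ≤ ‖x₀‖ + 1 :=
    (hy.norm.eventually (gt_mem_nhds (lt_add_one ‖x₀‖))).mono fun _ hi => hi.le
  have hoi : ∀ᶠ i in F, occM r u (μ i : Measure (PathSp n r)) V ≤ ENNReal.ofReal ε :=
    hyρ.mono fun i hi => hocc _ hi _ (hsol i) V hV hVv
  have hoQ := occM_le_of_tendsto hμ hε0.le hV hoi
  have happ : ∀ P : ProbabilityMeasure (PathSp n r),
      ∫⁻ ω, ENNReal.ofReal (Real.exp (θ ⬝ᵥ Xcan n r u ω) ^ 2) ∂(P : Measure (PathSp n r)) ≤ ENNReal.ofReal K →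
      occM r u (P : Measure (PathSp n r)) V ≤ ENNReal.ofReal ε →
      |∫ ω, g ω * expW σ l θ u ω ∂(P : Measure (PathSp n r)) -
        ∫ ω, expWApprox β g N θ u ω ∂(P : Measure (PathSp n r))| ≤ η / 4 := by
    intro P h1 h2
    refine (h.abs_integral_expW_sub_le hu hK0 h1 hg hg1 hN0 hβ hβB hδ0.le hV.measurableSet hfβ).trans ?_
    have h3 : (occM r u (P : Measure (PathSp n r)) V).toReal ≤ ε := ENNReal.toReal_le_of_le_ofReal hε0.le h2
    have h4 : D * (2 * rateBd C θ * (occM r u (P : Measure (PathSp n r)) V).toReal) ≤ D * (2 * rateBd C θ * ε) := by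
      gcongr
    rw [← hL, ← hD, mul_add]
    linarith
  have hlim := tendsto_integral_of_bdd hμ (continuous_expWApprox hβ hβB hg N θ u)
    (abs_expWApprox_le hβB hg1 hN0 θ hu)
  filter_upwards [hK, hoi, Metric.tendsto_nhds.1 hlim (η / 4) (by positivity)] with i h1 h2 h3
  have h4 := happ (μ i) h1 h2
  have h5 := happ Q hKQ hoQ
  rw [Real.dist_eq] at h3 ⊢
  rw [abs_le] at h4 h5
  rw [abs_lt] at h3 ⊢
  constructor <;> linarith [h3.1, h3.2, h4.1, h4.2, h5.1, h5.2]

lemma integral_mul_expW_eq [F.NeBot] (h : GoodCoef σ l C) (hdet : ∀ z : SpT n, IsUnit (σ z.1 z.2).det)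
    (hμ : Tendsto μ F (𝓝 Q)) (hy : Tendsto y F (𝓝 x₀))
    (hsol : ∀ i, SolvesMP n r σ l (y i) (μ i : Measure (PathSp n r))) (θ : Fin n → ℝ) {s t : ℝ} (hrs : r ≤ s)
    (hst : s ≤ t) {g : PathSp n r → ℝ} (hg : Continuous g) {B : ℝ} (hgB : ∀ ω, |g ω| ≤ B)
    (hgm : Measurable[canonFiltr n r s] g) :
    ∫ ω, g ω * expW σ l θ t ω ∂(Q : Measure (PathSp n r)) = ∫ ω, g ω * expW σ l θ s ω ∂(Q : Measure (PathSp n r)) := by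
  have hB1 : 0 < |B| + 1 := by positivity
  have hcont : Continuous fun ω => (|B| + 1)⁻¹ * g ω := continuous_const.mul hg
  have hle : ∀ ω, |(|B| + 1)⁻¹ * g ω| ≤ 1 := fun ω => by
    rw [abs_mul, abs_of_pos (inv_pos.2 hB1), inv_mul_le_iff₀ hB1]
    linarith [hgB ω, le_abs_self B]
  have h1 := tendsto_integral_expW h hdet hμ hy hsol θ (hrs.trans hst) hcont hle
  have h2 := tendsto_integral_expW h hdet hμ hy hsol θ hrs hcont hle
  have e : ∀ i, ∫ ω, (|B| + 1)⁻¹ * g ω * expW σ l θ t ω ∂(μ i : Measure (PathSp n r)) =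
      ∫ ω, (|B| + 1)⁻¹ * g ω * expW σ l θ s ω ∂(μ i : Measure (PathSp n r)) := by
    intro i
    have h3 := mart_integral h (hsol i) θ hrs hst hgm
    simp only [h.MexpP_eq_expW, mul_assoc] at h3
    rw [integral_const_mul, integral_const_mul] at h3
    have h4 := mul_left_cancel₀ (Real.exp_pos _).ne' h3
    simp only [mul_assoc]
    rw [integral_const_mul, integral_const_mul]
    simp only [mul_comm (g _)]
    rw [h4]
  simp only [e] at h1
  have h5 := tendsto_nhds_unique h1 h2
  simp only [mul_assoc] at h5
  rw [integral_const_mul, integral_const_mul] at h5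
  exact mul_left_cancel₀ (inv_pos.2 hB1).ne' h5

lemma measurable_restrictIcc (s : ℝ) :
    Measurable fun (ω : PathSp n r) (u : Set.Icc r s) => ω ⟨u.1, u.2.1⟩ :=
  measurable_pi_lambda _ fun _ => (continuous_eval_const _).measurable

lemma map_withDensity_expW_eq [F.NeBot] (h : GoodCoef σ l C) (hdet : ∀ z : SpT n, IsUnit (σ z.1 z.2).det)
    (hμ : Tendsto μ F (𝓝 Q)) (hy : Tendsto y F (𝓝 x₀))
    (hsol : ∀ i, SolvesMP n r σ l (y i) (μ i : Measure (PathSp n r))) (θ : Fin n → ℝ) {s t : ℝ} (hrs : r ≤ s)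
    (hst : s ≤ t) (hintg : ∀ u, r ≤ u → Integrable (expW σ l θ u) (Q : Measure (PathSp n r))) :
    ((Q : Measure (PathSp n r)).withDensity fun ω => ENNReal.ofReal (expW σ l θ t ω)).map
        (fun (ω : PathSp n r) (u : Set.Icc r s) => ω ⟨u.1, u.2.1⟩) =
      ((Q : Measure (PathSp n r)).withDensity fun ω => ENNReal.ofReal (expW σ l θ s ω)).map
        (fun (ω : PathSp n r) (u : Set.Icc r s) => ω ⟨u.1, u.2.1⟩) := by
  set ρ : PathSp n r → Set.Icc r s → Fin n → ℝ := fun ω u => ω ⟨u.1, u.2.1⟩ with hρ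
  have hρm : Measurable ρ := measurable_restrictIcc s
  set κ : ℝ → Measure (PathSp n r) := fun u =>
    (Q : Measure (PathSp n r)).withDensity fun ω => ENNReal.ofReal (expW σ l θ u ω) with hκ
  have hfin : ∀ u, r ≤ u → IsFiniteMeasure (κ u) := fun u hu =>
    isFiniteMeasure_withDensity_ofReal (hintg u hu).2
  have := hfin s hrs
  have := hfin t (hrs.trans hst)
  change (κ t).map ρ = (κ s).map ρ
  refine IsProjectiveLimit.unique (P := fun I : Finset (Set.Icc r s) => ((κ s).map ρ).map I.restrict)
    (fun I => ?_) (fun I => rfl)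
  refine ext_of_forall_integral_eq_of_IsFiniteMeasure fun f => ?_
  have hIm : Measurable (I.restrict (π := fun _ => Fin n → ℝ)) := Finset.measurable_restrict I
  have hcont : Continuous fun ω : PathSp n r => f (I.restrict (ρ ω)) :=
    f.continuous.comp (continuous_pi fun i => continuous_eval_const _)
  have e : ∀ u, ∫ z, f z ∂(((κ u).map ρ).map I.restrict) =
      ∫ ω, f (I.restrict (ρ ω)) * expW σ l θ u ω ∂(Q : Measure (PathSp n r)) := by
    intro u
    rw [integral_map hIm.aemeasurable f.continuous.aestronglyMeasurable,
      integral_map (f := fun z => f (I.restrict z)) hρm.aemeasurable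
        (f.continuous.measurable.comp hIm).aestronglyMeasurable, hκ,
      integral_withDensity_eq_integral_toReal_smul (h.measurable_expW θ u).ennreal_ofReal
        (ae_of_all _ fun _ => ENNReal.ofReal_lt_top)]
    refine integral_congr_ae (ae_of_all _ fun ω => ?_)
    simp only [ENNReal.toReal_ofReal (expW_pos θ u ω).le, smul_eq_mul, mul_comm]
  rw [e, e]
  refine integral_mul_expW_eq h hdet hμ hy hsol θ hrs hst hcont (fun ω => f.norm_coe_le_norm _) ?_
  exact (f.continuous.measurable.comp hIm).comp (comap_measurable ρ)

/-- Weak limits of solutions of the martingale problem solve the martingale problem. -/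
theorem SolvesMP.of_tendsto [F.NeBot] (h : GoodCoef σ l C) (hdet : ∀ z : SpT n, IsUnit (σ z.1 z.2).det)
    (hμ : Tendsto μ F (𝓝 Q)) (hy : Tendsto y F (𝓝 x₀))
    (hsol : ∀ i, SolvesMP n r σ l (y i) (μ i : Measure (PathSp n r))) :
    SolvesMP n r σ l x₀ (Q : Measure (PathSp n r)) := by
  refine ⟨?_, fun θ s t hrs hst => ?_⟩
  · have hc : Continuous fun z : Fin n → ℝ => min ‖z - x₀‖ 1 := by fun_prop
    have hcX := hc.comp (continuous_Xcan_path (n := n) (r := r) r)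
    have hb : ∀ ω : PathSp n r, |min ‖Xcan n r r ω - x₀‖ 1| ≤ 1 := fun ω => by
      rw [abs_of_nonneg (le_min (norm_nonneg _) zero_le_one)]; exact min_le_right _ _
    have h1 := tendsto_integral_of_bdd hμ hcX hb
    have h2 : ∀ i, ∫ ω, min ‖Xcan n r r ω - x₀‖ 1 ∂(μ i : Measure (PathSp n r)) = min ‖y i - x₀‖ 1 := fun i => by
      rw [integral_congr_ae (g := fun _ => min ‖y i - x₀‖ 1) ((hsol i).ae_start.mono fun ω hω => by simp only [hω])]
      simp
    have h3 := (hc.tendsto x₀).comp hy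
    simp only [Function.comp_apply, Function.comp_def, h2] at h1 h3
    have h4 := tendsto_nhds_unique h1 h3
    simp only [sub_self, norm_zero, zero_le_one, min_eq_left] at h4
    rw [integral_eq_zero_iff_of_nonneg (fun ω => le_min (norm_nonneg _) zero_le_one)
      (Integrable.of_bound hcX.aestronglyMeasurable 1 (ae_of_all _ hb))] at h4
    have h5 : MeasurableSet {ω : PathSp n r | ω ⟨r, le_refl r⟩ = x₀} :=
      (isClosed_singleton.preimage (continuous_eval_const (⟨r, le_refl r⟩ : Set.Ici r))).measurableSet
    rw [← prob_compl_eq_zero_iff h5]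
    filter_upwards [h4] with ω hω
    have h6 : ‖Xcan n r r ω - x₀‖ = 0 := by
      rcases min_choice ‖Xcan n r r ω - x₀‖ 1 with h7 | h7
      · rw [← h7]; exact hω
      · rw [Pi.zero_apply, h7] at hω; exact absurd hω one_ne_zero
    have h7 := sub_eq_zero.1 (norm_eq_zero.1 h6)
    simpa [Xcan] using h7
  · have hintg : ∀ u, r ≤ u → Integrable (expW σ l θ u) (Q : Measure (PathSp n r)) := fun u hu => by
      obtain ⟨K, hK0, hK⟩ := eventually_lintegral_sq_exp_le h hy hsol θ hu
      exact h.integrable_expW hu (lintegral_le_of_tendsto hμ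
        ((Real.continuous_exp.comp (continuous_dot_Xcan θ u)).pow 2) (fun ω => sq_nonneg _) hK0 hK)
    have e : ∀ u, MexpP n r σ l x₀ θ u = fun ω => Real.exp (-(θ ⬝ᵥ x₀)) * expW σ l θ u ω :=
      fun u => funext fun ω => h.MexpP_eq_expW x₀ θ u ω
    refine ⟨by rw [e]; exact (hintg t (hrs.trans hst)).const_mul _, ?_⟩
    rintro A ⟨S, hS, rfl⟩
    have hm := congrArg (fun ν : Measure (Set.Icc r s → Fin n → ℝ) => ν S)
      (map_withDensity_expW_eq h hdet hμ hy hsol θ hrs hst hintg)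
    have hSm := measurable_restrictIcc (n := n) (r := r) s hS
    simp only [Measure.map_apply (measurable_restrictIcc s) hS, withDensity_apply _ hSm] at hm
    rw [← ofReal_integral_eq_lintegral_ofReal (hintg t (hrs.trans hst)).integrableOn
        (ae_of_all _ fun ω => (expW_pos θ t ω).le),
      ← ofReal_integral_eq_lintegral_ofReal (hintg s hrs).integrableOn (ae_of_all _ fun ω => (expW_pos θ s ω).le),
      ENNReal.ofReal_eq_ofReal_iff (integral_nonneg fun ω => (expW_pos θ t ω).le)
        (integral_nonneg fun ω => (expW_pos θ s ω).le)] at hm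
    rw [e, e, integral_const_mul, integral_const_mul, hm]

end limitIdentification

section continuity

variable {n : ℕ} {r : ℝ} {σ : ℝ → (Fin n → ℝ) → Matrix (Fin n) (Fin n) ℝ}
  {l : ℝ → (Fin n → ℝ) → (Fin n → ℝ)}

lemma GoodCoef.exists_of_bounded (hσc : Continuous (fun p : ℝ × (Fin n → ℝ) => σ p.1 p.2))
    (hσb : ∃ Cb : ℝ, ∀ (u : ℝ) (x : Fin n → ℝ) (i j : Fin n), |σ u x i j| ≤ Cb)
    (hlmeas : Measurable (fun p : ℝ × (Fin n → ℝ) => l p.1 p.2))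
    (hlb : ∃ Bb : ℝ, ∀ (u : ℝ) (x : Fin n → ℝ), ‖l u x‖ ≤ Bb) : ∃ C, GoodCoef σ l C := by
  obtain ⟨Cb, hCb⟩ := hσb
  obtain ⟨Bb, hBb⟩ := hlb
  have h1 : ∀ u x i j, |σ u x i j| ≤ |Cb| := fun u x i j => (hCb u x i j).trans (le_abs_self _)
  have h2 : ∀ u x j, |l u x j| ≤ |Bb| := fun u x j =>
    (norm_le_pi_norm (l u x) j).trans ((hBb u x).trans (le_abs_self _))
  refine ⟨n * (|Cb| * |Bb|) + n * (|Cb| * |Cb|), hσc, hlmeas, by positivity, fun p i => ?_, fun p i j => ?_⟩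
  · have : |((σ p.1 p.2).mulVec (l p.1 p.2)) i| ≤ ∑ _j : Fin n, |Cb| * |Bb| := by
      change |∑ j, σ p.1 p.2 i j * l p.1 p.2 j| ≤ _
      refine (Finset.abs_sum_le_sum_abs _ _).trans (Finset.sum_le_sum fun j _ => ?_)
      rw [abs_mul]
      exact mul_le_mul (h1 _ _ _ _) (h2 _ _ _) (abs_nonneg _) (abs_nonneg _)
    rw [Finset.sum_const, Finset.card_univ, Fintype.card_fin, nsmul_eq_mul] at this
    have h3 : 0 ≤ (n : ℝ) * (|Cb| * |Cb|) := by positivity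
    linarith
  · have : |(σ p.1 p.2 * (σ p.1 p.2)ᵀ) i j| ≤ ∑ _j : Fin n, |Cb| * |Cb| := by
      rw [Matrix.mul_apply]
      refine (Finset.abs_sum_le_sum_abs _ _).trans (Finset.sum_le_sum fun k _ => ?_)
      rw [abs_mul]
      exact mul_le_mul (h1 _ _ _ _) (h1 _ _ _ _) (abs_nonneg _) (abs_nonneg _)
    rw [Finset.sum_const, Finset.card_univ, Fintype.card_fin, nsmul_eq_mul] at this
    have h3 : 0 ≤ (n : ℝ) * (|Cb| * |Bb|) := by positivity
    linarith

lemma isUnit_det_of_elliptic {A : Matrix (Fin n) (Fin n) ℝ}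
    (h : ∀ θ : Fin n → ℝ, θ ≠ 0 → 0 < θ ⬝ᵥ ((A * Aᵀ).mulVec θ)) : IsUnit A.det := by
  rw [isUnit_iff_ne_zero]
  intro h0
  obtain ⟨v, hv, hv0⟩ := Matrix.exists_mulVec_eq_zero_iff.2 (show (Aᵀ).det = 0 by rw [Matrix.det_transpose, h0])
  have := h v hv
  rw [← Matrix.mulVec_mulVec, hv0, Matrix.mulVec_zero, dotProduct_zero] at this
  exact lt_irrefl _ this

end continuity

lemma GoodCoef.isTightMeasureSet {n : ℕ} {r : ℝ} [MeasurableSpace (PathSp n r)] [BorelSpace (PathSp n r)]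
    {σ : ℝ → (Fin n → ℝ) → Matrix (Fin n) (Fin n) ℝ} {l : ℝ → (Fin n → ℝ) → (Fin n → ℝ)} {C : ℝ}
    (h : GoodCoef σ l C) (ρ : ℝ) {Qm : (Fin n → ℝ) → ProbabilityMeasure (PathSp n r)}
    (hsol : ∀ x, SolvesMP n r σ l x (Qm x : Measure (PathSp n r))) :
    IsTightMeasureSet {(μ : Measure (PathSp n r)) | μ ∈ Qm '' {x | ‖x‖ ≤ ρ}} := by
  rw [isTightMeasureSet_iff_exists_isCompact_measure_compl_le]
  intro ε hε
  obtain ⟨δ, hδ0, hδ⟩ := ENNReal.lt_iff_exists_nnreal_btwn.1 hε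
  obtain ⟨M, hM⟩ := SolvesMP.exists_modSet (n := n) (r := r) h ρ
    (show (0 : ℝ) < δ from NNReal.coe_pos.2 (ENNReal.coe_pos.1 hδ0))
  refine ⟨_, isCompact_modSet M ρ, ?_⟩
  rintro _ ⟨_, ⟨x, hx, rfl⟩, rfl⟩
  refine (hM x hx _ (hsol x)).trans ?_
  rw [ENNReal.ofReal_coe_nnreal]
  exact hδ.le

/-- **Weak continuity of the martingale-problem solutions in the starting point.**
Fix `r ≥ 0`, `σ` continuous bounded with `a = σσ*` strictly elliptic and `λ`
bounded Borel.  The map `x ↦ Q^{σ,λ}_{r,x}` (the unique solution of the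
martingale problem starting from `x` at time `r`) is continuous for the weak
topology on probability measures on path space. -/
theorem stmt14 (n : ℕ) (r : ℝ) (hr : 0 ≤ r)
    [MeasurableSpace (PathSp n r)] [BorelSpace (PathSp n r)]
    (σ : ℝ → (Fin n → ℝ) → Matrix (Fin n) (Fin n) ℝ)
    (l : ℝ → (Fin n → ℝ) → (Fin n → ℝ))
    (hσc : Continuous (fun p : ℝ × (Fin n → ℝ) => σ p.1 p.2))
    (hσb : ∃ Cb : ℝ, ∀ (u : ℝ) (x : Fin n → ℝ) (i j : Fin n), |σ u x i j| ≤ Cb)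
    (hell : ∀ (u : ℝ) (x θ : Fin n → ℝ), θ ≠ 0 →
      0 < θ ⬝ᵥ ((σ u x * (σ u x)ᵀ).mulVec θ))
    (hlmeas : Measurable (fun p : ℝ × (Fin n → ℝ) => l p.1 p.2))
    (hlb : ∃ Bb : ℝ, ∀ (u : ℝ) (x : Fin n → ℝ), ‖l u x‖ ≤ Bb)
    (Qm : (Fin n → ℝ) → ProbabilityMeasure (PathSp n r))
    (hsol : ∀ x, SolvesMP n r σ l x (Qm x : Measure (PathSp n r)))
    (huniq : ∀ (x : Fin n → ℝ) (P : ProbabilityMeasure (PathSp n r)),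
      SolvesMP n r σ l x (P : Measure (PathSp n r)) → P = Qm x) :
    Continuous Qm := by
  obtain ⟨C, h⟩ := GoodCoef.exists_of_bounded hσc hσb hlmeas hlb
  refine continuous_iff_continuousAt.2 fun x₀ => (tendsto_iff_ultrafilter _ _ _).2 fun U hU => ?_
  have hball : {x : Fin n → ℝ | ‖x‖ ≤ ‖x₀‖ + 1} ∈ U :=
    hU ((continuous_norm.tendsto x₀).eventually (ge_mem_nhds (lt_add_one ‖x₀‖)))
  obtain ⟨Q, -, hQ⟩ := (isCompact_closure_of_isTightMeasureSet
    (h.isTightMeasureSet (‖x₀‖ + 1) hsol)).ultrafilter_le_nhds (U.map Qm)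
    (le_principal_iff.2 (mem_of_superset (image_mem_map hball) subset_closure))
  have hQ' : Tendsto Qm U (𝓝 Q) := hQ
  rwa [huniq x₀ Q (SolvesMP.of_tendsto h (fun z => isUnit_det_of_elliptic (hell z.1 z.2)) hQ' hU hsol)] at hQ'
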